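/- Fix i ∈ {1,…,N} and let (r_ε) be a sequence of positive reals with r_ε ≤ r_{i,ε} and D(x_{i,ε}, r_ε) ⊂ Ω. If B_{i,ε}(r_ε) ≥ δ γ_{i,ε} for some δ > 0 and all ε, then there exists C > 0 such that |u_ε − B_{i,ε}| ≤ C/γ_{i,ε} on D(x_{i,ε}, r_ε); moreover the spherical mean satisfies (1/2πr_ε) ∫_{∂D(x_{i,ε},r_ε)} u_ε dσ = B_{i,ε}(r_ε) + o(γ_{i,ε}⁻¹) as ε → 0. -/

import Mathlib

open Metric Set Filter Topology Real MeasureTheory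
open scoped RealInnerProductSpace

noncomputable section

/-- Points of the plane. -/
abbrev Pt := EuclideanSpace ℝ (Fin 2)

/-- The geometer's Laplacian `Δu = -(∂²u/∂x² + ∂²u/∂y²)`. -/
def lap (u : Pt → ℝ) (x : Pt) : ℝ :=
  - ∑ i : Fin 2, fderiv ℝ (fun y => fderiv ℝ u y (EuclideanSpace.single i 1)) x
      (EuclideanSpace.single i 1)

/-- Convergence in `C^k(s)`: uniform convergence on `s` of all derivatives of order `≤ k`. -/
def TendstoCkOn (F : ℕ → Pt → ℝ) (g : Pt → ℝ) (s : Set Pt) (k : ℕ) : Prop :=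
  ∀ j : ℕ, j ≤ k → TendstoUniformlyOn (fun n x => iteratedFDeriv ℝ j (F n) x)
    (fun x => iteratedFDeriv ℝ j g x) atTop s

/-- Convergence in `C^k_loc(s)`: locally uniform convergence on `s` of all derivatives of
order `≤ k`. -/
def TendstoCkLocOn (F : ℕ → Pt → ℝ) (g : Pt → ℝ) (s : Set Pt) (k : ℕ) : Prop :=
  ∀ j : ℕ, j ≤ k → TendstoLocallyUniformlyOn (fun n x => iteratedFDeriv ℝ j (F n) x)
    (fun x => iteratedFDeriv ℝ j g x) atTop s

/-- The standard bubble profile `U(x) = -ln(1 + |x|²/4)`. -/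
def Ustd (x : Pt) : ℝ := - Real.log (1 + ‖x‖ ^ 2 / 4)

/-- The point of the plane with coordinates `(a, b)`. -/
def mkPt (a b : ℝ) : Pt := (WithLp.equiv 2 (Fin 2 → ℝ)).symm ![a, b]

/-- Spherical mean `(1/(2πr)) ∫_{∂D(c,r)} v dσ`, written via the parametrization of the
circle of radius `r` around `c`. -/
def sphAvg (v : Pt → ℝ) (c : Pt) (r : ℝ) : ℝ :=
  (2 * π)⁻¹ * ∫ θ in (0 : ℝ)..(2 * π), v (c + r • mkPt (Real.cos θ) (Real.sin θ))

lemma eventually_right_nonneg {g : ℝ → ℝ} {g' x : ℝ} (hg : HasDerivAt g g' x) (h0 : 0 ≤ g x)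
    (h1 : g x = 0 → 0 < g') : ∀ᶠ y in 𝓝[>] x, 0 ≤ g y := by
  rcases h0.lt_or_eq with h | h
  · exact ((hg.continuousAt.eventually (lt_mem_nhds h)).mono fun y hy => hy.le).filter_mono
      nhdsWithin_le_nhds
  · have hs := hasDerivAt_iff_tendsto_slope.1 hg
    have h2 : ∀ᶠ y in 𝓝[≠] x, 0 < slope g x y := hs.eventually (lt_mem_nhds (h1 h.symm))
    have h3 : ∀ᶠ y in 𝓝[>] x, 0 < slope g x y :=
      h2.filter_mono (nhdsWithin_mono _ fun y hy => ne_of_gt hy)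
    filter_upwards [h3, self_mem_nhdsWithin] with y hy hxy
    have hxy' : 0 < y - x := sub_pos.2 hxy
    rw [slope_def_field, ← h, sub_zero] at hy
    exact (by simpa [div_pos_iff_of_pos_right hxy'] using hy : 0 < g y).le

/-- Barrier principle for a relaxation system `m' = -p m + R`, `b' = q (m - b)`. -/
lemma relaxation_bound {m b R K κ : ℝ → ℝ} {p q ε s₀ K₁ : ℝ} (hp : 0 ≤ p) (hq : 0 ≤ q)
    (hε : 0 < ε)
    (hm : ∀ s ≤ s₀, HasDerivAt m (-p * m s + R s) s)
    (hb : ∀ s ≤ s₀, HasDerivAt b (q * (m s - b s)) s)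
    (hR : ∀ s ≤ s₀, |R s| ≤ κ s * (|b s| + ε)) (hκ : ∀ s, 0 < κ s)
    (hK : ∀ s, HasDerivAt K (κ s) s) (hK0 : ∀ s, 0 ≤ K s) (hK1 : ∀ s ≤ s₀, K s ≤ K₁)
    (hm0 : Tendsto m atBot (𝓝 0)) (hb0 : Tendsto b atBot (𝓝 0)) :
    ∀ s ≤ s₀, |m s| ≤ 2 * ε * exp (2 * K₁) ∧ |b s| ≤ 2 * ε * exp (2 * K₁) := by
  intro s hs
  set P : ℝ → ℝ := fun s => 2 * ε * exp (2 * K s) with hP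
  have hPd : ∀ s, HasDerivAt P (2 * κ s * P s) s := by
    intro s
    have := (((hK s).const_mul 2).exp).const_mul (2 * ε)
    exact this.congr_deriv (by simp only [hP]; ring)
  have hPge : ∀ s, 2 * ε ≤ P s := fun s => by
    have : 1 ≤ exp (2 * K s) := one_le_exp (by linarith [hK0 s])
    simp only [hP]; nlinarith
  have hev : ∀ᶠ t in atBot, |m t| < ε ∧ |b t| < ε ∧ t ≤ s := by
    have h1 := hm0.abs.eventually (gt_mem_nhds (by simpa using hε))
    have h2 := hb0.abs.eventually (gt_mem_nhds (by simpa using hε))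
    filter_upwards [h1, h2, eventually_le_atBot s] with t h1 h2 h3 using ⟨h1, h2, h3⟩
  obtain ⟨s₁, h1m, h1b, h1s⟩ := hev.exists
  set S : Set ℝ := {t | |m t| ≤ P t ∧ |b t| ≤ P t} with hS
  have hPc : Continuous P := continuous_iff_continuousAt.2 fun t => (hPd t).continuousAt
  have hsub : Icc s₁ s ⊆ S := by
    apply IsClosed.Icc_subset_of_forall_exists_gt
    · have e : S ∩ Icc s₁ s = {t ∈ Icc s₁ s | |m t| ≤ P t} ∩ {t ∈ Icc s₁ s | |b t| ≤ P t} := by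
        ext t; simp only [hS, mem_inter_iff, mem_ofPred_eq]; tauto
      have cm : ContinuousOn m (Icc s₁ s) := fun t ht =>
        (hm t (ht.2.trans hs)).continuousAt.continuousWithinAt
      have cb : ContinuousOn b (Icc s₁ s) := fun t ht =>
        (hb t (ht.2.trans hs)).continuousAt.continuousWithinAt
      rw [e]
      exact (isClosed_Icc.isClosed_le cm.abs hPc.continuousOn).inter
        (isClosed_Icc.isClosed_le cb.abs hPc.continuousOn)
    · exact ⟨by linarith [hPge s₁], by linarith [hPge s₁]⟩
    · rintro x ⟨⟨hxm, hxb⟩, hx1, hx2⟩ y hy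
      have hxs : x ≤ s₀ := hx2.le.trans hs
      have hRx := hR x hxs
      have hκx := hκ x
      have hPx := hPge x
      obtain ⟨m1, m2⟩ := abs_le.1 hxm
      obtain ⟨b1, b2⟩ := abs_le.1 hxb
      obtain ⟨R1, R2⟩ := abs_le.1 hRx
      have hRP : κ x * (|b x| + ε) < 2 * κ x * P x := by nlinarith
      have e1 := eventually_right_nonneg ((hPd x).sub (hm x hxs)) (by simpa using m2)
        (fun h => by
          have : m x = P x := by simp at h; linarith
          rw [this]
          nlinarith [mul_nonneg hp (by linarith : 0 ≤ P x)])
      have e2 := eventually_right_nonneg ((hPd x).add (hm x hxs)) (by simp; linarith)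
        (fun h => by
          have : m x = - P x := by simp at h; linarith
          rw [this]
          nlinarith [mul_nonneg hp (by linarith : 0 ≤ P x)])
      have e3 := eventually_right_nonneg ((hPd x).sub (hb x hxs)) (by simpa using b2)
        (fun h => by
          have : b x = P x := by simp at h; linarith
          rw [this]
          nlinarith [mul_nonneg hq (by linarith : 0 ≤ P x - m x),
            mul_pos hκx (by linarith : 0 < P x)])
      have e4 := eventually_right_nonneg ((hPd x).add (hb x hxs)) (by simp; linarith)
        (fun h => by
          have : b x = - P x := by simp at h; linarith
          rw [this]
          nlinarith [mul_nonneg hq (by linarith : 0 ≤ P x + m x),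
            mul_pos hκx (by linarith : 0 < P x)])
      have e5 : ∀ᶠ z in 𝓝[>] x, z ∈ Ioc x y := Ioc_mem_nhdsGT hy
      obtain ⟨z, h1, h2, h3, h4, h5⟩ := (e1.and (e2.and (e3.and (e4.and e5)))).exists
      simp at h1 h2 h3 h4
      exact ⟨z, ⟨abs_le.2 ⟨by linarith, by linarith⟩, abs_le.2 ⟨by linarith, by linarith⟩⟩, h5⟩
  have hle : P s ≤ 2 * ε * exp (2 * K₁) := by
    simp only [hP]; gcongr; exact hK1 s hs
  obtain ⟨h1, h2⟩ := hsub ⟨h1s, le_rfl⟩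
  exact ⟨h1.trans hle, h2.trans hle⟩

lemma deriv_test_max {ψ ψ1 : ℝ → ℝ} {ψ2 x : ℝ} (h1 : ∀ᶠ s in 𝓝 x, HasDerivAt ψ (ψ1 s) s)
    (h2 : HasDerivAt ψ1 ψ2 x) (hmax : IsLocalMax ψ x) : ψ1 x = 0 ∧ ψ2 ≤ 0 := by
  have h0 : ψ1 x = 0 := hmax.hasDerivAt_eq_zero h1.self_of_nhds
  refine ⟨h0, ?_⟩
  by_contra! hpos
  have hd : deriv ψ =ᶠ[𝓝 x] ψ1 := h1.mono fun s hs => hs.deriv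
  have hmin : IsLocalMin ψ x := by
    apply isLocalMin_of_deriv_deriv_pos
    · rw [hd.deriv_eq, h2.deriv]; exact hpos
    · rw [hd.eq_of_nhds, h0]
    · exact h1.self_of_nhds.continuousAt
  have hc : ∀ᶠ s in 𝓝 x, ψ s = ψ x := by
    filter_upwards [hmax, hmin] with s a b using le_antisymm a b
  have hc2 : ∀ᶠ s in 𝓝 x, ψ1 s = 0 := by
    filter_upwards [hc.eventually_nhds, h1] with s a b
    have : HasDerivAt ψ 0 s := (hasDerivAt_const s (ψ x)).congr_of_eventuallyEq a
    exact b.unique this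
  have : HasDerivAt ψ1 0 x := (hasDerivAt_const x (0:ℝ)).congr_of_eventuallyEq hc2
  have := h2.unique this
  linarith

/-- Maximum principle with barrier `A² e^{2s}`. -/
lemma energy_barrier {E E1 E2 Z g : ℝ → ℝ} {A s₀ : ℝ} (hA : 0 < A)
    (hE0 : ∀ s ≤ s₀, 0 ≤ E s)
    (hE : ∀ s ≤ s₀, HasDerivAt E (E1 s) s) (hE1 : ∀ s ≤ s₀, HasDerivAt E1 (E2 s) s)
    (hCS : ∀ s ≤ s₀, E1 s ^ 2 ≤ 4 * E s * Z s)
    (hE2 : ∀ s ≤ s₀, 2 * Z s + 3 * E s - 2 * √(E s) * g s ≤ E2 s)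
    (hg : ∀ s ≤ s₀, g s ≤ A / 2 * exp s) (hend : E s₀ ≤ A ^ 2 * exp (2 * s₀))
    (hbot : ∀ᶠ s in atBot, E s ≤ A ^ 2 * exp (2 * s)) :
    ∀ s ≤ s₀, E s ≤ A ^ 2 * exp (2 * s) := by
  intro t ht
  by_contra! hlt
  set Φ : ℝ → ℝ := fun s => A ^ 2 * exp (2 * s) with hΦ
  have hΦd : ∀ s, HasDerivAt Φ (2 * Φ s) s := fun s => by
    have := (((hasDerivAt_id s).const_mul 2).exp).const_mul (A ^ 2)
    exact this.congr_deriv (by simp only [hΦ, id]; ring)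
  obtain ⟨s₁, hs1⟩ := eventually_atBot.1 hbot
  have hs1t : s₁ < t := by
    by_contra! h
    exact absurd (hs1 t h) (not_le.2 hlt)
  have cont : ContinuousOn (fun s => E s - Φ s) (Icc s₁ s₀) := fun s hs =>
    ((hE s hs.2).continuousAt.sub (hΦd s).continuousAt).continuousWithinAt
  obtain ⟨x, hx, hmax⟩ := isCompact_Icc.exists_isMaxOn ⟨t, hs1t.le, ht⟩ cont
  have hxt : E t - Φ t ≤ E x - Φ x := hmax ⟨hs1t.le, ht⟩
  have hxp : 0 < E x - Φ x := by simp only [hΦ] at hxt ⊢; linarith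
  have hx1 : s₁ < x := lt_of_le_of_ne hx.1 fun h => by
    have := hs1 s₁ le_rfl; rw [← h] at hxp; simp only [hΦ] at hxp; linarith
  have hx0 : x < s₀ := lt_of_le_of_ne hx.2 fun h => by
    rw [h] at hxp; simp only [hΦ] at hxp; linarith
  have hloc : IsLocalMax (fun s => E s - Φ s) x := hmax.isLocalMax (Icc_mem_nhds hx1 hx0)
  have hd2 : HasDerivAt (fun s => E1 s - 2 * Φ s) (E2 x - 2 * (2 * Φ x)) x :=
    (hE1 x hx.2).sub ((hΦd x).const_mul 2)
  obtain ⟨h1, h2⟩ := deriv_test_max (ψ1 := fun s => E1 s - 2 * Φ s)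
    ((isOpen_Iio.eventually_mem hx0).mono fun s hs => (hE s (le_of_lt hs)).sub (hΦd s)) hd2 hloc
  have hΦx : 0 < Φ x := by simp only [hΦ]; positivity
  have hcs := hCS x hx.2
  have hgx := hg x hx.2
  have h3 := hE2 x hx.2
  have hsq : √(E x) ^ 2 = E x := Real.sq_sqrt (hE0 x hx.2)
  have hAe : A * exp x < √(E x) := by
    apply Real.lt_sqrt_of_sq_lt
    have : (A * exp x) ^ 2 = Φ x := by
      simp only [hΦ]; rw [mul_pow, ← Real.exp_nat_mul]; norm_num
    linarith
  have hE1x : E1 x = 2 * Φ x := by linarith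
  rw [hE1x] at hcs
  have hsp : 0 < √(E x) := lt_trans (by positivity) hAe
  have h4 : 2 * √(E x) * g x < E x := by nlinarith
  have hEx : 0 < E x := by linarith
  have h5 : Z x < 2 * Φ x - E x := by linarith
  nlinarith [sq_nonneg (Φ x - E x)]

/-- A function with nonnegative derivative vanishing at `-∞` is nonnegative. -/
lemma nonneg_of_deriv_nonneg_atBot {g g' : ℝ → ℝ} {s₀ : ℝ}
    (hg : ∀ s ≤ s₀, HasDerivAt g (g' s) s) (h0 : ∀ s ≤ s₀, 0 ≤ g' s)
    (hbot : Tendsto g atBot (𝓝 0)) : ∀ s ≤ s₀, 0 ≤ g s := by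
  intro s hs
  have h2 : interior (Iic s₀) ⊆ Iic s₀ := interior_subset
  have hmono : MonotoneOn g (Iic s₀) := by
    apply monotoneOn_of_deriv_nonneg (convex_Iic s₀)
    · exact fun t ht => (hg t ht).continuousAt.continuousWithinAt
    · intro t ht
      exact (hg t (h2 ht)).differentiableAt.differentiableWithinAt
    · intro t ht
      rw [(hg t (h2 ht)).deriv]
      exact h0 t (h2 ht)
  refine le_of_tendsto hbot ?_
  filter_upwards [eventually_le_atBot s] with t ht
  exact hmono (ht.trans hs) hs ht

lemma fourierCoeffOn_two_pi (z : ℝ → ℝ) (hz : Continuous z) (n : ℤ) :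
    fourierCoeffOn (two_pi_pos) (fun θ => (z θ : ℂ)) n =
      (2 * π : ℂ)⁻¹ * (((∫ θ in 0..2 * π, z θ * cos (n * θ) : ℝ) : ℂ)
        - Complex.I * ((∫ θ in 0..2 * π, z θ * sin (n * θ) : ℝ) : ℂ)) := by
  rw [fourierCoeffOn_eq_integral]
  rw [← intervalIntegral.integral_ofReal, ← intervalIntegral.integral_ofReal,
    ← intervalIntegral.integral_const_mul, ← intervalIntegral.integral_sub]
  · rw [Complex.real_smul]
    congr 1
    · push_cast; simp
    · apply intervalIntegral.integral_congr
      intro θ _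
      simp only [fourier_coe_apply, smul_eq_mul, sub_zero]
      have : (2 * π * Complex.I * ((-n : ℤ) : ℂ) * θ / ((2 * π : ℝ) : ℂ))
          = ((-(n * θ) : ℝ) : ℂ) * Complex.I := by
        have : (π : ℂ) ≠ 0 := by exact_mod_cast pi_ne_zero
        push_cast; field_simp
      rw [this, Complex.exp_mul_I, ← Complex.ofReal_cos, ← Complex.ofReal_sin]
      simp only [Real.cos_neg, Real.sin_neg]
      push_cast; ring
  · exact Continuous.intervalIntegrable (by fun_prop) _ _
  · exact Continuous.intervalIntegrable (by fun_prop) _ _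

/-- Wirtinger's inequality for functions without modes `0` and `±1`. -/
lemma wirtinger_two {z z' : ℝ → ℝ} (hz : ∀ θ, HasDerivAt z (z' θ) θ) (hz' : Continuous z')
    (hper : z (2 * π) = z 0) (h0 : ∫ θ in 0..2 * π, z θ = 0)
    (hc : ∫ θ in 0..2 * π, z θ * cos θ = 0) (hs : ∫ θ in 0..2 * π, z θ * sin θ = 0) :
    4 * ∫ θ in 0..2 * π, z θ ^ 2 ≤ ∫ θ in 0..2 * π, z' θ ^ 2 := by
  have hzc : Continuous z := continuous_iff_continuousAt.2 fun t => (hz t).continuousAt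
  have memlp : ∀ g : ℝ → ℝ, Continuous g →
      MemLp (fun θ => (g θ : ℂ)) 2 (volume.restrict (Ioc 0 (2 * π))) := by
    intro g hg
    have : Continuous fun θ => (g θ : ℂ) := by fun_prop
    obtain ⟨B, hB⟩ := (isCompact_Icc (a := (0 : ℝ)) (b := 2 * π)).exists_bound_of_continuousOn
      this.continuousOn
    refine MemLp.of_bound this.aestronglyMeasurable B ?_
    filter_upwards [ae_restrict_mem measurableSet_Ioc] with θ hθ
    exact hB θ (Ioc_subset_Icc_self hθ)
  have H1 := hasSum_sq_fourierCoeffOn two_pi_pos (memlp z hzc)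
  have H2 := hasSum_sq_fourierCoeffOn two_pi_pos (memlp z' hz')
  have hle : ∀ n : ℤ, 4 * ‖fourierCoeffOn two_pi_pos (fun θ => (z θ : ℂ)) n‖ ^ 2 ≤
      ‖fourierCoeffOn two_pi_pos (fun θ => (z' θ : ℂ)) n‖ ^ 2 := by
    intro n
    by_cases hn : n = 0 ∨ n = 1 ∨ n = -1
    · have : fourierCoeffOn two_pi_pos (fun θ => (z θ : ℂ)) n = 0 := by
        rw [fourierCoeffOn_two_pi z hzc]
        rcases hn with rfl | rfl | rfl <;> simp [h0, hc, hs]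
      rw [this]; simp
    · push Not at hn
      obtain ⟨hn0, hn1, hn2⟩ := hn
      have h2 : (2 : ℝ) ≤ |(n : ℝ)| := by
        have : (2 : ℤ) ≤ |n| := by
          rcases abs_cases n with h | h <;> omega
        exact_mod_cast this
      have := fourierCoeffOn_of_hasDerivAt two_pi_pos (f := fun θ => (z θ : ℂ))
        (f' := fun θ => (z' θ : ℂ)) hn0 (fun x _ => (hz x).ofReal_comp)
        (Continuous.intervalIntegrable (by fun_prop) _ _)
      rw [this]
      rw [hper]
      simp only [sub_self, mul_zero, zero_sub]
      rw [norm_mul, norm_neg, norm_mul]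
      have e : ‖(1 : ℂ) / (-2 * π * Complex.I * n)‖ = 1 / (2 * π * |(n : ℝ)|) := by
        simp [abs_of_pos pi_pos]
      have e2 : ‖(((2 * π : ℝ) : ℂ) - ((0 : ℝ) : ℂ))‖ = 2 * π := by
        simp [abs_of_pos pi_pos]
      rw [e, e2]
      set X := ‖fourierCoeffOn two_pi_pos (fun θ => (z' θ : ℂ)) n‖
      have e3 : 1 / (2 * π * |(n : ℝ)|) * (2 * π * X) = X / |(n : ℝ)| := by
        have : |(n : ℝ)| ≠ 0 := by linarith
        field_simp
      rw [e3, div_pow, ← mul_div_assoc, div_le_iff₀ (by positivity)]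
      nlinarith [sq_nonneg X, mul_le_mul_of_nonneg_left
        (by nlinarith : (4 : ℝ) ≤ |(n : ℝ)| ^ 2) (sq_nonneg X)]
  have := hasSum_le hle (H1.mul_left 4) H2
  simp only [sub_zero, smul_eq_mul, Complex.norm_real, Real.norm_eq_abs, sq_abs] at this
  have hpos : 0 < (2 * π)⁻¹ := by positivity
  rw [mul_left_comm] at this
  exact le_of_mul_le_mul_left this hpos

/-- Differentiation under the integral sign over a period. -/
lemma hasDerivAt_integral_param {F F' : ℝ → ℝ → ℝ} {S s : ℝ} (hs : s < S)
    (hF : ∀ s < S, ∀ θ, HasDerivAt (fun t => F t θ) (F' s θ) s)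
    (hc : ContinuousOn (Function.uncurry F) (Iio S ×ˢ univ))
    (hc' : ContinuousOn (Function.uncurry F') (Iio S ×ˢ univ)) :
    HasDerivAt (fun t => ∫ θ in 0..2 * π, F t θ) (∫ θ in 0..2 * π, F' s θ) s := by
  have slice : ∀ G : ℝ → ℝ → ℝ, ContinuousOn (Function.uncurry G) (Iio S ×ˢ univ) →
      ∀ t < S, Continuous (G t) := by
    intro G hG t ht
    have := hG.comp (f := fun θ : ℝ => (t, θ)) (s := univ) (by fun_prop)
      (fun θ _ => ⟨ht, mem_univ _⟩)
    exact continuousOn_univ.1 this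
  obtain ⟨d, hd0, hd⟩ : ∃ d > 0, s + d < S := ⟨(S - s) / 2, by linarith, by linarith⟩
  have hsub : Icc (s - d) (s + d) ×ˢ Icc 0 (2 * π) ⊆ Iio S ×ˢ (univ : Set ℝ) :=
    prod_mono (fun t ht => lt_of_le_of_lt ht.2 hd) (subset_univ _)
  obtain ⟨B, hB⟩ := (isCompact_Icc.prod isCompact_Icc).exists_bound_of_continuousOn
    (hc'.mono hsub)
  have hmem : Ioo (s - d) (s + d) ∈ 𝓝 s := Ioo_mem_nhds (by linarith) (by linarith)
  refine (intervalIntegral.hasDerivAt_integral_of_dominated_loc_of_deriv_le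
    (F := F) (F' := F') (bound := fun _ => B) (s := Ioo (s - d) (s + d)) hmem ?_ ?_ ?_ ?_ ?_ ?_).2
  · filter_upwards [hmem] with t ht
    exact (slice F hc t (ht.2.trans hd)).aestronglyMeasurable
  · exact (slice F hc s hs).intervalIntegrable _ _
  · exact (slice F' hc' s hs).aestronglyMeasurable
  · refine ae_of_all _ fun θ hθ t ht => ?_
    rw [uIoc_of_le two_pi_pos.le] at hθ
    exact hB (t, θ) ⟨Ioo_subset_Icc_self ht, Ioc_subset_Icc_self hθ⟩
  · exact intervalIntegrable_const
  · exact ae_of_all _ fun θ _ t ht => hF t (ht.2.trans hd) θ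

lemma integral_cauchy_schwarz {f g : ℝ → ℝ} (hf : Continuous f) (hg : Continuous g) :
    (∫ θ in 0..2 * π, f θ * g θ) ^ 2 ≤
      (∫ θ in 0..2 * π, f θ ^ 2) * ∫ θ in 0..2 * π, g θ ^ 2 := by
  set a := ∫ θ in 0..2 * π, f θ ^ 2
  set b := ∫ θ in 0..2 * π, f θ * g θ
  set c := ∫ θ in 0..2 * π, g θ ^ 2
  have h : ∀ x : ℝ, 0 ≤ a * (x * x) + (2 * b) * x + c := by
    intro x
    have e : ∫ θ in 0..2 * π, (x * f θ + g θ) ^ 2 = a * (x * x) + (2 * b) * x + c := by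
      have : ∀ θ, (x * f θ + g θ) ^ 2 = (x * x) * f θ ^ 2 + (2 * x) * (f θ * g θ) + g θ ^ 2 :=
        fun θ => by ring
      simp_rw [this]
      rw [intervalIntegral.integral_add, intervalIntegral.integral_add,
        intervalIntegral.integral_const_mul, intervalIntegral.integral_const_mul]
      · ring
      all_goals exact Continuous.intervalIntegrable (by fun_prop) _ _
    rw [← e]
    exact intervalIntegral.integral_nonneg two_pi_pos.le fun θ _ => sq_nonneg _
  have := discrim_le_zero h
  unfold discrim at this
  nlinarith

lemma integral_congr_of_continuous_add {f g : ℝ → ℝ} (hf : Continuous f) (hg : Continuous g) :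
    ∫ θ in 0..2 * π, (f θ + g θ) = (∫ θ in 0..2 * π, f θ) + ∫ θ in 0..2 * π, g θ :=
  intervalIntegral.integral_add (hf.intervalIntegrable _ _) (hg.intervalIntegrable _ _)

lemma integral_period_parts {f f' g g' : ℝ → ℝ} (hf : ∀ θ, HasDerivAt f (f' θ) θ)
    (hg : ∀ θ, HasDerivAt g (g' θ) θ) (hf' : Continuous f') (hg' : Continuous g')
    (hfp : f (2 * π) = f 0) (hgp : g (2 * π) = g 0) :
    ∫ θ in 0..2 * π, f' θ * g θ = - ∫ θ in 0..2 * π, f θ * g' θ := by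
  have := intervalIntegral.integral_deriv_mul_eq_sub (a := 0) (b := 2 * π) (u := f) (v := g)
    (u' := f') (v' := g') (fun x _ => hf x) (fun x _ => hg x)
    (hf'.intervalIntegrable _ _) (hg'.intervalIntegrable _ _)
  rw [hfp, hgp, sub_self, integral_congr_of_continuous_add] at this
  · linarith
  · exact hf'.mul (continuous_iff_continuousAt.2 fun t => (hg t).continuousAt)
  · exact (continuous_iff_continuousAt.2 fun t => (hf t).continuousAt).mul hg'

/-- Component of a function on the circle orthogonal to the Fourier modes `0` and `±1`. -/
def highPart (f : ℝ → ℝ) (θ : ℝ) : ℝ :=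
  f θ - (∫ x in 0..2 * π, f x) / (2 * π)
    - ((∫ x in 0..2 * π, f x * cos x) * cos θ + (∫ x in 0..2 * π, f x * sin x) * sin θ) / π

/-- The bilinear form `∫ (highPart f) (highPart g)`, in expanded form. -/
def highInner (f g : ℝ → ℝ) : ℝ :=
  (∫ x in 0..2 * π, f x * g x) - (∫ x in 0..2 * π, f x) * (∫ x in 0..2 * π, g x) / (2 * π)
    - ((∫ x in 0..2 * π, f x * cos x) * (∫ x in 0..2 * π, g x * cos x)
      + (∫ x in 0..2 * π, f x * sin x) * (∫ x in 0..2 * π, g x * sin x)) / π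

lemma continuous_highPart {f : ℝ → ℝ} (hf : Continuous f) : Continuous (highPart f) := by
  unfold highPart; fun_prop

lemma integral_highPart_mul {f g : ℝ → ℝ} (hf : Continuous f) (hg : Continuous g) :
    ∫ x in 0..2 * π, highPart f x * g x = highInner f g := by
  unfold highPart highInner
  set a := ∫ x in 0..2 * π, f x
  set b := ∫ x in 0..2 * π, f x * cos x
  set c := ∫ x in 0..2 * π, f x * sin x
  have : ∀ x, (f x - a / (2 * π) - (b * cos x + c * sin x) / π) * g x =
      f x * g x - a / (2 * π) * g x - (b / π * (g x * cos x) + c / π * (g x * sin x)) :=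
    fun x => by ring
  simp_rw [this]
  rw [intervalIntegral.integral_sub, intervalIntegral.integral_sub, intervalIntegral.integral_add,
    intervalIntegral.integral_const_mul, intervalIntegral.integral_const_mul,
    intervalIntegral.integral_const_mul]
  · ring
  all_goals exact Continuous.intervalIntegrable (by fun_prop) _ _

lemma integral_cos_sq_period : ∫ x in 0..2 * π, cos x * cos x = π := by
  have := integral_cos_sq (a := 0) (b := 2 * π)
  simp only [pow_two] at this
  rw [this]; simp

lemma integral_sin_sq_period : ∫ x in 0..2 * π, sin x * sin x = π := by
  have := integral_sin_sq (a := 0) (b := 2 * π)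
  simp only [pow_two] at this
  rw [this]; simp

lemma integral_sin_cos_period : ∫ x in 0..2 * π, sin x * cos x = 0 := by
  rw [integral_sin_mul_cos₁]; simp

lemma integral_cos_sin_period : ∫ x in 0..2 * π, cos x * sin x = 0 := by
  simp_rw [mul_comm (cos _)]; exact integral_sin_cos_period

lemma integral_highPart {f : ℝ → ℝ} (hf : Continuous f) :
    ∫ x in 0..2 * π, highPart f x = 0 := by
  have := integral_highPart_mul hf (g := fun _ => 1) continuous_const
  simp only [mul_one] at this
  rw [this]
  unfold highInner
  simp

lemma integral_highPart_cos {f : ℝ → ℝ} (hf : Continuous f) :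
    ∫ x in 0..2 * π, highPart f x * cos x = 0 := by
  rw [integral_highPart_mul hf continuous_cos]
  unfold highInner
  rw [integral_cos_sq_period, integral_cos_sin_period]
  simp

lemma integral_highPart_sin {f : ℝ → ℝ} (hf : Continuous f) :
    ∫ x in 0..2 * π, highPart f x * sin x = 0 := by
  rw [integral_highPart_mul hf continuous_sin]
  unfold highInner
  rw [integral_sin_sq_period, integral_sin_cos_period]
  simp

lemma integral_mul_highPart {f g : ℝ → ℝ} (hf : Continuous f) (hg : Continuous g) :
    ∫ x in 0..2 * π, highPart f x * highPart g x = highInner f g := by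
  have hh := continuous_highPart hf
  rw [← integral_highPart_mul hf hg]
  conv_lhs => enter [1, x]; rw [highPart.eq_1 g]
  set a := ∫ x in 0..2 * π, g x
  set b := ∫ x in 0..2 * π, g x * cos x
  set c := ∫ x in 0..2 * π, g x * sin x
  have : ∀ x, highPart f x * (g x - a / (2 * π) - (b * cos x + c * sin x) / π) =
      highPart f x * g x - a / (2 * π) * highPart f x
        - (b / π * (highPart f x * cos x) + c / π * (highPart f x * sin x)) :=
    fun x => by ring
  simp_rw [this]
  rw [intervalIntegral.integral_sub, intervalIntegral.integral_sub, intervalIntegral.integral_add,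
    intervalIntegral.integral_const_mul, intervalIntegral.integral_const_mul,
    intervalIntegral.integral_const_mul, integral_highPart hf, integral_highPart_cos hf,
    integral_highPart_sin hf]
  · ring
  all_goals exact Continuous.intervalIntegrable (by fun_prop) _ _

lemma highInner_self_nonneg {f : ℝ → ℝ} (hf : Continuous f) : 0 ≤ highInner f f := by
  rw [← integral_mul_highPart hf hf]
  exact intervalIntegral.integral_nonneg two_pi_pos.le fun θ _ => mul_self_nonneg _

lemma highInner_sq_le {f g : ℝ → ℝ} (hf : Continuous f) (hg : Continuous g) :
    highInner f g ^ 2 ≤ highInner f f * highInner g g := by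
  have := integral_cauchy_schwarz (continuous_highPart hf) (continuous_highPart hg)
  simp only [integral_mul_highPart hf hg, pow_two (highPart _ _), integral_mul_highPart hf hf,
    integral_mul_highPart hg hg] at this
  exact this

lemma highInner_le_sqrt {f q : ℝ → ℝ} (hf : Continuous f) (hq : Continuous q) :
    |highInner f q| ≤ √(highInner f f) * √(∫ x in 0..2 * π, q x ^ 2) := by
  rw [← Real.sqrt_mul (highInner_self_nonneg hf), ← integral_highPart_mul hf hq]
  apply Real.abs_le_sqrt
  have := integral_cauchy_schwarz (continuous_highPart hf) hq
  simpa only [pow_two (highPart _ _), integral_mul_highPart hf hf] using this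

lemma highInner_add_right {f g h : ℝ → ℝ} (hf : Continuous f) (hg : Continuous g)
    (hh : Continuous h) :
    highInner f (fun x => g x + h x) = highInner f g + highInner f h := by
  have := continuous_highPart hf
  rw [← integral_highPart_mul hf hg, ← integral_highPart_mul hf hh,
    ← integral_highPart_mul hf (by fun_prop), ← integral_congr_of_continuous_add (by fun_prop)
      (by fun_prop)]
  simp_rw [mul_add]

lemma highInner_smul_right {f g : ℝ → ℝ} (c : ℝ) (hf : Continuous f) (hg : Continuous g) :
    highInner f (fun x => c * g x) = c * highInner f g := by
  rw [← integral_highPart_mul hf hg, ← integral_highPart_mul hf (by fun_prop),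
    ← intervalIntegral.integral_const_mul]
  congr 1; ext x; ring

/-- Wirtinger's inequality for the high modes, after an integration by parts. -/
lemma highInner_second_deriv {v vt vtt : ℝ → ℝ} (h1 : ∀ θ, HasDerivAt v (vt θ) θ)
    (h2 : ∀ θ, HasDerivAt vt (vtt θ) θ) (hc : Continuous vtt)
    (hp : v (2 * π) = v 0) (hpt : vt (2 * π) = vt 0) :
    highInner v vtt ≤ - (4 * highInner v v) := by
  have hv : Continuous v := continuous_iff_continuousAt.2 fun t => (h1 t).continuousAt
  have hvt : Continuous vt := continuous_iff_continuousAt.2 fun t => (h2 t).continuousAt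
  set b := ∫ x in 0..2 * π, v x * cos x with hb
  set c := ∫ x in 0..2 * π, v x * sin x with hcc
  set w := highPart v with hw
  have hwc : Continuous w := continuous_highPart hv
  set w' : ℝ → ℝ := fun θ => vt θ - (b * (-sin θ) + c * cos θ) / π with hw'
  have hwd : ∀ θ, HasDerivAt w (w' θ) θ := by
    intro θ
    have := ((h1 θ).sub_const ((∫ x in 0..2 * π, v x) / (2 * π))).sub
      ((((hasDerivAt_cos θ).const_mul b).add ((hasDerivAt_sin θ).const_mul c)).div_const π)
    exact this
  have hw'c : Continuous w' := by fun_prop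
  have hwp : w (2 * π) = w 0 := by simp [hw, highPart, hp]
  have i1 : ∫ x in 0..2 * π, w x * vtt x = - ∫ x in 0..2 * π, w' x * vt x := by
    rw [integral_period_parts hwd h2 hw'c hc hwp hpt]; ring
  have i2 : ∫ x in 0..2 * π, w' x * cos x = 0 := by
    rw [integral_period_parts hwd hasDerivAt_cos hw'c (by fun_prop) hwp (by simp)]
    simp only [mul_neg, intervalIntegral.integral_neg, neg_neg]
    exact integral_highPart_sin hv
  have i3 : ∫ x in 0..2 * π, w' x * sin x = 0 := by
    rw [integral_period_parts hwd hasDerivAt_sin hw'c (by fun_prop) hwp (by simp)]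
    rw [integral_highPart_cos hv]; simp
  have i4 : ∫ x in 0..2 * π, w' x * vt x = ∫ x in 0..2 * π, w' x ^ 2 := by
    have : ∀ x, w' x * vt x = w' x ^ 2 + (-(b / π) * (w' x * sin x) + c / π * (w' x * cos x)) := by
      intro x; simp only [hw']; ring
    simp_rw [this]
    rw [integral_congr_of_continuous_add (by fun_prop) (by fun_prop),
      integral_congr_of_continuous_add (by fun_prop) (by fun_prop),
      intervalIntegral.integral_const_mul, intervalIntegral.integral_const_mul, i2, i3]
    ring
  have i5 := wirtinger_two hwd hw'c hwp (integral_highPart hv) (integral_highPart_cos hv)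
    (integral_highPart_sin hv)
  have i6 : ∫ x in 0..2 * π, w x ^ 2 = highInner v v := by
    simp_rw [pow_two]; exact integral_mul_highPart hv hv
  rw [← integral_highPart_mul hv hc, i1, i4]
  rw [i6] at i5
  linarith

/-- The weight `t² (1 + t²)^{-1-α}` with `t = e^s`. -/
def kap (α s : ℝ) : ℝ := exp (2 * s) * (1 + exp (2 * s)) ^ (-1 - α)

/-- The primitive of `kap α` vanishing at `-∞`. -/
def kapPrim (α s : ℝ) : ℝ := (1 - (1 + exp (2 * s)) ^ (-α)) / (2 * α)

lemma kap_pos (α s : ℝ) : 0 < kap α s := by unfold kap; positivity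

lemma hasDerivAt_kapPrim {α : ℝ} (hα : 0 < α) (s : ℝ) :
    HasDerivAt (kapPrim α) (kap α s) s := by
  have h1 : HasDerivAt (fun s : ℝ => 1 + exp (2 * s)) (2 * exp (2 * s)) s := by
    have := (((hasDerivAt_id s).const_mul 2).exp).const_add 1
    exact this.congr_deriv (by simp only [id]; ring)
  have h2 := h1.rpow_const (p := -α) (Or.inl (by positivity))
  have h3 := (h2.const_sub 1).div_const (2 * α)
  refine h3.congr_deriv ?_
  unfold kap
  rw [show -1 - α = -α - 1 by ring]
  field_simp

lemma one_add_exp_ge_one (s : ℝ) : 1 ≤ 1 + exp (2 * s) := by linarith [exp_pos (2 * s)]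

lemma kapPrim_nonneg {α : ℝ} (hα : 0 < α) (s : ℝ) : 0 ≤ kapPrim α s := by
  unfold kapPrim
  have := Real.rpow_le_one_of_one_le_of_nonpos (one_add_exp_ge_one s) (by linarith : -α ≤ 0)
  apply div_nonneg <;> linarith

lemma kapPrim_le {α : ℝ} (hα : 0 < α) (s : ℝ) : kapPrim α s ≤ 1 / (2 * α) := by
  unfold kapPrim
  have : 0 < (1 + exp (2 * s)) ^ (-α) := by positivity
  gcongr; linarith

lemma kap_le_one {α : ℝ} (hα : 0 < α) (s : ℝ) : kap α s ≤ 1 := by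
  unfold kap
  have h1 : (1 + exp (2 * s)) ^ (-1 - α) ≤ (1 + exp (2 * s)) ^ (-1 : ℝ) :=
    Real.rpow_le_rpow_of_exponent_le (one_add_exp_ge_one s) (by linarith)
  rw [Real.rpow_neg_one] at h1
  calc _ ≤ exp (2 * s) * (1 + exp (2 * s))⁻¹ := by gcongr
    _ ≤ 1 := by
      rw [← div_eq_mul_inv, div_le_one (by positivity)]; linarith

lemma kap_anti {α β : ℝ} (h : α ≤ β) (s : ℝ) : kap β s ≤ kap α s := by
  unfold kap
  gcongr
  · exact one_add_exp_ge_one s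

lemma kap_mul_exp_le {α : ℝ} (hα : 0 < α) (s : ℝ) : kap α s * exp (α * s) ≤ kap (α / 2) s := by
  unfold kap
  have h1 : exp (α * s) ≤ (1 + exp (2 * s)) ^ (α / 2) := by
    have : exp (α * s) = exp (2 * s) ^ (α / 2) := by
      rw [← Real.exp_mul]; congr 1; ring
    rw [this]
    exact Real.rpow_le_rpow (exp_pos _).le (by linarith) (by linarith)
  have h2 : (1 + exp (2 * s)) ^ (-1 - α / 2) =
      (1 + exp (2 * s)) ^ (-1 - α) * (1 + exp (2 * s)) ^ (α / 2) := by
    rw [← Real.rpow_add (by positivity)]; congr 1; ring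
  rw [h2, ← mul_assoc]
  gcongr

/-- A `C²` function on `(-∞, S) × ℝ/2πℤ`, with its derivatives: `v1, v2` in the first variable
and `vt, vtt` in the angular variable. -/
structure IsPolar (S : ℝ) (v v1 v2 vt vtt : ℝ → ℝ → ℝ) : Prop where
  d1 : ∀ s < S, ∀ θ, HasDerivAt (fun t => v t θ) (v1 s θ) s
  d2 : ∀ s < S, ∀ θ, HasDerivAt (fun t => v1 t θ) (v2 s θ) s
  dt : ∀ s < S, ∀ θ, HasDerivAt (v s) (vt s θ) θ
  dtt : ∀ s < S, ∀ θ, HasDerivAt (vt s) (vtt s θ) θ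
  c0 : ContinuousOn (Function.uncurry v) (Iio S ×ˢ univ)
  c1 : ContinuousOn (Function.uncurry v1) (Iio S ×ˢ univ)
  c2 : ContinuousOn (Function.uncurry v2) (Iio S ×ˢ univ)
  ct : ContinuousOn (Function.uncurry vt) (Iio S ×ˢ univ)
  ctt : ContinuousOn (Function.uncurry vtt) (Iio S ×ˢ univ)
  per : ∀ s < S, v s (2 * π) = v s 0
  pert : ∀ s < S, vt s (2 * π) = vt s 0

lemma continuous_slice {S s : ℝ} (hs : s < S) {F : ℝ → ℝ → ℝ}
    (hF : ContinuousOn (Function.uncurry F) (Iio S ×ˢ univ)) : Continuous (F s) := by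
  rw [← continuousOn_univ]
  exact hF.comp (f := fun θ => (s, θ)) (by fun_prop) (fun θ _ => ⟨hs, mem_univ _⟩)

lemma hasDerivAt_integral_mul {F F' : ℝ → ℝ → ℝ} {S s : ℝ} (hs : s < S)
    (hF : ∀ s < S, ∀ θ, HasDerivAt (fun t => F t θ) (F' s θ) s)
    (hc : ContinuousOn (Function.uncurry F) (Iio S ×ˢ univ))
    (hc' : ContinuousOn (Function.uncurry F') (Iio S ×ˢ univ))
    {w : ℝ → ℝ} (hw : Continuous w) :
    HasDerivAt (fun t => ∫ θ in 0..2 * π, F t θ * w θ) (∫ θ in 0..2 * π, F' s θ * w θ) s := by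
  have hw2 : ContinuousOn (fun p : ℝ × ℝ => w p.2) (Iio S ×ˢ univ) := by fun_prop
  exact hasDerivAt_integral_param (F := fun t θ => F t θ * w θ) (F' := fun t θ => F' t θ * w θ) hs
    (fun s hs θ => (hF s hs θ).mul_const _) (hc.mul hw2) (hc'.mul hw2)

lemma highInner_comm (f g : ℝ → ℝ) : highInner f g = highInner g f := by
  unfold highInner
  simp_rw [mul_comm (g _) (f _)]
  ring

lemma hasDerivAt_highInner {F F' G G' : ℝ → ℝ → ℝ} {S s : ℝ} (hs : s < S)
    (hF : ∀ s < S, ∀ θ, HasDerivAt (fun t => F t θ) (F' s θ) s)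
    (hG : ∀ s < S, ∀ θ, HasDerivAt (fun t => G t θ) (G' s θ) s)
    (hc : ContinuousOn (Function.uncurry F) (Iio S ×ˢ univ))
    (hc' : ContinuousOn (Function.uncurry F') (Iio S ×ˢ univ))
    (gc : ContinuousOn (Function.uncurry G) (Iio S ×ˢ univ))
    (gc' : ContinuousOn (Function.uncurry G') (Iio S ×ˢ univ)) :
    HasDerivAt (fun t => highInner (F t) (G t)) (highInner (F' s) (G s) + highInner (F s) (G' s))
      s := by
  have h1 := hasDerivAt_integral_param (F := fun t θ => F t θ * G t θ)
    (F' := fun t θ => F' t θ * G t θ + F t θ * G' t θ) hs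
    (fun s hs θ => (hF s hs θ).mul (hG s hs θ)) (hc.mul gc) ((hc'.mul gc).add (hc.mul gc'))
  have f0 := hasDerivAt_integral_param hs hF hc hc'
  have g0 := hasDerivAt_integral_param hs hG gc gc'
  have f1 := hasDerivAt_integral_mul hs hF hc hc' continuous_cos
  have g1 := hasDerivAt_integral_mul hs hG gc gc' continuous_cos
  have f2 := hasDerivAt_integral_mul hs hF hc hc' continuous_sin
  have g2 := hasDerivAt_integral_mul hs hG gc gc' continuous_sin
  have hFs := continuous_slice hs hc
  have hF's := continuous_slice hs hc'
  have hGs := continuous_slice hs gc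
  have hG's := continuous_slice hs gc'
  rw [integral_congr_of_continuous_add (f := fun θ => F' s θ * G s θ)
    (g := fun θ => F s θ * G' s θ) (hF's.mul hGs) (hFs.mul hG's)] at h1
  have := (h1.sub ((f0.mul g0).div_const (2 * π))).sub (((f1.mul g1).add (f2.mul g2)).div_const π)
  refine this.congr_deriv ?_
  unfold highInner
  ring

lemma integral_sq_eq_highInner (f : ℝ → ℝ) :
    ∫ x in 0..2 * π, f x ^ 2 = highInner f f + (∫ x in 0..2 * π, f x) ^ 2 / (2 * π)
      + ((∫ x in 0..2 * π, f x * cos x) ^ 2 + (∫ x in 0..2 * π, f x * sin x) ^ 2) / π := by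
  unfold highInner
  simp_rw [pow_two]
  ring

lemma highInner_self_le (f : ℝ → ℝ) : highInner f f ≤ ∫ x in 0..2 * π, f x ^ 2 := by
  rw [integral_sq_eq_highInner]
  have : 0 ≤ (∫ x in 0..2 * π, f x) ^ 2 / (2 * π) := by positivity
  have : 0 ≤ ((∫ x in 0..2 * π, f x * cos x) ^ 2 + (∫ x in 0..2 * π, f x * sin x) ^ 2) / π := by
    positivity
  linarith

lemma abs_integral_mul_le {q w : ℝ → ℝ} (hq : Continuous q) (hw : Continuous w)
    (h1 : ∀ x, |w x| ≤ 1) {A : ℝ} (hA : 0 ≤ A) (h : ∫ x in 0..2 * π, q x ^ 2 ≤ A ^ 2) :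
    |∫ x in 0..2 * π, q x * w x| ≤ 3 * A := by
  have h2 : ∫ x in 0..2 * π, w x ^ 2 ≤ 2 * π := by
    have : ∫ x in 0..2 * π, w x ^ 2 ≤ ∫ x in 0..2 * π, (1 : ℝ) := by
      apply intervalIntegral.integral_mono_on (by positivity)
        ((hw.pow 2).intervalIntegrable _ _) (continuous_const.intervalIntegrable _ _)
      intro x _
      show w x ^ 2 ≤ 1
      rw [← sq_abs]; exact pow_le_one₀ (abs_nonneg _) (h1 x)
    simpa using this
  have h3 := integral_cauchy_schwarz hq hw
  have h4 : 0 ≤ ∫ x in 0..2 * π, w x ^ 2 :=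
    intervalIntegral.integral_nonneg (by positivity) fun x _ => sq_nonneg _
  apply abs_le_of_sq_le_sq _ (by positivity)
  have h5 : 2 * π ≤ 9 := by linarith [pi_lt_four]
  calc _ ≤ _ := h3
    _ ≤ A ^ 2 * 9 := by gcongr; linarith
    _ = _ := by ring

/-- Growth bound for a mode with exponent `β ∈ [1/2, 1]`. -/
lemma mode_zero_bound {a a1 a2 : ℝ → ℝ} {β C α H s₀ : ℝ} (hβ : 1 / 2 ≤ β) (hα : 0 < α)
    (hC : 0 < C) (hH : 0 < H)
    (h1 : ∀ s ≤ s₀, HasDerivAt a (a1 s) s) (h2 : ∀ s ≤ s₀, HasDerivAt a1 (a2 s) s)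
    (hb : ∀ s ≤ s₀, |a2 s| ≤ C * kap α s * (|a s| + H * exp (β * s)))
    (l0 : Tendsto (fun s => exp (-β * s) * a s) atBot (𝓝 0))
    (l1 : Tendsto (fun s => exp (-β * s) * a1 s) atBot (𝓝 0)) :
    ∀ s ≤ s₀, |a s| ≤ 2 * H * exp (2 * C / α) * exp (β * s) := by
  have hβ0 : 0 < β := by linarith
  have he : ∀ s, HasDerivAt (fun s => exp (-β * s)) (-β * exp (-β * s)) s := fun s => by
    have := ((hasDerivAt_id s).const_mul (-β)).exp
    exact this.congr_deriv (by simp only [id]; ring)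
  have key := relaxation_bound (m := fun s => exp (-β * s) * a1 s / β)
    (b := fun s => exp (-β * s) * a s) (R := fun s => exp (-β * s) * a2 s / β)
    (K := fun s => 2 * C * kapPrim α s) (κ := fun s => 2 * C * kap α s) (p := β) (q := β)
    (ε := H) (s₀ := s₀) (K₁ := C / α) hβ0.le hβ0.le hH
    (fun s hs => (((he s).mul (h2 s hs)).div_const β).congr_deriv (by ring))
    (fun s hs => ((he s).mul (h1 s hs)).congr_deriv (by field_simp; ring))
    (fun s hs => ?_) (fun s => by have := kap_pos α s; positivity)
    (fun s => (hasDerivAt_kapPrim hα s).const_mul _)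
    (fun s => by have := kapPrim_nonneg hα s; positivity)
    (fun s hs => ?_) (by simpa using l1.div_const β) l0
  · intro s hs
    have := (key s hs).2
    rw [abs_mul, abs_of_pos (exp_pos _)] at this
    have e1 : exp (-β * s) * exp (β * s) = 1 := by rw [← exp_add]; simp
    calc |a s| = exp (-β * s) * exp (β * s) * |a s| := by rw [e1, one_mul]
      _ = exp (-β * s) * |a s| * exp (β * s) := by ring
      _ ≤ 2 * H * exp (2 * (C / α)) * exp (β * s) := by gcongr
      _ = _ := by rw [mul_div_assoc]
  · have e1 : exp (-β * s) * exp (β * s) = 1 := by rw [← exp_add]; simp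
    rw [abs_div, abs_mul, abs_of_pos (exp_pos _), abs_of_pos hβ0, abs_mul, abs_of_pos (exp_pos _),
      div_le_iff₀ hβ0]
    have hk := kap_pos α s
    have h0 : 0 ≤ C * kap α s * (exp (-β * s) * |a s| + H) := by positivity
    calc exp (-β * s) * |a2 s| ≤ exp (-β * s) * (C * kap α s * (|a s| + H * exp (β * s))) := by
          gcongr; exact hb s hs
      _ = C * kap α s * (exp (-β * s) * |a s| + H * (exp (-β * s) * exp (β * s))) := by ring
      _ = C * kap α s * (exp (-β * s) * |a s| + H) := by rw [e1, mul_one]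
      _ ≤ 2 * (C * kap α s * (exp (-β * s) * |a s| + H)) * β := by nlinarith
      _ = _ := by ring
  · have := kapPrim_le hα s
    calc 2 * C * kapPrim α s ≤ 2 * C * (1 / (2 * α)) := by gcongr
      _ = C / α := by field_simp

/-- Growth bound for the modes `cos` and `sin`. -/
lemma mode_one_bound {a a1 a2 : ℝ → ℝ} {C α H s₀ : ℝ} (hα : 0 < α)
    (hC : 0 < C) (hH : 0 < H)
    (h1 : ∀ s ≤ s₀, HasDerivAt a (a1 s) s) (h2 : ∀ s ≤ s₀, HasDerivAt a1 (a2 s) s)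
    (hb : ∀ s ≤ s₀, |a2 s - a s| ≤ C * kap α s * (|a s| + H * exp s))
    (l0 : Tendsto (fun s => exp (-s) * a s) atBot (𝓝 0))
    (l1 : Tendsto (fun s => exp (-s) * a1 s) atBot (𝓝 0)) :
    ∀ s ≤ s₀, |a s| ≤ 2 * H * exp (2 * C / α) * exp s := by
  have he : ∀ s : ℝ, HasDerivAt (fun s => exp (-s)) (- exp (-s)) s := fun s => by
    have := ((hasDerivAt_id s).neg).exp
    exact this.congr_deriv (by simp only [id, Pi.neg_apply]; ring)
  have key := relaxation_bound (m := fun s => exp (-s) * (a s + a1 s) / 2)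
    (b := fun s => exp (-s) * a s) (R := fun s => exp (-s) * (a2 s - a s) / 2)
    (K := fun s => 2 * C * kapPrim α s) (κ := fun s => 2 * C * kap α s) (p := 0) (q := 2)
    (ε := H) (s₀ := s₀) (K₁ := C / α) le_rfl (by norm_num) hH
    (fun s hs => (((he s).mul ((h1 s hs).add (h2 s hs))).div_const 2).congr_deriv (by simp; ring))
    (fun s hs => ((he s).mul (h1 s hs)).congr_deriv (by ring))
    (fun s hs => ?_) (fun s => by have := kap_pos α s; positivity)
    (fun s => (hasDerivAt_kapPrim hα s).const_mul _)
    (fun s => by have := kapPrim_nonneg hα s; positivity)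
    (fun s hs => ?_) (by simpa [mul_add] using (l0.add l1).div_const 2) l0
  · intro s hs
    have := (key s hs).2
    rw [abs_mul, abs_of_pos (exp_pos _)] at this
    have e1 : exp (-s) * exp s = 1 := by rw [← exp_add]; simp
    calc |a s| = exp (-s) * exp s * |a s| := by rw [e1, one_mul]
      _ = exp (-s) * |a s| * exp s := by ring
      _ ≤ 2 * H * exp (2 * (C / α)) * exp s := by gcongr
      _ = _ := by rw [mul_div_assoc]
  · have e1 : exp (-s) * exp s = 1 := by rw [← exp_add]; simp
    rw [abs_div, abs_mul, abs_of_pos (exp_pos _), abs_two, abs_mul, abs_of_pos (exp_pos _),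
      div_le_iff₀ two_pos]
    have hk := kap_pos α s
    have h0 : 0 ≤ C * kap α s * (exp (-s) * |a s| + H) := by positivity
    calc exp (-s) * |a2 s - a s| ≤ exp (-s) * (C * kap α s * (|a s| + H * exp s)) := by
          gcongr; exact hb s hs
      _ = C * kap α s * (exp (-s) * |a s| + H * (exp (-s) * exp s)) := by ring
      _ = C * kap α s * (exp (-s) * |a s| + H) := by rw [e1, mul_one]
      _ ≤ 2 * (C * kap α s * (exp (-s) * |a s| + H)) * 2 := by nlinarith
      _ = _ := by ring
  · have := kapPrim_le hα s
    calc 2 * C * kapPrim α s ≤ 2 * C * (1 / (2 * α)) := by gcongr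
      _ = C / α := by field_simp

/-- `v(s, θ) = o(e^s)` as `s → -∞`, uniformly in `θ`. -/
def SmallAtBot (v : ℝ → ℝ → ℝ) : Prop := ∀ η > 0, ∀ᶠ s in atBot, ∀ θ, |v s θ| ≤ η * exp s

lemma SmallAtBot.tendsto_mode {v : ℝ → ℝ → ℝ} (hv : SmallAtBot v) {w : ℝ → ℝ}
    (hw : ∀ x, |w x| ≤ 1) {β : ℝ} (hβ : β ≤ 1) :
    Tendsto (fun s => exp (-β * s) * ∫ x in 0..2 * π, v s x * w x) atBot (𝓝 0) := by
  rw [Metric.tendsto_nhds]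
  intro ε hε
  filter_upwards [hv (ε / 14) (by positivity), eventually_le_atBot 0] with s hs hs0
  have h1 : |∫ x in 0..2 * π, v s x * w x| ≤ ε / 14 * exp s * |2 * π - 0| := by
    rw [← Real.norm_eq_abs]
    apply intervalIntegral.norm_integral_le_of_norm_le_const
    intro x _
    rw [Real.norm_eq_abs, abs_mul]
    calc |v s x| * |w x| ≤ (ε / 14 * exp s) * 1 := by
          gcongr
          · exact hs x
          · exact hw x
      _ = _ := mul_one _
  rw [sub_zero, abs_of_pos two_pi_pos] at h1
  rw [dist_zero_right, Real.norm_eq_abs, abs_mul, abs_of_pos (exp_pos _)]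
  have h2 : exp (-β * s) * exp s ≤ 1 := by
    rw [← exp_add]; apply exp_le_one_iff.2; nlinarith
  calc _ ≤ exp (-β * s) * (ε / 14 * exp s * (2 * π)) := by gcongr
    _ = (exp (-β * s) * exp s) * (ε / 14 * (2 * π)) := by ring
    _ ≤ 1 * (ε / 14 * (2 * π)) := by gcongr
    _ < ε := by nlinarith [pi_lt_d2]

lemma SmallAtBot.eventually_integral_sq {v : ℝ → ℝ → ℝ} (hv : SmallAtBot v) {A : ℝ} (hA : 0 < A) :
    ∀ᶠ s in atBot, ∫ x in 0..2 * π, v s x ^ 2 ≤ A ^ 2 * exp (2 * s) := by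
  filter_upwards [hv (A / 3) (by positivity)] with s hs
  have h1 : |∫ x in 0..2 * π, v s x ^ 2| ≤ (A / 3 * exp s) ^ 2 * |2 * π - 0| := by
    rw [← Real.norm_eq_abs]
    apply intervalIntegral.norm_integral_le_of_norm_le_const
    intro x _
    rw [Real.norm_eq_abs, abs_pow]
    gcongr
    exact hs x
  rw [sub_zero, abs_of_pos two_pi_pos] at h1
  calc _ ≤ _ := le_abs_self _
    _ ≤ _ := h1
    _ ≤ (A / 3 * exp s) ^ 2 * 9 := by gcongr; linarith [pi_lt_four]
    _ = _ := by rw [mul_pow, ← exp_nat_mul]; push_cast; ring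

namespace IsPolar

variable {S : ℝ} {v v1 v2 vt vtt : ℝ → ℝ → ℝ}

lemma continuous_source (hv : IsPolar S v v1 v2 vt vtt) (k : ℝ → ℝ) {s : ℝ} (hs : s < S) :
    Continuous fun θ => v2 s θ + vtt s θ + k s * v s θ :=
  ((continuous_slice hs hv.c2).add (continuous_slice hs hv.ctt)).add
    ((continuous_slice hs hv.c0).const_mul _)

/-- The equation satisfied by the Fourier modes. -/
lemma mode_eq (hv : IsPolar S v v1 v2 vt vtt) (k : ℝ → ℝ) {s : ℝ} (hs : s < S) {w w' w'' : ℝ → ℝ}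
    (hw : ∀ θ, HasDerivAt w (w' θ) θ) (hw' : ∀ θ, HasDerivAt w' (w'' θ) θ) (hw'' : Continuous w'')
    (hp : w (2 * π) = w 0) (hp' : w' (2 * π) = w' 0) :
    ∫ θ in 0..2 * π, v2 s θ * w θ =
      (∫ θ in 0..2 * π, (v2 s θ + vtt s θ + k s * v s θ) * w θ)
      - k s * (∫ θ in 0..2 * π, v s θ * w θ) - ∫ θ in 0..2 * π, v s θ * w'' θ := by
  have c0 := continuous_slice hs hv.c0
  have c2 := continuous_slice hs hv.c2
  have ct := continuous_slice hs hv.ct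
  have ctt := continuous_slice hs hv.ctt
  have cw : Continuous w := continuous_iff_continuousAt.2 fun θ => (hw θ).continuousAt
  have cw' : Continuous w' := continuous_iff_continuousAt.2 fun θ => (hw' θ).continuousAt
  have e1 : ∫ θ in 0..2 * π, vtt s θ * w θ = ∫ θ in 0..2 * π, v s θ * w'' θ := by
    rw [integral_period_parts (hv.dtt s hs) hw ctt cw' (hv.pert s hs) hp,
      integral_period_parts (hv.dt s hs) hw' ct hw'' (hv.per s hs) hp', neg_neg]
  have e2 : ∀ θ, (v2 s θ + vtt s θ + k s * v s θ) * w θ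
      = v2 s θ * w θ + (vtt s θ * w θ + k s * (v s θ * w θ)) := fun θ => by ring
  simp_rw [e2]
  rw [integral_congr_of_continuous_add (by fun_prop) (by fun_prop),
    integral_congr_of_continuous_add (by fun_prop) (by fun_prop),
    intervalIntegral.integral_const_mul, e1]
  ring

/-- Bound of the high modes of `v` by the barrier `A e^s`. -/
lemma high_bound (hv : IsPolar S v v1 v2 vt vtt) {k : ℝ → ℝ} {s₀ A : ℝ} (hs₀ : s₀ < S) (hA : 0 < A)
    (hk : ∀ s ≤ s₀, k s ≤ 5 / 2) (hsm : SmallAtBot v)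
    (hq : ∀ s ≤ s₀, ∫ θ in 0..2 * π, (v2 s θ + vtt s θ + k s * v s θ) ^ 2 ≤
      (A / 2 * exp s) ^ 2)
    (hend : ∫ θ in 0..2 * π, v s₀ θ ^ 2 ≤ A ^ 2 * exp (2 * s₀)) :
    ∀ s ≤ s₀, highInner (v s) (v s) ≤ A ^ 2 * exp (2 * s) := by
  refine energy_barrier (E1 := fun s => 2 * highInner (v s) (v1 s))
    (E2 := fun s => 2 * highInner (v1 s) (v1 s) + 2 * highInner (v s) (v2 s))
    (Z := fun s => highInner (v1 s) (v1 s))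
    (g := fun s => √(∫ θ in 0..2 * π, (v2 s θ + vtt s θ + k s * v s θ) ^ 2)) hA
    (fun s hs => highInner_self_nonneg (continuous_slice (hs.trans_lt hs₀) hv.c0))
    (fun s hs => ?_) (fun s hs => ?_) (fun s hs => ?_) (fun s hs => ?_) (fun s hs => ?_)
    ((highInner_self_le _).trans hend) ?_
  · refine (hasDerivAt_highInner (hs.trans_lt hs₀) hv.d1 hv.d1 hv.c0 hv.c1 hv.c0
      hv.c1).congr_deriv ?_
    rw [highInner_comm (v1 s)]; ring
  · refine ((hasDerivAt_highInner (hs.trans_lt hs₀) hv.d1 hv.d2 hv.c0 hv.c1 hv.c1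
      hv.c2).const_mul 2).congr_deriv ?_
    ring
  · have hs' := hs.trans_lt hs₀
    have := highInner_sq_le (continuous_slice hs' hv.c0) (continuous_slice hs' hv.c1)
    linear_combination 4 * this
  · have hs' := hs.trans_lt hs₀
    have c0 := continuous_slice hs' hv.c0
    have c2 := continuous_slice hs' hv.c2
    have ctt := continuous_slice hs' hv.ctt
    have e1 := highInner_second_deriv (hv.dt s hs') (hv.dtt s hs') ctt (hv.per s hs')
      (hv.pert s hs')
    have e2 := highInner_le_sqrt c0 (hv.continuous_source k hs')
    have e3 : highInner (v s) (fun θ => v2 s θ + vtt s θ + k s * v s θ) =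
        highInner (v s) (v2 s) + highInner (v s) (vtt s) + k s * highInner (v s) (v s) := by
      rw [highInner_add_right c0 (by fun_prop) (by fun_prop), highInner_add_right c0 c2 ctt,
        highInner_smul_right _ c0 c0]
    rw [e3] at e2
    have e4 := neg_le_of_abs_le e2
    have e5 := highInner_self_nonneg c0
    have e6 := mul_le_mul_of_nonneg_right (hk s hs) e5
    linarith
  · rw [← Real.sqrt_sq (show 0 ≤ A / 2 * exp s by positivity)]
    exact Real.sqrt_le_sqrt (hq s hs)
  · filter_upwards [hsm.eventually_integral_sq hA] with s hs
    exact (highInner_self_le _).trans hs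

/-- Growth estimate for solutions of `v_ss + v_θθ + k v = q`. -/
lemma linear_bound (hv : IsPolar S v v1 v2 vt vtt) {k : ℝ → ℝ} {s₀ α Ck H V₀ : ℝ} (hs₀ : s₀ < S)
    (hα : 0 < α) (hα2 : α ≤ 1 / 2) (hCk : 1 ≤ Ck) (hH : 0 < H) (hV : 0 ≤ V₀)
    (hk0 : ∀ s ≤ s₀, 0 ≤ k s) (hk : ∀ s ≤ s₀, k s ≤ 5 / 2) (hkk : ∀ s ≤ s₀, k s ≤ Ck * kap α s)
    (hsm : SmallAtBot v) (hsm1 : SmallAtBot v1)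
    (hq : ∀ s ≤ s₀, ∫ θ in 0..2 * π, (v2 s θ + vtt s θ + k s * v s θ) ^ 2 ≤
      (kap α s * (H * exp s)) ^ 2)
    (hend : ∫ θ in 0..2 * π, v s₀ θ ^ 2 ≤ (V₀ * exp s₀) ^ 2) :
    ∀ s ≤ s₀, ∫ θ in 0..2 * π, v s θ ^ 2 ≤ (3 * exp (12 * Ck / α) * (H + V₀) * exp s) ^ 2 ∧
      |∫ θ in 0..2 * π, v s θ| ≤ 3 * exp (12 * Ck / α) * H * exp ((1 - α) * s) := by
  have hα' : 0 < α / 2 := by positivity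
  set X := exp (12 * Ck / α) with hX
  have hX1 : 1 ≤ X := one_le_exp (by positivity)
  have hX2 : exp (2 * (3 * Ck) / α) ≤ X := by
    apply exp_le_exp.2; gcongr ?_ / α; linarith
  have hX3 : exp (2 * (3 * Ck) / (α / 2)) = X := by
    rw [hX]; congr 1; field_simp; ring
  have hsrc : ∀ s ≤ s₀, ∀ w : ℝ → ℝ, Continuous w → (∀ x, |w x| ≤ 1) →
      |∫ θ in 0..2 * π, (v2 s θ + vtt s θ + k s * v s θ) * w θ| ≤
        3 * (kap α s * (H * exp s)) := fun s hs w hw hw1 => by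
    have := kap_pos α s
    exact abs_integral_mul_le (hv.continuous_source k (hs.trans_lt hs₀)) hw hw1 (by positivity)
      (hq s hs)
  have hmode : ∀ s ≤ s₀, ∀ a J : ℝ, |J| ≤ 3 * (kap α s * (H * exp s)) →
      |J - k s * a| ≤ 3 * Ck * kap α s * (|a| + H * exp s) := fun s hs a J hJ => by
    have hkp := kap_pos α s
    have h1 : |k s * a| ≤ Ck * kap α s * |a| := by
      rw [abs_mul, abs_of_nonneg (hk0 s hs)]; gcongr; exact hkk s hs
    have h2 : 0 ≤ kap α s * |a| := by positivity
    have h3 : 0 ≤ kap α s * (H * exp s) := by positivity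
    calc |J - k s * a| ≤ |J| + |k s * a| := abs_sub _ _
      _ ≤ 3 * (kap α s * (H * exp s)) + Ck * kap α s * |a| := add_le_add hJ h1
      _ ≤ _ := by nlinarith
  have hone : ∀ x : ℝ, |(fun _ : ℝ => (1 : ℝ)) x| ≤ 1 := fun x => by simp
  have D1 : ∀ {w : ℝ → ℝ}, Continuous w → ∀ s ≤ s₀,
      HasDerivAt (fun s => ∫ θ in 0..2 * π, v s θ * w θ) (∫ θ in 0..2 * π, v1 s θ * w θ) s :=
    fun hw s hs => hasDerivAt_integral_mul (hs.trans_lt hs₀) hv.d1 hv.c0 hv.c1 hw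
  have D2 : ∀ {w : ℝ → ℝ}, Continuous w → ∀ s ≤ s₀,
      HasDerivAt (fun s => ∫ θ in 0..2 * π, v1 s θ * w θ) (∫ θ in 0..2 * π, v2 s θ * w θ) s :=
    fun hw s hs => hasDerivAt_integral_mul (hs.trans_lt hs₀) hv.d2 hv.c1 hv.c2 hw
  have B0 : ∀ s ≤ s₀, |∫ θ in 0..2 * π, v2 s θ * 1| ≤
      3 * Ck * kap α s * (|∫ θ in 0..2 * π, v s θ * 1| + H * exp s) := fun s hs => by
    have e := hv.mode_eq k (hs.trans_lt hs₀) (w := fun _ => 1) (w' := fun _ => 0)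
      (w'' := fun _ => 0) (fun θ => hasDerivAt_const _ _) (fun θ => hasDerivAt_const _ _)
      continuous_const rfl rfl
    simp only [mul_zero, intervalIntegral.integral_zero, sub_zero] at e
    rw [e]
    exact hmode s hs _ _ (hsrc s hs _ continuous_const hone)
  have M0 := mode_zero_bound (β := 1) (C := 3 * Ck) (H := H) (α := α) (s₀ := s₀) (by norm_num) hα
    (by positivity) hH (D1 (w := fun _ => 1) continuous_const)
    (D2 (w := fun _ => 1) continuous_const)
    (fun s hs => by rw [one_mul]; exact B0 s hs)
    (hsm.tendsto_mode hone le_rfl) (hsm1.tendsto_mode hone le_rfl)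
  have M0' := mode_zero_bound (β := 1 - α) (C := 3 * Ck) (H := H) (α := α / 2) (s₀ := s₀)
    (by linarith) hα' (by positivity) hH (D1 (w := fun _ => 1) continuous_const)
    (D2 (w := fun _ => 1) continuous_const)
    (fun s hs => by
      refine (B0 s hs).trans ?_
      have h1 := kap_anti (show α / 2 ≤ α by linarith) s
      have h2 := kap_mul_exp_le hα s
      have h3 : exp s = exp (α * s) * exp ((1 - α) * s) := by rw [← exp_add]; congr 1; ring
      calc 3 * Ck * kap α s * (|∫ θ in 0..2 * π, v s θ * 1| + H * exp s)
          = 3 * Ck * (kap α s * |∫ θ in 0..2 * π, v s θ * 1|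
            + (kap α s * exp (α * s)) * (H * exp ((1 - α) * s))) := by rw [h3]; ring
        _ ≤ 3 * Ck * (kap (α / 2) s * |∫ θ in 0..2 * π, v s θ * 1|
            + kap (α / 2) s * (H * exp ((1 - α) * s))) := by gcongr
        _ = _ := by ring)
    (hsm.tendsto_mode hone (by linarith)) (hsm1.tendsto_mode hone (by linarith))
  have M1 := mode_one_bound (C := 3 * Ck) (H := H) (α := α) (s₀ := s₀) hα
    (by positivity) hH (D1 continuous_cos) (D2 continuous_cos)
    (fun s hs => by
      have e := hv.mode_eq k (hs.trans_lt hs₀) (w := cos) (w' := fun θ => -sin θ)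
        (w'' := fun θ => -cos θ) (fun θ => hasDerivAt_cos _) (fun θ => (hasDerivAt_sin _).neg)
        (by fun_prop) (by simp) (by simp)
      simp only [mul_neg, intervalIntegral.integral_neg, sub_neg_eq_add] at e
      rw [e, add_sub_cancel_right]
      exact hmode s hs _ _ (hsrc s hs _ continuous_cos abs_cos_le_one))
    (by simpa using hsm.tendsto_mode abs_cos_le_one le_rfl)
    (by simpa using hsm1.tendsto_mode abs_cos_le_one le_rfl)
  have M2 := mode_one_bound (C := 3 * Ck) (H := H) (α := α) (s₀ := s₀) hα
    (by positivity) hH (D1 continuous_sin) (D2 continuous_sin)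
    (fun s hs => by
      have e := hv.mode_eq k (hs.trans_lt hs₀) (w := sin) (w' := cos)
        (w'' := fun θ => -sin θ) (fun θ => hasDerivAt_sin _) (fun θ => hasDerivAt_cos _)
        (by fun_prop) (by simp) (by simp)
      simp only [mul_neg, intervalIntegral.integral_neg, sub_neg_eq_add] at e
      rw [e, add_sub_cancel_right]
      exact hmode s hs _ _ (hsrc s hs _ continuous_sin abs_sin_le_one))
    (by simpa using hsm.tendsto_mode abs_sin_le_one le_rfl)
    (by simpa using hsm1.tendsto_mode abs_sin_le_one le_rfl)
  have HI := hv.high_bound (k := k) (A := 2 * (H + V₀)) hs₀ (by positivity) hk hsm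
    (fun s hs => (hq s hs).trans (by
      have h1 := kap_le_one hα s
      have h2 := kap_pos α s
      have : kap α s * (H * exp s) ≤ 1 * ((H + V₀) * exp s) := by gcongr; linarith
      have e : 2 * (H + V₀) / 2 * exp s = 1 * ((H + V₀) * exp s) := by ring
      rw [e]
      exact pow_le_pow_left₀ (by positivity) this 2))
    (hend.trans (by
      rw [two_mul s₀, exp_add, ← pow_two, ← mul_pow]
      exact pow_le_pow_left₀ (by positivity) (by gcongr; linarith) 2))
  intro s hs
  have m0 := M0 s hs
  have m0' := M0' s hs
  have m1 := M1 s hs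
  have m2 := M2 s hs
  rw [hX3] at m0'
  simp only [mul_one, one_mul] at m0 m0'
  have up : ∀ a : ℝ, |a| ≤ 2 * H * exp (2 * (3 * Ck) / α) * exp s →
      a ^ 2 ≤ (2 * H * X * exp s) ^ 2 := fun a ha => by
    rw [← sq_abs a]
    exact pow_le_pow_left₀ (abs_nonneg _) (ha.trans (by gcongr)) 2
  refine ⟨?_, m0'.trans ?_⟩
  · rw [integral_sq_eq_highInner]
    set W := (2 * H * X * exp s) ^ 2 with hW
    have hi := HI s hs
    have p3 := pi_gt_three
    have t0 : (∫ θ in 0..2 * π, v s θ) ^ 2 / (2 * π) ≤ W / 6 := by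
      rw [div_le_div_iff₀ two_pi_pos (by norm_num)]
      nlinarith [up _ m0, sq_nonneg (2 * H * X * exp s)]
    have t1 : ((∫ x in 0..2 * π, v s x * cos x) ^ 2 + (∫ x in 0..2 * π, v s x * sin x) ^ 2) / π
        ≤ 2 * W / 3 := by
      rw [div_le_div_iff₀ pi_pos (by norm_num)]
      nlinarith [up _ m1, up _ m2, sq_nonneg (2 * H * X * exp s)]
    have e2 : exp (2 * s) = exp s ^ 2 := by rw [two_mul, exp_add, pow_two]
    rw [e2] at hi
    have hs1 : 0 ≤ (X ^ 2 - 1) * ((H + V₀) ^ 2 * exp s ^ 2) := by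
      apply mul_nonneg _ (by positivity)
      nlinarith
    have hs2 : H ^ 2 * (X ^ 2 * exp s ^ 2) ≤ (H + V₀) ^ 2 * (X ^ 2 * exp s ^ 2) := by
      gcongr; linarith
    calc _ ≤ (2 * (H + V₀)) ^ 2 * exp s ^ 2 + W / 6 + 2 * W / 3 := by linarith
      _ ≤ _ := by rw [hW]; nlinarith
  · have : 0 ≤ H * X * exp ((1 - α) * s) := by positivity
    nlinarith

/-- Conditional growth estimate: the source is controlled by `ε |v| + D₀ e^{s - s₀}`. -/
lemma bound (hv : IsPolar S v v1 v2 vt vtt) {k : ℝ → ℝ} {s₀ α Ck D₀ C₄ ε : ℝ}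
    (hs₀ : s₀ < S)
    (hα : 0 < α) (hα2 : α ≤ 1 / 2) (hCk : 1 ≤ Ck) (hD : 0 < D₀) (hC₄ : 0 ≤ C₄) (hε : 0 ≤ ε)
    (hεY : ε * (8 * (3 * exp (12 * Ck / α))) ≤ 1)
    (hk0 : ∀ s ≤ s₀, 0 ≤ k s) (hk : ∀ s ≤ s₀, k s ≤ 5 / 2) (hkk : ∀ s ≤ s₀, k s ≤ Ck * kap α s)
    (hsm : SmallAtBot v) (hsm1 : SmallAtBot v1)
    (hq : ∀ s ≤ s₀, ∀ θ, |v2 s θ + vtt s θ + k s * v s θ| ≤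
      kap α s * (ε * |v s θ| + D₀ * exp (s - s₀)))
    (hend : ∀ θ, |v s₀ θ| ≤ C₄) :
    |∫ θ in 0..2 * π, v s₀ θ| ≤ 3 * exp (12 * Ck / α) * (6 * D₀ + 3 * C₄) * exp (-α * s₀) := by
  set Y := 3 * exp (12 * Ck / α) with hY
  have hY0 : 0 < Y := by positivity
  set D := D₀ * exp (-s₀) with hDdef
  have hD0 : 0 < D := by positivity
  set V₀ := 3 * C₄ * exp (-s₀) with hV
  have hV0 : 0 ≤ V₀ := by positivity
  have hexp : ∀ s : ℝ, exp (-s) * exp s = 1 := fun s => by rw [← exp_add]; simp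
  set J : ℝ → ℝ := fun s => ∫ θ in 0..2 * π, v s θ ^ 2 with hJ
  have hJ0 : ∀ s, 0 ≤ J s := fun s =>
    intervalIntegral.integral_nonneg (by positivity) fun x _ => sq_nonneg _
  set n : ℝ → ℝ := fun s => √(J s) * exp (-s) with hn
  have hn0 : ∀ s, 0 ≤ n s := fun s => by positivity
  have hJc : ∀ s ≤ s₀, ContinuousAt J s := fun s hs =>
    (hasDerivAt_integral_param (F := fun s θ => v s θ ^ 2)
      (F' := fun s θ => 2 * v s θ * v1 s θ) (hs.trans_lt hs₀)
      (fun s hs θ => ((hv.d1 s hs θ).pow 2).congr_deriv (by simp)) ((hv.c0.pow 2).congr fun _ _ => rfl)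
      (((continuousOn_const (c := 2)).mul (hv.c0.mul hv.c1)).congr fun _ _ =>
        mul_assoc _ _ _)).continuousAt
  have hbdd : BddAbove (n '' Iic s₀) := by
    obtain ⟨s₁, h1⟩ := eventually_atBot.1 (hsm.eventually_integral_sq one_pos)
    have hc : ContinuousOn n (Icc s₁ s₀) := fun s hs =>
      (((hJc s hs.2).sqrt).mul (by fun_prop)).continuousWithinAt
    obtain ⟨b, hb⟩ := (isCompact_Icc.image_of_continuousOn hc).bddAbove
    refine ⟨max b 1, ?_⟩
    rintro _ ⟨s, hs, rfl⟩
    rcases le_total s s₁ with h | h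
    · refine le_max_of_le_right ?_
      have e : (1 : ℝ) ^ 2 * exp (2 * s) = exp s ^ 2 := by rw [two_mul, exp_add]; ring
      have := Real.sqrt_le_sqrt ((h1 s h).trans_eq e)
      rw [Real.sqrt_sq (exp_pos _).le] at this
      calc n s ≤ exp s * exp (-s) := by simp only [hn]; gcongr
        _ = 1 := by rw [mul_comm, hexp]
    · exact le_max_of_le_left (hb ⟨s, ⟨h, hs⟩, rfl⟩)
  set M := sSup (n '' Iic s₀) with hM
  have hnM : ∀ s ≤ s₀, n s ≤ M := fun s hs => le_csSup hbdd ⟨s, hs, rfl⟩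
  have hM0 : 0 ≤ M := (hn0 s₀).trans (hnM s₀ le_rfl)
  have hJM : ∀ s ≤ s₀, J s ≤ (M * exp s) ^ 2 := fun s hs => by
    rw [← Real.sqrt_le_left (by positivity)]
    calc √(J s) = √(J s) * (exp (-s) * exp s) := by rw [hexp, mul_one]
      _ = n s * exp s := by simp only [hn]; ring
      _ ≤ _ := by gcongr; exact hnM s hs
  set H := 2 * ε * M + 4 * D with hH
  have hH0 : 0 < H := by positivity
  have key := hv.linear_bound (k := k) (H := H) (V₀ := V₀) hs₀ hα hα2 hCk hH0 hV0 hk0 hk hkk hsm hsm1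
    (fun s hs => by
      have hs' := hs.trans_lt hs₀
      have c0 := continuous_slice hs' hv.c0
      have hkp := kap_pos α s
      have hDe : D₀ * exp (s - s₀) = D * exp s := by
        rw [hDdef, mul_assoc, ← exp_add]; congr 2; ring
      have hle : ∫ θ in 0..2 * π, (v2 s θ + vtt s θ + k s * v s θ) ^ 2 ≤
          ∫ θ in 0..2 * π, ((kap α s ^ 2 * (2 * ε ^ 2)) * v s θ ^ 2
            + kap α s ^ 2 * (2 * (D * exp s) ^ 2)) := by
        apply intervalIntegral.integral_mono_on two_pi_pos.le
          (((hv.continuous_source k hs').pow 2).intervalIntegrable _ _)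
          (Continuous.intervalIntegrable (by fun_prop) _ _)
        intro θ _
        have h1 := hq s hs θ
        rw [hDe] at h1
        have h2 := pow_le_pow_left₀ (abs_nonneg _) h1 2
        simp only [sq_abs] at h2
        refine h2.trans ?_
        have h3 : (ε * |v s θ| + D * exp s) ^ 2 ≤ 2 * ε ^ 2 * v s θ ^ 2 + 2 * (D * exp s) ^ 2 := by
          rw [← sq_abs (v s θ)]
          linarith [sq_nonneg (ε * |v s θ| - D * exp s)]
        rw [mul_pow]
        calc _ ≤ kap α s ^ 2 * (2 * ε ^ 2 * v s θ ^ 2 + 2 * (D * exp s) ^ 2) := by gcongr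
          _ = _ := by ring
      refine hle.trans ?_
      rw [integral_congr_of_continuous_add (by fun_prop) (by fun_prop),
        intervalIntegral.integral_const_mul, intervalIntegral.integral_const, sub_zero, smul_eq_mul]
      have h5 := hJM s hs
      calc kap α s ^ 2 * (2 * ε ^ 2) * J s + 2 * π * (kap α s ^ 2 * (2 * (D * exp s) ^ 2))
          ≤ kap α s ^ 2 * (2 * ε ^ 2) * (M * exp s) ^ 2
            + 8 * (kap α s ^ 2 * (2 * (D * exp s) ^ 2)) := by
            gcongr; linarith [pi_lt_four]
        _ = kap α s ^ 2 * exp s ^ 2 * (2 * (ε * M) ^ 2 + 16 * D ^ 2) := by ring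
        _ ≤ kap α s ^ 2 * exp s ^ 2 * (2 * (ε * M) + 4 * D) ^ 2 := by
            gcongr
            have : 0 ≤ ε * M * D := by positivity
            nlinarith [sq_nonneg (ε * M)]
        _ = _ := by rw [hH]; ring)
    (by
      have hb : |∫ θ in 0..2 * π, v s₀ θ ^ 2| ≤ C₄ ^ 2 * |2 * π - 0| := by
        rw [← Real.norm_eq_abs]
        apply intervalIntegral.norm_integral_le_of_norm_le_const
        intro x _
        rw [Real.norm_eq_abs, abs_pow]
        gcongr
        exact hend x
      rw [sub_zero, abs_of_pos two_pi_pos] at hb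
      have e : V₀ * exp s₀ = 3 * C₄ := by rw [hV, mul_assoc, hexp, mul_one]
      rw [e]
      calc _ ≤ _ := le_abs_self _
        _ ≤ _ := hb
        _ ≤ C₄ ^ 2 * 9 := by gcongr; linarith [pi_lt_four]
        _ = _ := by ring)
  rw [← hY] at key
  have hMle : M ≤ Y * (H + V₀) := by
    refine csSup_le (Set.Nonempty.image n ⟨s₀, self_mem_Iic⟩) ?_
    rintro _ ⟨s, hs, rfl⟩
    have h1 := Real.sqrt_le_sqrt (key s hs).1
    rw [Real.sqrt_sq (by positivity)] at h1
    calc n s ≤ Y * (H + V₀) * exp s * exp (-s) := by simp only [hn]; gcongr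
      _ = Y * (H + V₀) * (exp (-s) * exp s) := by ring
      _ = _ := by rw [hexp, mul_one]
  have hεM : 2 * ε * M ≤ H / 4 + V₀ / 4 := by
    have h1 : ε * M ≤ ε * (Y * (H + V₀)) := by gcongr
    have h2 : ε * (8 * Y) * (H + V₀) ≤ 1 * (H + V₀) := by gcongr
    linarith
  have hHle : H ≤ 6 * D + V₀ := by linarith
  calc |∫ θ in 0..2 * π, v s₀ θ| ≤ Y * H * exp ((1 - α) * s₀) := (key s₀ le_rfl).2
    _ ≤ Y * (6 * D + V₀) * exp ((1 - α) * s₀) := by gcongr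
    _ = Y * (6 * D₀ + 3 * C₄) * (exp (-s₀) * exp ((1 - α) * s₀)) := by rw [hDdef, hV]; ring
    _ = _ := by rw [← exp_add]; congr 2; ring

end IsPolar

/-- The weight `e^{2s} exp(-2φ + φ²/γ²)`. -/
def bubWeight (γ : ℝ) (φ : ℝ → ℝ) (s : ℝ) : ℝ := exp (2 * s) * exp (-2 * φ s + φ s ^ 2 / γ ^ 2)

/-- The bubble `B = γ - φ/γ` in the logarithmic variable `s`, with `φ1 = φ'`. -/
structure IsBubble (γ : ℝ) (φ φ1 : ℝ → ℝ) : Prop where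
  d1 : ∀ s, HasDerivAt φ (φ1 s) s
  d2 : ∀ s, HasDerivAt φ1 ((1 - φ s / γ ^ 2) * bubWeight γ φ s) s
  l0 : Tendsto (fun s => exp (-s) * φ s) atBot (𝓝 0)
  l1 : Tendsto (fun s => exp (-s) * φ1 s) atBot (𝓝 0)

/-- The limit profile `log (1 + e^{2s}/4)`. -/
def limProfile (s : ℝ) : ℝ := log (1 + exp (2 * s) / 4)

def limProfile' (s : ℝ) : ℝ := exp (2 * s) / 2 / (1 + exp (2 * s) / 4)

lemma hasDerivAt_exp_two_mul (s : ℝ) : HasDerivAt (fun s : ℝ => exp (2 * s)) (2 * exp (2 * s)) s := by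
  have := ((hasDerivAt_id s).const_mul 2).exp
  exact this.congr_deriv (by simp only [id]; ring)

lemma hasDerivAt_limProfile (s : ℝ) : HasDerivAt limProfile (limProfile' s) s := by
  have h := ((hasDerivAt_exp_two_mul s).div_const 4).const_add 1
  exact (h.log (by positivity)).congr_deriv (by unfold limProfile'; congr 1; ring)

lemma exp_neg_two_limProfile (s : ℝ) : exp (-2 * limProfile s) = ((1 + exp (2 * s) / 4) ^ 2)⁻¹ := by
  unfold limProfile
  rw [show -2 * log (1 + exp (2 * s) / 4) = -(2 * log (1 + exp (2 * s) / 4)) by ring, exp_neg,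
    two_mul, exp_add, exp_log (by positivity), pow_two]

lemma hasDerivAt_limProfile' (s : ℝ) :
    HasDerivAt limProfile' (exp (2 * s) * exp (-2 * limProfile s)) s := by
  have h := ((hasDerivAt_exp_two_mul s).div_const 4).const_add 1
  have h2 := ((hasDerivAt_exp_two_mul s).div_const 2).div h (by positivity)
  refine h2.congr_deriv ?_
  rw [exp_neg_two_limProfile]
  field_simp
  ring

lemma limProfile_nonneg (s : ℝ) : 0 ≤ limProfile s :=
  log_nonneg (by linarith [exp_pos (2 * s)])

lemma limProfile_le (s : ℝ) : limProfile s ≤ exp (2 * s) / 4 := by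
  have := log_le_sub_one_of_pos (show 0 < 1 + exp (2 * s) / 4 by positivity)
  unfold limProfile
  linarith

lemma exp_neg_mul_exp_two (s : ℝ) : exp (-s) * exp (2 * s) = exp s := by
  rw [← exp_add]; congr 1; ring

lemma tendsto_exp_neg_mul_of_le {g : ℝ → ℝ} (h0 : ∀ s, 0 ≤ g s) (h1 : ∀ s, g s ≤ exp (2 * s)) :
    Tendsto (fun s => exp (-s) * g s) atBot (𝓝 0) := by
  refine squeeze_zero (fun s => mul_nonneg (exp_pos _).le (h0 s)) (fun s => ?_)
    tendsto_exp_atBot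
  rw [← exp_neg_mul_exp_two s]
  gcongr
  exact h1 s

lemma tendsto_limProfile : Tendsto (fun s => exp (-s) * limProfile s) atBot (𝓝 0) :=
  tendsto_exp_neg_mul_of_le limProfile_nonneg
    fun s => (limProfile_le s).trans (by linarith [exp_pos (2 * s)])

lemma tendsto_limProfile' : Tendsto (fun s => exp (-s) * limProfile' s) atBot (𝓝 0) := by
  refine tendsto_exp_neg_mul_of_le (fun s => by unfold limProfile'; positivity) fun s => ?_
  unfold limProfile'
  rw [div_le_iff₀ (by positivity)]
  nlinarith [exp_pos (2 * s)]

lemma tendsto_of_exp_neg_mul {g : ℝ → ℝ} (h : Tendsto (fun s => exp (-s) * g s) atBot (𝓝 0)) :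
    Tendsto g atBot (𝓝 0) := by
  have := h.mul tendsto_exp_atBot
  rw [zero_mul] at this
  refine this.congr fun s => ?_
  rw [mul_right_comm, ← exp_add]; simp

lemma tendsto_exp_two_mul_atBot : Tendsto (fun s : ℝ => exp (2 * s)) atBot (𝓝 0) :=
  tendsto_exp_atBot.comp ((tendsto_const_mul_atBot_of_pos two_pos).2 tendsto_id)

namespace IsBubble

variable {γ : ℝ} {φ φ1 : ℝ → ℝ}

lemma deriv_nonneg (h : IsBubble γ φ φ1) (hγ : 0 < γ) {s₂ : ℝ} (hφ : ∀ s ≤ s₂, φ s ≤ γ ^ 2) :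
    ∀ s ≤ s₂, 0 ≤ φ1 s := by
  refine nonneg_of_deriv_nonneg_atBot (fun s _ => h.d2 s) (fun s hs => ?_)
    (tendsto_of_exp_neg_mul h.l1)
  have : φ s / γ ^ 2 ≤ 1 := div_le_one_of_le₀ (hφ s hs) (by positivity)
  exact mul_nonneg (by linarith) (by unfold bubWeight; positivity)

lemma nonneg (h : IsBubble γ φ φ1) (hγ : 0 < γ) {s₂ : ℝ} (hφ : ∀ s ≤ s₂, φ s ≤ γ ^ 2) :
    ∀ s ≤ s₂, 0 ≤ φ s :=
  nonneg_of_deriv_nonneg_atBot (fun s _ => h.d1 s) (h.deriv_nonneg hγ hφ)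
    (tendsto_of_exp_neg_mul h.l0)

lemma weight_le (hγ : 0 < γ) {s θ : ℝ} (h0 : 0 ≤ φ s) (h1 : φ s ≤ (1 - θ) * γ ^ 2) :
    bubWeight γ φ s ≤ exp (2 * s - (1 + θ) * φ s) := by
  unfold bubWeight
  rw [← exp_add]
  apply exp_le_exp.2
  have : φ s ^ 2 / γ ^ 2 ≤ (1 - θ) * φ s := by
    rw [div_le_iff₀ (by positivity)]; nlinarith
  linarith

lemma source_le (h : IsBubble γ φ φ1) (hγ : 0 < γ) {s₂ : ℝ} (hφ : ∀ s ≤ s₂, φ s ≤ γ ^ 2) {s : ℝ}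
    (hs : s ≤ s₂) : (1 - φ s / γ ^ 2) * bubWeight γ φ s ≤ bubWeight γ φ s := by
  have h0 := h.nonneg hγ hφ s hs
  have : 0 ≤ φ s / γ ^ 2 := by positivity
  have hw : 0 < bubWeight γ φ s := by unfold bubWeight; positivity
  nlinarith

lemma deriv_le (h : IsBubble γ φ φ1) (hγ : 0 < γ) {s₂ : ℝ} (hφ : ∀ s ≤ s₂, φ s ≤ γ ^ 2) :
    ∀ s ≤ s₂, φ1 s ≤ exp (2 * s) / 2 := by
  intro s hs
  refine sub_nonneg.1 (nonneg_of_deriv_nonneg_atBot (g := fun s => exp (2 * s) / 2 - φ1 s)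
    (s₀ := s₂) (fun s _ => ((hasDerivAt_exp_two_mul s).div_const 2).sub (h.d2 s))
    (fun s hs => ?_) ?_ s hs)
  · have h0 := h.nonneg hγ hφ s hs
    have h1 := h.source_le hγ hφ hs
    have h2 := weight_le (θ := 0) hγ h0 (by simpa using hφ s hs)
    have h3 : exp (2 * s - (1 + 0) * φ s) ≤ exp (2 * s) := exp_le_exp.2 (by linarith)
    linarith
  · simpa using (tendsto_exp_two_mul_atBot.div_const 2).sub (tendsto_of_exp_neg_mul h.l1)

lemma le_exp (h : IsBubble γ φ φ1) (hγ : 0 < γ) {s₂ : ℝ} (hφ : ∀ s ≤ s₂, φ s ≤ γ ^ 2) :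
    ∀ s ≤ s₂, φ s ≤ exp (2 * s) / 4 := by
  intro s hs
  refine sub_nonneg.1 (nonneg_of_deriv_nonneg_atBot (g := fun s => exp (2 * s) / 4 - φ s)
    (s₀ := s₂) (fun s _ => ((hasDerivAt_exp_two_mul s).div_const 4).sub (h.d1 s))
    (fun s hs => ?_) ?_ s hs)
  · linarith [h.deriv_le hγ hφ s hs]
  · simpa using (tendsto_exp_two_mul_atBot.div_const 4).sub (tendsto_of_exp_neg_mul h.l0)

lemma source_diff_le (hγ : 0 < γ) {x y : ℝ} (hx : 0 ≤ x) (hxγ : x ≤ γ ^ 2) (hy : 0 ≤ y) :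
    |(1 - x / γ ^ 2) * exp (-2 * x + x ^ 2 / γ ^ 2) - exp (-2 * y)| ≤
      2 * |x - y| + x * (1 + x) / γ ^ 2 := by
  set a := x / γ ^ 2 with ha
  have ha0 : 0 ≤ a := by positivity
  have ha1 : a ≤ 1 := div_le_one_of_le₀ hxγ (by positivity)
  have e1 : x ^ 2 / γ ^ 2 = a * x := by rw [ha]; ring
  have e2 : x * (1 + x) / γ ^ 2 = a * (1 + x) := by rw [ha]; ring
  rw [e1, e2]
  have lip : ∀ p q : ℝ, p ≤ 0 → q ≤ 0 → exp p - exp q ≤ |p - q| := fun p q hp hq => by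
    have h1 := add_one_le_exp (q - p)
    have h2 : exp q = exp p * exp (q - p) := by rw [← exp_add]; congr 1; ring
    have h3 : exp p ≤ 1 := exp_le_one_iff.2 hp
    have h4 : exp p * (q - p + 1) ≤ exp q := by rw [h2]; gcongr
    have h5 : exp p * (p - q) ≤ 1 * |p - q| := by
      calc exp p * (p - q) ≤ exp p * |p - q| := by gcongr; exact le_abs_self _
        _ ≤ _ := by gcongr
    linarith
  have h2 : |exp (-2 * x) - exp (-2 * y)| ≤ 2 * |x - y| := by
    have e : |(-2 * x) - (-2 * y)| = 2 * |x - y| := by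
      rw [← mul_sub, abs_mul]; norm_num
    rw [abs_le]
    have a1 := lip (-2 * x) (-2 * y) (by linarith) (by linarith)
    have a2 := lip (-2 * y) (-2 * x) (by linarith) (by linarith)
    rw [abs_sub_comm] at a2
    rw [e] at a1 a2
    constructor <;> linarith
  have h1 : |(1 - a) * exp (-2 * x + a * x) - exp (-2 * x)| ≤ a * (1 + x) := by
    have hax : 0 ≤ a * x := by positivity
    have b1 := lip (-2 * x + a * x) (-2 * x) (by nlinarith) (by linarith)
    rw [show -2 * x + a * x - -2 * x = a * x by ring, abs_of_nonneg hax] at b1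
    have b2 : exp (-2 * x) ≤ exp (-2 * x + a * x) := exp_le_exp.2 (by linarith)
    have b3 : exp (-2 * x + a * x) ≤ 1 := exp_le_one_iff.2 (by nlinarith)
    have b4 := exp_pos (-2 * x + a * x)
    rw [abs_le]
    constructor <;> nlinarith
  calc _ = |((1 - a) * exp (-2 * x + a * x) - exp (-2 * x)) + (exp (-2 * x) - exp (-2 * y))| := by
        congr 1; ring
    _ ≤ _ := abs_add_le _ _
    _ ≤ _ := by linarith

/-- Quantitative convergence to the limit profile. -/
lemma dist_limProfile (h : IsBubble γ φ φ1) (hγ : 0 < γ) {s₂ ρ : ℝ} (hφ : ∀ s ≤ s₂, φ s ≤ γ ^ 2) :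
    ∃ K, K = 2 * exp ρ * (exp ρ * (1 + exp (2 * ρ))) * exp (2 * exp (2 * ρ)) ∧
    ∀ s ≤ s₂, s ≤ ρ → |φ s - limProfile s| ≤ K / γ ^ 2 ∧ |φ1 s - limProfile' s| ≤ K / γ ^ 2 := by
  refine ⟨_, rfl, ?_⟩
  have he : ∀ s : ℝ, HasDerivAt (fun s => exp (-s)) (- exp (-s)) s := fun s => by
    have := ((hasDerivAt_id s).neg).exp
    exact this.congr_deriv (by simp only [id, Pi.neg_apply]; ring)
  have dd1 : ∀ s, HasDerivAt (fun s => φ s - limProfile s) (φ1 s - limProfile' s) s :=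
    fun s => (h.d1 s).sub (hasDerivAt_limProfile s)
  have dd2 : ∀ s, HasDerivAt (fun s => φ1 s - limProfile' s)
      ((1 - φ s / γ ^ 2) * bubWeight γ φ s - exp (2 * s) * exp (-2 * limProfile s)) s :=
    fun s => (h.d2 s).sub (hasDerivAt_limProfile' s)
  have key := relaxation_bound (m := fun s => exp (-s) * (φ1 s - limProfile' s))
    (b := fun s => exp (-s) * (φ s - limProfile s))
    (R := fun s => exp (-s) * ((1 - φ s / γ ^ 2) * bubWeight γ φ s
      - exp (2 * s) * exp (-2 * limProfile s)))
    (κ := fun s => 2 * exp (2 * s)) (K := fun s => exp (2 * s)) (p := 1) (q := 1)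
    (ε := exp ρ * (1 + exp (2 * ρ)) / γ ^ 2) (s₀ := min s₂ ρ) (K₁ := exp (2 * ρ))
    (by norm_num) (by norm_num) (by positivity)
    (fun s _ => ((he s).mul (dd2 s)).congr_deriv (by ring))
    (fun s _ => ((he s).mul (dd1 s)).congr_deriv (by ring))
    (fun s hs => ?_) (fun s => by positivity) hasDerivAt_exp_two_mul (fun s => (exp_pos _).le)
    (fun s hs => exp_le_exp.2 (by linarith [le_min_iff.1 hs]))
    (by simpa [mul_sub] using h.l1.sub tendsto_limProfile')
    (by simpa [mul_sub] using h.l0.sub tendsto_limProfile)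
  · intro s hs hsρ
    obtain ⟨k1, k2⟩ := key s (le_min hs hsρ)
    rw [abs_mul, abs_of_pos (exp_pos _)] at k1 k2
    have e1 : exp s * exp (-s) = 1 := by rw [← exp_add]; simp
    have up : ∀ a : ℝ, exp (-s) * |a| ≤ 2 * (exp ρ * (1 + exp (2 * ρ)) / γ ^ 2)
        * exp (2 * exp (2 * ρ)) → |a| ≤ 2 * exp ρ * (exp ρ * (1 + exp (2 * ρ)))
          * exp (2 * exp (2 * ρ)) / γ ^ 2 := fun a ha => by
      calc |a| = exp s * (exp (-s) * |a|) := by rw [← mul_assoc, e1, one_mul]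
        _ ≤ exp ρ * (2 * (exp ρ * (1 + exp (2 * ρ)) / γ ^ 2) * exp (2 * exp (2 * ρ))) := by
          gcongr
        _ = _ := by ring
    exact ⟨up _ k2, up _ k1⟩
  · obtain ⟨hs2, hsρ⟩ := le_min_iff.1 hs
    have h0 := h.nonneg hγ hφ s hs2
    have h1 := h.le_exp hγ hφ s hs2
    have h2 := source_diff_le hγ h0 (hφ s hs2) (limProfile_nonneg s)
    rw [abs_mul, abs_mul, abs_of_pos (exp_pos _)]
    have e : (1 - φ s / γ ^ 2) * bubWeight γ φ s - exp (2 * s) * exp (-2 * limProfile s)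
        = exp (2 * s) * ((1 - φ s / γ ^ 2) * exp (-2 * φ s + φ s ^ 2 / γ ^ 2)
          - exp (-2 * limProfile s)) := by unfold bubWeight; ring
    have h3 : exp (-s) * (φ s * (1 + φ s) / γ ^ 2) ≤ 2 * (exp ρ * (1 + exp (2 * ρ)) / γ ^ 2) := by
      have m1 : exp (2 * s) ≤ exp (2 * ρ) := exp_le_exp.2 (by linarith)
      have m2 : exp (-s) * φ s ≤ exp ρ := by
        calc exp (-s) * φ s ≤ exp (-s) * exp (2 * s) := by
              gcongr; linarith [exp_pos (2 * s)]
          _ = exp s := exp_neg_mul_exp_two s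
          _ ≤ _ := exp_le_exp.2 hsρ
      have m3 : 1 + φ s ≤ 1 + exp (2 * ρ) := by linarith [exp_pos (2 * s)]
      calc exp (-s) * (φ s * (1 + φ s) / γ ^ 2) = exp (-s) * φ s * (1 + φ s) / γ ^ 2 := by ring
        _ ≤ exp ρ * (1 + exp (2 * ρ)) / γ ^ 2 := by gcongr
        _ ≤ _ := by
          have : 0 ≤ exp ρ * (1 + exp (2 * ρ)) / γ ^ 2 := by positivity
          linarith
    rw [e, abs_mul, abs_of_pos (exp_pos (2 * s))]
    calc _ ≤ exp (-s) * (exp (2 * s) * (2 * |φ s - limProfile s| + φ s * (1 + φ s) / γ ^ 2)) := by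
          gcongr
      _ = exp (2 * s) * (2 * (exp (-s) * |φ s - limProfile s|)
          + exp (-s) * (φ s * (1 + φ s) / γ ^ 2)) := by ring
      _ ≤ exp (2 * s) * (2 * (exp (-s) * |φ s - limProfile s|)
          + 2 * (exp ρ * (1 + exp (2 * ρ)) / γ ^ 2)) := by gcongr
      _ = _ := by ring

end IsBubble

lemma exp_neg_le_kap {θ s : ℝ} (hθ1 : θ ≤ 1) (hs : 0 ≤ s) :
    exp (-θ * s) ≤ 4 * kap (θ / 2) s := by
  unfold kap
  have h1 : 1 ≤ exp (2 * s) := one_le_exp (by linarith)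
  rcases le_or_gt (-1 - θ / 2) 0 with h0 | h0
  · have h2 : (2 * exp (2 * s)) ^ (-1 - θ / 2) ≤ (1 + exp (2 * s)) ^ (-1 - θ / 2) :=
      Real.rpow_le_rpow_of_nonpos (by positivity) (by linarith) h0
    rw [Real.mul_rpow (by norm_num) (by positivity), ← Real.exp_mul] at h2
    have h3 : (2 : ℝ) ^ (-2 : ℝ) ≤ 2 ^ (-1 - θ / 2) :=
      Real.rpow_le_rpow_of_exponent_le (by norm_num) (by linarith)
    have h4 : (2 : ℝ) ^ (-2 : ℝ) = 1 / 4 := by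
      rw [Real.rpow_neg (by norm_num)]; norm_num
    rw [h4] at h3
    have e : exp (-θ * s) = exp (2 * s) * exp (2 * s * (-1 - θ / 2)) := by
      rw [← exp_add]; congr 1; ring
    calc exp (-θ * s) = 4 * (exp (2 * s) * (1 / 4 * exp (2 * s * (-1 - θ / 2)))) := by rw [e]; ring
      _ ≤ 4 * (exp (2 * s) * (2 ^ (-1 - θ / 2) * exp (2 * s * (-1 - θ / 2)))) := by gcongr
      _ ≤ _ := by gcongr
  · have h2 : (1 : ℝ) ≤ (1 + exp (2 * s)) ^ (-1 - θ / 2) :=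
      Real.one_le_rpow (by linarith) h0.le
    have h3 : exp (-θ * s) ≤ exp (2 * s) * exp (2 * s * (-1 - θ / 2)) := by
      rw [← exp_add]; apply exp_le_exp.2; nlinarith
    have h4 : exp (2 * s * (-1 - θ / 2)) ≤ (1 + exp (2 * s)) ^ (-1 - θ / 2) := by
      rw [Real.exp_mul]
      exact Real.rpow_le_rpow (exp_pos _).le (by linarith) h0.le
    calc _ ≤ _ := h3
      _ ≤ exp (2 * s) * (1 + exp (2 * s)) ^ (-1 - θ / 2) := by gcongr
      _ ≤ _ := by
        have : 0 ≤ exp (2 * s) * (1 + exp (2 * s)) ^ (-1 - θ / 2) := by positivity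
        linarith

lemma limProfile'_ge {θ ρ : ℝ} (hθ : 0 < θ) (hρ : 32 / θ ≤ exp (2 * ρ)) :
    2 - θ / 4 ≤ limProfile' ρ := by
  unfold limProfile'
  rw [le_div_iff₀ (by positivity)]
  rw [div_le_iff₀ hθ] at hρ
  nlinarith [exp_pos (2 * ρ)]

lemma limProfile'_le (s : ℝ) : limProfile' s ≤ 2 := by
  unfold limProfile'
  rw [div_le_iff₀ (by positivity)]
  linarith

lemma limProfile_ge (s : ℝ) : 2 * s - 3 / 2 ≤ limProfile s := by
  unfold limProfile
  have h1 : exp (2 * s - 3 / 2) ≤ 1 + exp (2 * s) / 4 := by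
    have h4 : exp (-(3 / 2) : ℝ) ≤ 1 / 4 := by
      rw [exp_neg, inv_le_comm₀ (exp_pos _) (by norm_num)]
      have : exp (3 / 2 : ℝ) = exp (3 / 4) * exp (3 / 4) := by rw [← exp_add]; norm_num
      have h5 := quadratic_le_exp_of_nonneg (show (0 : ℝ) ≤ 3 / 4 by norm_num)
      rw [this]; nlinarith
    rw [sub_eq_add_neg, exp_add]
    nlinarith [exp_pos (2 * s)]
  exact (le_log_iff_exp_le (by positivity)).2 h1

namespace IsBubble

variable {γ θ ρ η s₂ : ℝ} {φ φ1 : ℝ → ℝ}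

lemma monotone_deriv (h : IsBubble γ φ φ1) (hγ : 0 < γ) (hφ : ∀ s ≤ s₂, φ s ≤ γ ^ 2) :
    MonotoneOn φ1 (Iic s₂) := by
  have h2 : interior (Iic s₂) ⊆ Iic s₂ := interior_subset
  apply monotoneOn_of_deriv_nonneg (convex_Iic s₂)
  · exact fun t ht => (h.d2 t).continuousAt.continuousWithinAt
  · exact fun t ht => (h.d2 t).differentiableAt.differentiableWithinAt
  · intro t ht
    rw [(h.d2 t).deriv]
    have : φ t / γ ^ 2 ≤ 1 := div_le_one_of_le₀ (hφ t (h2 ht)) (by positivity)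
    exact mul_nonneg (by linarith) (by unfold bubWeight; positivity)

lemma weight_decay (h : IsBubble γ φ φ1) (hγ : 0 < γ) (hθ : 0 < θ) (hθ1 : θ ≤ 1)
    (hη : η ≤ θ / 4) (hη2 : η ≤ 1 / 20)
    (hρ : 32 / θ ≤ exp (2 * ρ)) (hφ : ∀ s ≤ s₂, φ s ≤ (1 - θ) * γ ^ 2)
    (hc : ∀ s ≤ s₂, s ≤ ρ → |φ s - limProfile s| ≤ η ∧ |φ1 s - limProfile' s| ≤ η) {s : ℝ}
    (hs : ρ ≤ s) (hs2 : s ≤ s₂) : bubWeight γ φ s ≤ exp 4 * exp (-θ * ρ) * exp (-θ * s) := by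
  have hφ' : ∀ s ≤ s₂, φ s ≤ γ ^ 2 := fun s hs => (hφ s hs).trans (by nlinarith [sq_nonneg γ])
  obtain ⟨c1, c2⟩ := hc ρ (hs.trans hs2) le_rfl
  have b1 : 2 - θ / 2 ≤ φ1 ρ := by
    linarith [limProfile'_ge hθ hρ, (abs_le.1 c2).1]
  have b2 : 2 * ρ - 31 / 20 ≤ φ ρ := by
    linarith [limProfile_ge ρ, (abs_le.1 c1).1]
  have b3 : φ ρ + (2 - θ / 2) * (s - ρ) ≤ φ s := by
    have hm : MonotoneOn (fun t => φ t - (2 - θ / 2) * t) (Icc ρ s) := by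
      have hsub : interior (Icc ρ s) ⊆ Icc ρ s := interior_subset
      have hd : ∀ t, HasDerivAt (fun t => φ t - (2 - θ / 2) * t) (φ1 t - (2 - θ / 2)) t := fun t =>
        ((h.d1 t).sub ((hasDerivAt_id t).const_mul _)).congr_deriv (by simp)
      apply monotoneOn_of_deriv_nonneg (convex_Icc ρ s)
      · exact fun t ht => (hd t).continuousAt.continuousWithinAt
      · exact fun t ht => (hd t).differentiableAt.differentiableWithinAt
      · intro t ht
        rw [(hd t).deriv]
        have := h.monotone_deriv hγ hφ' (show ρ ∈ Iic s₂ from hs.trans hs2)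
          (show t ∈ Iic s₂ from (hsub ht).2.trans hs2) (hsub ht).1
        linarith
    have := hm (left_mem_Icc.2 hs) (right_mem_Icc.2 hs) hs
    simp only at this
    linarith
  refine (weight_le hγ (h.nonneg hγ hφ' s hs2) (hφ s hs2)).trans ?_
  rw [← exp_add, ← exp_add]
  apply exp_le_exp.2
  have b4 : (1 + θ) * (2 * ρ - 31 / 20 + (2 - θ / 2) * (s - ρ)) ≤ (1 + θ) * φ s := by
    gcongr; linarith
  have b5 : 0 ≤ (θ / 2 - θ ^ 2 / 2) * (s - ρ) :=
    mul_nonneg (by nlinarith) (by linarith)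
  nlinarith

lemma weight_le_kap (h : IsBubble γ φ φ1) (hγ : 0 < γ) (hθ : 0 < θ) (hθ1 : θ ≤ 1)
    (hη2 : η ≤ 1 / 20) (hφ : ∀ s ≤ s₂, φ s ≤ (1 - θ) * γ ^ 2)
    (hc : ∀ s ≤ s₂, s ≤ ρ → |φ s - limProfile s| ≤ η ∧ |φ1 s - limProfile' s| ≤ η) {s : ℝ}
    (hs : s ≤ ρ) (hs2 : s ≤ s₂) : bubWeight γ φ s ≤ 32 * kap (θ / 2) s := by
  have hφ' : ∀ s ≤ s₂, φ s ≤ γ ^ 2 := fun s hs => (hφ s hs).trans (by nlinarith [sq_nonneg γ])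
  obtain ⟨c1, -⟩ := hc s hs2 hs
  refine (weight_le hγ (h.nonneg hγ hφ' s hs2) (hφ s hs2)).trans ?_
  have hx : 0 < 1 + exp (2 * s) := by positivity
  have h1 : log (1 + exp (2 * s)) - log 4 ≤ limProfile s := by
    rw [← log_div (by positivity) (by norm_num)]
    unfold limProfile
    exact log_le_log (by positivity) (by linarith)
  have hl0 : 0 ≤ log (1 + exp (2 * s)) := log_nonneg (by linarith [exp_pos (2 * s)])
  have h2 : log (32 : ℝ) = 5 * log 2 := by
    rw [show (32 : ℝ) = 2 ^ 5 by norm_num, log_pow]; norm_num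
  have h3 : log (4 : ℝ) = 2 * log 2 := by
    rw [show (4 : ℝ) = 2 ^ 2 by norm_num, log_pow]; norm_num
  have h4 := log_two_gt_d9
  have e : 32 * kap (θ / 2) s = exp (log 32 + (2 * s + (-1 - θ / 2) * log (1 + exp (2 * s)))) := by
    unfold kap
    rw [exp_add, exp_log (by norm_num), exp_add, Real.rpow_def_of_pos hx]
    congr 3; ring
  rw [e]
  apply exp_le_exp.2
  have h5 : log (1 + exp (2 * s)) - log 4 - η ≤ φ s := by linarith [(abs_le.1 c1).1]
  have h6 : (1 + θ) * (log (1 + exp (2 * s)) - log 4 - η) ≤ (1 + θ) * φ s := by gcongr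
  nlinarith

lemma deriv_le_of_decay (h : IsBubble γ φ φ1) (hγ : 0 < γ) (hθ : 0 < θ) (hθ1 : θ ≤ 1)
    (hη : η ≤ θ / 4) (hη2 : η ≤ 1 / 20)
    (hρ : 32 / θ ≤ exp (2 * ρ)) (hφ : ∀ s ≤ s₂, φ s ≤ (1 - θ) * γ ^ 2)
    (hc : ∀ s ≤ s₂, s ≤ ρ → |φ s - limProfile s| ≤ η ∧ |φ1 s - limProfile' s| ≤ η)
    (hρ2 : exp 4 * exp (-(2 * θ * ρ)) ≤ θ ^ 2 / 2)
    {s : ℝ} (hs2 : s ≤ s₂) : φ1 s ≤ 2 + θ := by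
  have hφ' : ∀ s ≤ s₂, φ s ≤ γ ^ 2 := fun s hs => (hφ s hs).trans (by nlinarith [sq_nonneg γ])
  rcases le_total s ρ with hsρ | hsρ
  · linarith [limProfile'_le s, (abs_le.1 (hc s hs2 hsρ).2).2]
  have h0 : φ1 ρ ≤ 2 + θ / 4 := by
    linarith [limProfile'_le ρ, (abs_le.1 (hc ρ (hsρ.trans hs2) le_rfl).2).2]
  have hm : AntitoneOn (fun t => φ1 t + exp 4 * exp (-θ * ρ) * exp (-θ * t) / θ) (Icc ρ s) := by
    have hsub : interior (Icc ρ s) ⊆ Icc ρ s := interior_subset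
    have hd : ∀ t, HasDerivAt (fun t => φ1 t + exp 4 * exp (-θ * ρ) * exp (-θ * t) / θ)
        ((1 - φ t / γ ^ 2) * bubWeight γ φ t - exp 4 * exp (-θ * ρ) * exp (-θ * t)) t := fun t => by
      have e1 := ((hasDerivAt_id t).const_mul (-θ)).exp
      have e2 := (h.d2 t).add ((e1.const_mul (exp 4 * exp (-θ * ρ))).div_const θ)
      refine e2.congr_deriv ?_
      simp only [id]
      field_simp
      ring
    apply antitoneOn_of_deriv_nonpos (convex_Icc ρ s)
    · exact fun t ht => (hd t).continuousAt.continuousWithinAt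
    · exact fun t ht => (hd t).differentiableAt.differentiableWithinAt
    · intro t ht
      rw [(hd t).deriv]
      have ht' := hsub ht
      have b1 := h.source_le hγ hφ' (ht'.2.trans hs2)
      have b2 := h.weight_decay hγ hθ hθ1 hη hη2 hρ hφ hc ht'.1 (ht'.2.trans hs2)
      linarith
  have h1 := hm (left_mem_Icc.2 hsρ) (right_mem_Icc.2 hsρ) hsρ
  simp only at h1
  have h2 : 0 ≤ exp 4 * exp (-θ * ρ) * exp (-θ * s) / θ := by positivity
  have h3 : exp 4 * exp (-θ * ρ) * exp (-θ * ρ) / θ ≤ θ / 2 := by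
    rw [div_le_iff₀ hθ, mul_assoc, ← exp_add]
    rw [show -θ * ρ + -θ * ρ = -(2 * θ * ρ) by ring]
    nlinarith
  linarith

lemma energy_antitone (h : IsBubble γ φ φ1) :
    Antitone fun s => φ1 s ^ 2 * exp (-(2 * s)) + exp (-2 * φ s + φ s ^ 2 / γ ^ 2) := by
  have hd : ∀ s, HasDerivAt (fun s => φ1 s ^ 2 * exp (-(2 * s))
      + exp (-2 * φ s + φ s ^ 2 / γ ^ 2)) (-(2 * φ1 s ^ 2 * exp (-(2 * s)))) s := fun s => by
    have e1 := (((hasDerivAt_id s).const_mul 2).neg).exp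
    have e2 := (((h.d1 s).const_mul (-2)).add (((h.d1 s).pow 2).div_const (γ ^ 2))).exp
    have e3 := (((h.d2 s).pow 2).mul e1).add e2
    have e4 : exp (2 * s) * exp (-(2 * s)) = 1 := by rw [← exp_add]; simp
    refine e3.congr_deriv ?_
    simp only [id, Pi.neg_apply, Pi.add_apply, Pi.pow_apply, bubWeight]
    push_cast
    linear_combination (2 * φ1 s * (1 - φ s / γ ^ 2)
      * exp (-2 * φ s + φ s ^ 2 / γ ^ 2)) * e4
  apply antitone_of_deriv_nonpos
  · exact fun s => (hd s).differentiableAt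
  · intro s
    rw [(hd s).deriv]
    have : 0 ≤ 2 * φ1 s ^ 2 * exp (-(2 * s)) := by positivity
    linarith

end IsBubble

lemma exists_first_hit {g : ℝ → ℝ} {c s' : ℝ} (hg : ContinuousOn g (Iic s'))
    (hbot : ∀ᶠ s in atBot, g s < c) (hs' : c ≤ g s') :
    ∃ t ≤ s', g t = c ∧ ∀ s ≤ t, g s ≤ c := by
  obtain ⟨s₁, h1⟩ := eventually_atBot.1 hbot
  have h1' : s₁ ≤ s' := by
    by_contra! hlt
    exact absurd hs' (not_le.2 (h1 s' hlt.le))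
  have hg1 : ContinuousOn g (Icc s₁ s') := hg.mono fun s hs => hs.2
  set T : Set ℝ := Icc s₁ s' ∩ g ⁻¹' {c} with hT
  have hTc : IsClosed T := hg1.preimage_isClosed_of_isClosed isClosed_Icc isClosed_singleton
  have hTb : BddBelow T := ⟨s₁, fun s hs => hs.1.1⟩
  have hTn : T.Nonempty := by
    obtain ⟨t, ht, htc⟩ := intermediate_value_Icc h1' hg1 ⟨(h1 s₁ le_rfl).le, hs'⟩
    exact ⟨t, ht, htc⟩
  have hmem := hTc.csInf_mem hTn hTb
  refine ⟨sInf T, hmem.1.2, hmem.2, fun s hs => ?_⟩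
  rcases le_total s s₁ with h | h
  · exact (h1 s h).le
  by_contra! hlt
  have hg2 : ContinuousOn g (Icc s₁ s) := hg.mono fun t ht => ht.2.trans (hs.trans hmem.1.2)
  obtain ⟨t, ht, htc⟩ := intermediate_value_Icc h hg2 ⟨(h1 s₁ le_rfl).le, hlt.le⟩
  have h3 := csInf_le hTb (show t ∈ T from ⟨⟨ht.1, ht.2.trans (hs.trans hmem.1.2)⟩, htc⟩)
  have h4 : t = s := le_antisymm ht.2 (hs.trans h3)
  rw [h4] at htc
  exact hlt.ne' htc

namespace IsBubble

variable {γ θ ρ s₂ : ℝ} {φ φ1 : ℝ → ℝ}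

/-- A bubble which is above `δ γ` at some radius stays above `δ² γ / 2` before that radius. -/
lemma no_oscillation (h : IsBubble γ φ φ1) (hγ : 1 ≤ γ) {δ : ℝ} (hδ : 0 < δ) (hδ2 : δ ≤ 1 / 2)
    (hθ : θ = δ ^ 2 / 2) (hγθ : 9 ≤ θ * γ ^ 2) (hρ : 32 / θ ≤ exp (2 * ρ))
    (hρ2 : exp 4 * exp (-(2 * θ * ρ)) ≤ θ ^ 2 / 2)
    (hc : ∀ s₂, (∀ s ≤ s₂, φ s ≤ γ ^ 2) → ∀ s ≤ s₂, s ≤ ρ →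
      |φ s - limProfile s| ≤ θ / 4 ∧ |φ1 s - limProfile' s| ≤ θ / 4)
    {σ : ℝ} (hσ : φ σ ≤ (1 - δ) * γ ^ 2) : ∀ s ≤ σ, φ s ≤ (1 - θ) * γ ^ 2 := by
  have hθ0 : 0 < θ := by rw [hθ]; positivity
  have hθ1 : θ ≤ 1 / 8 := by rw [hθ]; nlinarith
  have hγ0 : 0 < γ := by linarith
  have hγ2 : 1 ≤ γ ^ 2 := one_le_pow₀ hγ
  intro s hs
  by_contra! hlt
  have hcφ : Continuous φ := continuous_iff_continuousAt.2 fun t => (h.d1 t).continuousAt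
  have hc0 : 0 < (1 - θ) * γ ^ 2 := by
    apply mul_pos <;> linarith
  obtain ⟨t, hts, ht, hle⟩ := exists_first_hit hcφ.continuousOn
    ((tendsto_of_exp_neg_mul h.l0).eventually (gt_mem_nhds hc0)) hlt.le
  have hle' : ∀ s ≤ t, φ s ≤ γ ^ 2 := fun s hs => (hle s hs).trans (by nlinarith)
  have hd : ∀ s ≤ t, φ1 s ≤ 2 + θ := fun s hs =>
    h.deriv_le_of_decay hγ0 hθ0 (by linarith) le_rfl (by linarith) hρ hle (hc t hle') hρ2 hs
  have ht0 : 0 ≤ t := by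
    by_contra! htn
    have h1 := h.le_exp hγ0 hle' t le_rfl
    have h2 : exp (2 * t) ≤ 1 := exp_le_one_iff.2 (by linarith)
    nlinarith
  have hgrow : φ t ≤ 1 / 4 + (2 + θ) * t := by
    have hm : AntitoneOn (fun s => φ s - (2 + θ) * s) (Icc 0 t) := by
      have hsub : interior (Icc 0 t) ⊆ Icc 0 t := interior_subset
      have hd' : ∀ s, HasDerivAt (fun s => φ s - (2 + θ) * s) (φ1 s - (2 + θ)) s := fun s =>
        ((h.d1 s).sub ((hasDerivAt_id s).const_mul _)).congr_deriv (by simp)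
      apply antitoneOn_of_deriv_nonpos (convex_Icc 0 t)
      · exact fun s hs => (hd' s).continuousAt.continuousWithinAt
      · exact fun s hs => (hd' s).differentiableAt.differentiableWithinAt
      · intro s hs
        rw [(hd' s).deriv]
        linarith [hd s (hsub hs).2]
    have h1 := hm (left_mem_Icc.2 ht0) (right_mem_Icc.2 ht0) ht0
    have h2 := h.le_exp hγ0 hle' 0 ht0
    simp at h1 h2
    linarith
  have hen := h.energy_antitone (hts.trans hs)
  simp only at hen
  have sqf : ∀ x, -2 * φ x + φ x ^ 2 / γ ^ 2 = (1 - φ x / γ ^ 2) ^ 2 * γ ^ 2 - γ ^ 2 := fun x => by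
    field_simp; ring
  rw [sqf, sqf, ht] at hen
  have e1 : (1 - (1 - θ) * γ ^ 2 / γ ^ 2) = θ := by field_simp; ring
  rw [e1] at hen
  have h1 : δ ≤ 1 - φ σ / γ ^ 2 := by
    have : φ σ / γ ^ 2 ≤ 1 - δ := by rw [div_le_iff₀ (by positivity)]; exact hσ
    linarith
  have h2 : exp ((δ ^ 2 - 1) * γ ^ 2) ≤ exp ((1 - φ σ / γ ^ 2) ^ 2 * γ ^ 2 - γ ^ 2) := by
    apply exp_le_exp.2
    have : δ ^ 2 * γ ^ 2 ≤ (1 - φ σ / γ ^ 2) ^ 2 * γ ^ 2 := by gcongr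
    linarith
  have h3 : φ1 t ^ 2 ≤ 5 := by
    have a0 := h.deriv_nonneg hγ0 hle' t le_rfl
    have a1 := hd t le_rfl
    nlinarith
  set Q := exp ((δ ^ 2 - 1) * γ ^ 2) with hQ
  have hQ0 : 0 < Q := exp_pos _
  have hδθ : δ ^ 2 = 2 * θ := by rw [hθ]; ring
  have h4 : exp (-(2 * t)) ≤ Q * exp (-(θ * γ ^ 2 / 3)) * exp (1 / 4) := by
    rw [hQ, ← exp_add, ← exp_add]
    apply exp_le_exp.2
    rw [ht] at hgrow
    have : (2 + θ) * (-(2 * t)) ≤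
        (2 + θ) * ((δ ^ 2 - 1) * γ ^ 2 + -(θ * γ ^ 2 / 3) + 1 / 4) := by
      rw [hδθ]
      have p1 := mul_nonneg hθ0.le (sq_nonneg γ)
      have p2 := mul_nonneg (sq_nonneg θ) (sq_nonneg γ)
      linarith
    exact le_of_mul_le_mul_left this (by linarith)
  have h5 : exp (θ ^ 2 * γ ^ 2 - γ ^ 2) ≤ Q * exp (-(θ * γ ^ 2 / 3)) := by
    rw [hQ, ← exp_add]
    apply exp_le_exp.2
    rw [hδθ]
    have p1 : θ ^ 2 * γ ^ 2 ≤ θ * γ ^ 2 := by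
      gcongr
      rw [sq]
      exact mul_le_of_le_one_left hθ0.le (by linarith)
    have p2 := mul_nonneg hθ0.le (sq_nonneg γ)
    linarith
  have h6 : exp (-(θ * γ ^ 2 / 3)) ≤ 1 / 8 := by
    rw [exp_neg, inv_le_comm₀ (exp_pos _) (by norm_num)]
    have h7 : exp 3 ≤ exp (θ * γ ^ 2 / 3) := exp_le_exp.2 (by linarith)
    have h8 := quadratic_le_exp_of_nonneg (show (0 : ℝ) ≤ 3 by norm_num)
    linarith
  have h9 : exp (1 / 4 : ℝ) ≤ 4 / 3 := by
    have := exp_bound_div_one_sub_of_interval (x := 1 / 4) (by norm_num) (by norm_num)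
    linarith
  have h11 : Q * exp (-(θ * γ ^ 2 / 3)) ≤ Q * (1 / 8) := by gcongr
  have h12 : Q * exp (-(θ * γ ^ 2 / 3)) * exp (1 / 4) ≤ Q * (1 / 8) * (4 / 3) := by gcongr
  have h13 : φ1 t ^ 2 * exp (-(2 * t)) ≤ 5 * (Q * (1 / 8) * (4 / 3)) := by
    gcongr
    exact h4.trans h12
  have h14 : 0 ≤ φ1 σ ^ 2 * exp (-(2 * σ)) := by positivity
  linarith

end IsBubble

/-- Uniform convergence of bubbles to the limit profile on bounded ranges. -/
lemma exists_limProfile_close {η : ℝ} (hη : 0 < η) (ρ : ℝ) : ∃ Γ ≥ 1, ∀ γ ≥ Γ, ∀ φ φ1,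
    IsBubble γ φ φ1 → ∀ s₂, (∀ s ≤ s₂, φ s ≤ γ ^ 2) → ∀ s ≤ s₂, s ≤ ρ →
      |φ s - limProfile s| ≤ η ∧ |φ1 s - limProfile' s| ≤ η := by
  set K := 2 * exp ρ * (exp ρ * (1 + exp (2 * ρ))) * exp (2 * exp (2 * ρ)) with hK
  have hK0 : 0 < K := by positivity
  refine ⟨max 1 (K / η), le_max_left _ _, fun γ hγ φ φ1 h s₂ hφ s hs hsρ => ?_⟩
  obtain ⟨hγ1, hγ2⟩ := max_le_iff.1 hγ
  obtain ⟨K', hK', hb⟩ := h.dist_limProfile (ρ := ρ) (by linarith) hφ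
  rw [← hK] at hK'
  subst hK'
  have : K / γ ^ 2 ≤ η := by
    rw [div_le_iff₀ (by positivity)]
    rw [div_le_iff₀ hη] at hγ2
    nlinarith
  exact ⟨(hb s hs hsρ).1.trans this, (hb s hs hsρ).2.trans this⟩

/-- Control of a bubble up to a radius where it is at least `δ γ`. -/
lemma bubble_profile {δ θ ε : ℝ} (hδ : 0 < δ) (hδ2 : δ ≤ 1 / 2) (hθ : θ = δ ^ 2 / 2) (hε : 0 < ε) :
    ∃ ρ ≥ 0, ∃ Γ ≥ 1, ∀ γ ≥ Γ, ∀ φ φ1, IsBubble γ φ φ1 → ∀ σ, φ σ ≤ (1 - δ) * γ ^ 2 →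
      ∀ s ≤ σ, 0 ≤ φ s ∧ φ s ≤ (1 - θ) * γ ^ 2 ∧ bubWeight γ φ s ≤ 32 * kap (θ / 2) s ∧
        (1 / γ ^ 2 + 2) * bubWeight γ φ s ≤ 5 / 2 ∧
        (ρ ≤ s → bubWeight γ φ s ≤ ε * kap (θ / 2) s) := by
  have hθ0 : 0 < θ := by rw [hθ]; positivity
  have hθ1 : θ ≤ 1 / 8 := by rw [hθ]; nlinarith
  set ε' := min ε (1 / 2) with hε'
  have hε0 : 0 < ε' := by positivity
  obtain ⟨ρ, hρ0, hρ1, hρ2, hρ3⟩ : ∃ ρ ≥ 0, 32 / θ ≤ exp (2 * ρ) ∧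
      exp 4 * exp (-(2 * θ * ρ)) ≤ θ ^ 2 / 2 ∧ exp 4 * exp (-θ * ρ) * 4 ≤ ε' := by
    have t1 : Tendsto (fun ρ : ℝ => exp (2 * ρ)) atTop atTop :=
      tendsto_exp_atTop.comp (tendsto_id.const_mul_atTop two_pos)
    have t2 : Tendsto (fun ρ : ℝ => exp 4 * exp (-(2 * θ * ρ))) atTop (𝓝 (exp 4 * 0)) :=
      (tendsto_exp_neg_atTop_nhds_zero.comp
        (tendsto_id.const_mul_atTop (by positivity : 0 < 2 * θ))).const_mul _
    have t3 : Tendsto (fun ρ : ℝ => exp 4 * exp (-(θ * ρ)) * 4) atTop (𝓝 (exp 4 * 0 * 4)) :=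
      ((tendsto_exp_neg_atTop_nhds_zero.comp
        (tendsto_id.const_mul_atTop hθ0)).const_mul _).mul_const _
    rw [mul_zero] at t2
    rw [mul_zero, zero_mul] at t3
    obtain ⟨ρ, h1, h2, h3, h4⟩ := ((eventually_ge_atTop 0).and ((t1.eventually_ge_atTop (32 / θ)).and
      ((t2.eventually (gt_mem_nhds (by positivity : 0 < θ ^ 2 / 2))).and
        (t3.eventually (gt_mem_nhds hε0))))).exists
    exact ⟨ρ, h1, h2, h3.le, by rw [neg_mul]; exact h4.le⟩
  obtain ⟨Γ, hΓ1, hΓ⟩ := exists_limProfile_close (show 0 < θ / 4 by positivity) ρ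
  refine ⟨ρ, hρ0, max (max Γ 6) (max (9 / θ) (2 * exp (2 * ρ) / θ)), by
    exact le_max_of_le_left (le_max_of_le_left hΓ1), fun γ hγ φ φ1 h σ hσ => ?_⟩
  obtain ⟨hγ', hγ''⟩ := max_le_iff.1 hγ
  obtain ⟨hγΓ, hγ6⟩ := max_le_iff.1 hγ'
  obtain ⟨hγ9, hγρ⟩ := max_le_iff.1 hγ''
  rw [div_le_iff₀ hθ0] at hγ9 hγρ
  have hγ0 : 0 < γ := by linarith
  have hγθ : 9 ≤ θ * γ ^ 2 := by nlinarith
  have hc := hΓ γ hγΓ φ φ1 h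
  have hno := h.no_oscillation (by linarith) hδ hδ2 hθ hγθ hρ1 hρ2 hc hσ
  have hφ' : ∀ s ≤ σ, φ s ≤ γ ^ 2 := fun s hs => (hno s hs).trans (by nlinarith [sq_nonneg γ])
  intro s hs
  have h0 := h.nonneg hγ0 hφ' s hs
  have hkp := kap_pos (θ / 2) s
  have hk1 := kap_le_one (show 0 < θ / 2 by positivity) s
  have hdec : ρ ≤ s → bubWeight γ φ s ≤ ε' * kap (θ / 2) s := fun hρs => by
    have h1 := h.weight_decay hγ0 hθ0 (by linarith) le_rfl (by linarith) hρ1 hno (hc σ hφ') hρs hs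
    have h2 := exp_neg_le_kap (θ := θ) (by linarith) (hρ0.trans hρs)
    calc _ ≤ _ := h1
      _ ≤ exp 4 * exp (-θ * ρ) * (4 * kap (θ / 2) s) := by gcongr
      _ = exp 4 * exp (-θ * ρ) * 4 * kap (θ / 2) s := by ring
      _ ≤ _ := by gcongr
  have hγ36 : 1 / γ ^ 2 ≤ 1 / 36 := one_div_le_one_div_of_le (by norm_num) (by nlinarith)
  refine ⟨h0, hno s hs, ?_, ?_, fun hρs => (hdec hρs).trans (by gcongr; exact min_le_left _ _)⟩
  · rcases le_total s ρ with hsρ | hsρ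
    · exact h.weight_le_kap hγ0 hθ0 (by linarith) (by linarith : θ / 4 ≤ 1 / 20) hno (hc σ hφ')
        hsρ hs
    · refine (hdec hsρ).trans ?_
      gcongr
      exact (min_le_right _ _).trans (by norm_num)
  · have hw : bubWeight γ φ s ≤ 6 / 5 := by
      rcases le_total s ρ with hsρ | hsρ
      · have c1 := (abs_le.1 (hc σ hφ' s hs hsρ).1).1
        have c2 : φ s ^ 2 / γ ^ 2 ≤ θ / 4 := by
          have a1 := h.le_exp hγ0 hφ' s hs
          have a2 : exp (2 * s) ≤ exp (2 * ρ) := exp_le_exp.2 (by linarith)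
          rw [div_le_iff₀ (by positivity)]
          have a3 : φ s ≤ θ * γ / 8 := by linarith
          have a4 : φ s ^ 2 ≤ (θ * γ / 8) ^ 2 := by gcongr
          nlinarith [mul_nonneg hθ0.le (sq_nonneg γ)]
        have c3 : exp (-2 * φ s + φ s ^ 2 / γ ^ 2) ≤ exp (-2 * limProfile s) * exp (1 / 8) := by
          rw [← exp_add]; apply exp_le_exp.2; linarith
        have c4 : exp (1 / 8 : ℝ) ≤ 6 / 5 := by
          have := exp_bound_div_one_sub_of_interval (x := 1 / 8) (by norm_num) (by norm_num)
          linarith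
        have c5 : exp (2 * s) * exp (-2 * limProfile s) ≤ 1 := by
          rw [exp_neg_two_limProfile, ← div_eq_mul_inv, div_le_one (by positivity)]
          nlinarith [sq_nonneg (1 - exp (2 * s) / 4)]
        unfold bubWeight
        calc _ ≤ exp (2 * s) * (exp (-2 * limProfile s) * exp (1 / 8)) := by gcongr
          _ = exp (2 * s) * exp (-2 * limProfile s) * exp (1 / 8) := by ring
          _ ≤ 1 * (6 / 5) := by gcongr
          _ = _ := by ring
      · have : ε' * kap (θ / 2) s ≤ 1 / 2 * 1 := by
          gcongr; exact min_le_right _ _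
        linarith [hdec hsρ]
    have hw0 : 0 ≤ bubWeight γ φ s := by unfold bubWeight; positivity
    calc (1 / γ ^ 2 + 2) * bubWeight γ φ s ≤ (1 / 36 + 2) * (6 / 5) := by gcongr
      _ ≤ _ := by norm_num

lemma abs_exp_sub_one_le_mul_exp (d : ℝ) : |exp d - 1| ≤ |d| * exp |d| := by
  have h := Complex.norm_exp_sub_sum_le_norm_mul_exp d 1
  simp only [Finset.range_one, Finset.sum_singleton, pow_zero, Nat.factorial_zero, Nat.cast_one,
    div_one, pow_one, Complex.norm_real, Real.norm_eq_abs] at h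
  rw [← Complex.ofReal_exp, ← Complex.ofReal_one, ← Complex.ofReal_sub, Complex.norm_real,
    Real.norm_eq_abs] at h
  exact h

lemma abs_exp_sub_one_sub_le_mul_exp (d : ℝ) : |exp d - 1 - d| ≤ d ^ 2 * exp |d| := by
  have h := Complex.norm_exp_sub_sum_le_norm_mul_exp d 2
  simp only [Finset.sum_range_succ, Finset.range_zero, Finset.sum_empty, pow_zero,
    Nat.factorial_zero, Nat.cast_one,
    div_one, pow_one, Complex.norm_real, Real.norm_eq_abs, zero_add, Nat.factorial_one] at h
  rw [← Complex.ofReal_exp, ← Complex.ofReal_one, ← Complex.ofReal_add, ← Complex.ofReal_sub,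
    Complex.norm_real, Real.norm_eq_abs, sq_abs, ← sub_sub] at h
  exact h

set_option maxHeartbeats 400000 in
/-- Second order expansion of the nonlinearity `b ↦ b e^{b²}` around a bubble. -/
lemma source_estimate {γ B v F C₄ : ℝ} (hγ : 1 ≤ γ) (hB0 : 0 ≤ B) (hB : B ≤ γ) (hv : |v| ≤ C₄) :
    |γ⁻¹ * (F * ((B + v / γ) * exp ((B + v / γ) ^ 2)) - B * exp (B ^ 2))
        - γ⁻¹ ^ 2 * (1 + 2 * B ^ 2) * exp (B ^ 2) * v| ≤
      4 * (2 + C₄) ^ 2 * exp (C₄ * (2 + C₄)) * exp (B ^ 2) * (v ^ 2 + |F - 1|) := by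
  have hγ0 : 0 < γ := by linarith
  have hC : 0 ≤ C₄ := (abs_nonneg v).trans hv
  set b := B / γ with hb
  set w := v / γ with hw
  have hb0 : 0 ≤ b := by positivity
  have hb1 : b ≤ 1 := div_le_one_of_le₀ hB hγ0.le
  have hBb : B = b * γ := by rw [hb]; field_simp
  have hvw : v = w * γ := by rw [hw]; field_simp
  have hw1 : |w| ≤ |v| := by
    rw [hw, abs_div, abs_of_pos hγ0]; exact div_le_self (abs_nonneg _) hγ
  set d := 2 * b * v + w ^ 2 with hd
  have hd1 : |d| ≤ |v| * (2 + C₄) := by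
    have : |d| ≤ 2 * b * |v| + |w| ^ 2 := by
      rw [hd]
      refine (abs_add_le _ _).trans ?_
      rw [abs_mul, abs_pow, abs_of_nonneg (by positivity : 0 ≤ 2 * b)]
    have h2 : |w| ^ 2 ≤ |v| * C₄ := by
      rw [sq]; gcongr; exact hw1.trans hv
    nlinarith [abs_nonneg v]
  set M := exp (C₄ * (2 + C₄)) with hM
  have hM1 : 1 ≤ M := one_le_exp (by positivity)
  have hdM : exp |d| ≤ M := by
    apply exp_le_exp.2
    exact hd1.trans (by gcongr)
  have e1 := (abs_exp_sub_one_le_mul_exp d)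
  have e2 := (abs_exp_sub_one_sub_le_mul_exp d)
  have e3 : |exp d - 1| ≤ |v| * (2 + C₄) * M := e1.trans (by gcongr)
  have e4 : |exp d - 1 - d| ≤ (|v| * (2 + C₄)) ^ 2 * M := by
    refine e2.trans ?_
    rw [← sq_abs d]
    gcongr
  have e5 : exp d ≤ M := (exp_le_exp.2 (le_abs_self d)).trans hdM
  set c := γ⁻¹ with hc
  have hc0 : 0 < c := by positivity
  have hc1 : c ≤ 1 := inv_le_one_of_one_le₀ hγ
  have hcγ : c * γ = 1 := by rw [hc]; field_simp
  have hsq : (B + w) ^ 2 = B ^ 2 + d := by rw [hd, hBb, hvw]; ring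
  have key : c * (F * ((B + w) * exp ((B + w) ^ 2)) - B * exp (B ^ 2))
        - c ^ 2 * (1 + 2 * B ^ 2) * exp (B ^ 2) * v =
      exp (B ^ 2) * ((F - 1) * (b + c * w) * exp d + b * (exp d - 1 - d) + b * w ^ 2
        + c * w * (exp d - 1)) := by
    rw [hsq, exp_add, hBb]
    have a1 : w = c * v := by rw [hw, hc]; ring
    have a2 : c * (b * γ) = b := by rw [mul_left_comm, hcγ, mul_one]
    have a3 : c ^ 2 * (b * γ) ^ 2 = b ^ 2 := by rw [← mul_pow, a2]
    have : c * (F * ((b * γ + w) * (exp ((b * γ) ^ 2) * exp d)) - b * γ * exp ((b * γ) ^ 2))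
        - c ^ 2 * (1 + 2 * (b * γ) ^ 2) * exp ((b * γ) ^ 2) * v =
        exp ((b * γ) ^ 2) * (F * (c * (b * γ) + c * w) * exp d - c * (b * γ)
          - (c * (c * v) + 2 * (c ^ 2 * (b * γ) ^ 2) * v)) := by ring
    rw [this, a2, a3, ← a1, hd]
    ring
  rw [key, abs_mul, abs_of_pos (exp_pos _)]
  have f1 : |(F - 1) * (b + c * w) * exp d| ≤ |F - 1| * (2 + C₄) * M := by
    rw [abs_mul, abs_mul, abs_of_pos (exp_pos d)]
    gcongr
    refine (abs_add_le _ _).trans ?_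
    rw [abs_of_nonneg hb0, abs_mul, abs_of_pos hc0]
    have : c * |w| ≤ 1 * C₄ := by gcongr; exact hw1.trans hv
    linarith
  have f2 : |b * (exp d - 1 - d)| ≤ 1 * ((|v| * (2 + C₄)) ^ 2 * M) := by
    rw [abs_mul, abs_of_nonneg hb0]
    gcongr
  have f3 : |b * w ^ 2| ≤ 1 * v ^ 2 := by
    rw [abs_mul, abs_of_nonneg hb0, abs_pow, ← sq_abs v]
    gcongr
  have f4 : |c * w * (exp d - 1)| ≤ 1 * |v| * (|v| * (2 + C₄) * M) := by
    rw [abs_mul, abs_mul, abs_of_pos hc0]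
    gcongr
  have f5 : |(F - 1) * (b + c * w) * exp d + b * (exp d - 1 - d) + b * w ^ 2
        + c * w * (exp d - 1)| ≤ 4 * (2 + C₄) ^ 2 * M * (v ^ 2 + |F - 1|) := by
    refine (abs_add_le _ _).trans ?_
    refine (add_le_add_left ((abs_add_le _ _).trans
      (add_le_add_left (abs_add_le _ _) _)) _).trans ?_
    have g1 : 2 + C₄ ≤ (2 + C₄) ^ 2 := le_self_pow₀ (by linarith) two_ne_zero
    have g2 : (1 : ℝ) ≤ (2 + C₄) ^ 2 * M :=
      one_le_mul_of_one_le_of_one_le (one_le_pow₀ (by linarith)) hM1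
    have g3 : |F - 1| * (2 + C₄) * M ≤ |F - 1| * (2 + C₄) ^ 2 * M := by gcongr
    have g4 : 1 * |v| * (|v| * (2 + C₄) * M) ≤ v ^ 2 * ((2 + C₄) ^ 2 * M) := by
      calc _ = |v| ^ 2 * ((2 + C₄) * M) := by ring
        _ ≤ |v| ^ 2 * ((2 + C₄) ^ 2 * M) := by gcongr
        _ = _ := by rw [sq_abs]
    have g5 : v ^ 2 ≤ v ^ 2 * ((2 + C₄) ^ 2 * M) := le_mul_of_one_le_right (sq_nonneg _) g2
    have g6 : (|v| * (2 + C₄)) ^ 2 * M = v ^ 2 * ((2 + C₄) ^ 2 * M) := by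
      rw [mul_pow, sq_abs]; ring
    have g7 : 0 ≤ v ^ 2 * ((2 + C₄) ^ 2 * M) := by positivity
    have g8 : 0 ≤ |F - 1| * (2 + C₄) ^ 2 * M := by positivity
    linarith
  calc _ ≤ exp (B ^ 2) * (4 * (2 + C₄) ^ 2 * M * (v ^ 2 + |F - 1|)) := by gcongr
    _ = _ := by ring

/-- A solution `P` in logarithmic polar coordinates around a concentration point, compared with
the bubble `γ - φ/γ` up to the logarithmic radius `σ`. -/
structure IsBubblePair (δ L C₂ γ σ S : ℝ) (P P1 P2 Pθ Pθθ F : ℝ → ℝ → ℝ) (φ φ1 : ℝ → ℝ) :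
    Prop where
  polar : IsPolar S P P1 P2 Pθ Pθθ
  bubble : IsBubble γ φ φ1
  lt : σ < S
  eqn : ∀ s ≤ σ, ∀ θ, P2 s θ + Pθθ s θ =
    -(exp (2 * s) * F s θ * γ⁻¹ ^ 2 * exp (-γ ^ 2) * P s θ * exp (P s θ ^ 2))
  small : SmallAtBot fun s θ => P s θ - γ
  small1 : SmallAtBot P1
  pos : ∀ s ≤ σ, ∀ θ, 0 < P s θ
  osc : ∀ s ≤ σ, ∀ θ, P s θ * |Pθ s θ| ≤ C₂
  periodic : ∀ s ≤ σ, Function.Periodic (P s) (2 * π)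
  coeff : ∀ s ≤ σ, ∀ θ, |F s θ - 1| ≤ L * exp (s - σ)
  lower : φ σ ≤ (1 - δ) * γ ^ 2

namespace IsBubblePair

variable {δ L C₂ γ σ S : ℝ} {P P1 P2 Pθ Pθθ F : ℝ → ℝ → ℝ} {φ φ1 : ℝ → ℝ}

lemma bubble_continuous (hb : IsBubble γ φ φ1) : Continuous φ :=
  continuous_iff_continuousAt.2 fun s => (hb.d1 s).continuousAt

lemma bubble_deriv_continuous (hb : IsBubble γ φ φ1) : Continuous φ1 :=
  continuous_iff_continuousAt.2 fun s => (hb.d2 s).continuousAt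

lemma bubWeight_continuous (hb : IsBubble γ φ φ1) : Continuous (bubWeight γ φ) := by
  have := bubble_continuous hb
  unfold bubWeight
  fun_prop

/-- The rescaled difference with the bubble is a polar `C²` function. -/
lemma diff_polar (h : IsBubblePair δ L C₂ γ σ S P P1 P2 Pθ Pθθ F φ φ1) :
    IsPolar S (fun s θ => γ * (P s θ - γ) + φ s) (fun s θ => γ * P1 s θ + φ1 s)
      (fun s θ => γ * P2 s θ + (1 - φ s / γ ^ 2) * bubWeight γ φ s) (fun s θ => γ * Pθ s θ)
      (fun s θ => γ * Pθθ s θ) where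
  d1 s hs θ := (((h.polar.d1 s hs θ).sub_const γ).const_mul γ).add (h.bubble.d1 s)
  d2 s hs θ := ((h.polar.d2 s hs θ).const_mul γ).add (h.bubble.d2 s)
  dt s hs θ := (((h.polar.dt s hs θ).sub_const γ).const_mul γ).add_const (φ s)
  dtt s hs θ := (h.polar.dtt s hs θ).const_mul γ
  c0 := by
    have := (bubble_continuous h.bubble)
    exact (continuousOn_const.mul (h.polar.c0.sub continuousOn_const)).add
      (this.comp continuous_fst).continuousOn
  c1 := (continuousOn_const.mul h.polar.c1).add
    ((bubble_deriv_continuous h.bubble).comp continuous_fst).continuousOn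
  c2 := by
    have h1 := bubble_continuous h.bubble
    have h2 := bubWeight_continuous h.bubble
    have h3 : Continuous fun s => (1 - φ s / γ ^ 2) * bubWeight γ φ s := by fun_prop
    exact (continuousOn_const.mul h.polar.c2).add (h3.comp continuous_fst).continuousOn
  ct := continuousOn_const.mul h.polar.ct
  ctt := continuousOn_const.mul h.polar.ctt
  per s hs := by simp only [h.polar.per s hs]
  pert s hs := by simp only [h.polar.pert s hs]

lemma smallAtBot_add {v : ℝ → ℝ → ℝ} {g : ℝ → ℝ} {c : ℝ} (hc : 0 < c) (hv : SmallAtBot v)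
    (hg : Tendsto (fun s => exp (-s) * g s) atBot (𝓝 0)) :
    SmallAtBot fun s θ => c * v s θ + g s := by
  intro η hη
  have h1 := hv (η / (2 * c)) (by positivity)
  have h2 := hg.eventually (Metric.ball_mem_nhds 0 (half_pos hη))
  filter_upwards [h1, h2] with s a b θ
  rw [dist_zero_right, Real.norm_eq_abs, abs_mul, abs_of_pos (exp_pos _),
    exp_neg, inv_mul_lt_iff₀ (exp_pos _)] at b
  refine (abs_add_le _ _).trans ?_
  rw [abs_mul, abs_of_pos hc]
  have : c * |v s θ| ≤ c * (η / (2 * c) * exp s) := by gcongr; exact a θ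
  have e : c * (η / (2 * c) * exp s) = η / 2 * exp s := by field_simp
  linarith

/-- Linearised equation for the rescaled difference. -/
lemma source (h : IsBubblePair δ L C₂ γ σ S P P1 P2 Pθ Pθθ F φ φ1) (hγ : 1 ≤ γ) {s θ C₄ : ℝ}
    (hs : s ≤ σ) (h0 : 0 ≤ φ s) (h1 : φ s ≤ γ ^ 2) (hv : |γ * (P s θ - γ) + φ s| ≤ C₄) :
    |γ * P2 s θ + (1 - φ s / γ ^ 2) * bubWeight γ φ s + γ * Pθθ s θ
        + (1 / γ ^ 2 + 2 * (1 - φ s / γ ^ 2) ^ 2) * bubWeight γ φ s * (γ * (P s θ - γ) + φ s)| ≤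
      4 * (2 + C₄) ^ 2 * exp (C₄ * (2 + C₄)) * bubWeight γ φ s *
        ((γ * (P s θ - γ) + φ s) ^ 2 + |F s θ - 1|) := by
  have hγ0 : 0 < γ := by linarith
  have hB1 : γ - φ s / γ ≤ γ := by
    have : 0 ≤ φ s / γ := by positivity
    linarith
  have hB0 : 0 ≤ γ - φ s / γ := by
    rw [sub_nonneg, div_le_iff₀ hγ0]; linarith
  have key := source_estimate (F := F s θ) hγ hB0 hB1 hv
  have hP : γ - φ s / γ + (γ * (P s θ - γ) + φ s) / γ = P s θ := by field_simp; ring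
  have hsq : (γ - φ s / γ) ^ 2 = γ ^ 2 + (-2 * φ s + φ s ^ 2 / γ ^ 2) := by field_simp; ring
  rw [hP] at key
  have hw : bubWeight γ φ s = exp (2 * s) * (exp (-γ ^ 2) * exp ((γ - φ s / γ) ^ 2)) := by
    unfold bubWeight
    rw [hsq, exp_add (γ ^ 2), ← mul_assoc (exp (-γ ^ 2)), ← exp_add (-γ ^ 2), neg_add_cancel,
      exp_zero, one_mul]
  have hb : 1 - φ s / γ ^ 2 = γ⁻¹ * (γ - φ s / γ) := by field_simp
  have e : γ * P2 s θ + (1 - φ s / γ ^ 2) * bubWeight γ φ s + γ * Pθθ s θ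
        + (1 / γ ^ 2 + 2 * (1 - φ s / γ ^ 2) ^ 2) * bubWeight γ φ s * (γ * (P s θ - γ) + φ s) =
      -(exp (2 * s) * exp (-γ ^ 2)) *
        (γ⁻¹ * (F s θ * (P s θ * exp (P s θ ^ 2)) - (γ - φ s / γ) * exp ((γ - φ s / γ) ^ 2))
        - γ⁻¹ ^ 2 * (1 + 2 * (γ - φ s / γ) ^ 2) * exp ((γ - φ s / γ) ^ 2)
          * (γ * (P s θ - γ) + φ s)) := by
    have e1 : γ * P2 s θ + γ * Pθθ s θ =
        -(exp (2 * s) * F s θ * γ⁻¹ * exp (-γ ^ 2) * P s θ * exp (P s θ ^ 2)) := by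
      rw [← mul_add, h.eqn s hs θ]
      have : γ * γ⁻¹ ^ 2 = γ⁻¹ := by field_simp
      linear_combination (-(exp (2 * s) * F s θ * exp (-γ ^ 2) * P s θ * exp (P s θ ^ 2))) * this
    rw [add_right_comm (γ * P2 s θ), e1, hb, hw, one_div, ← inv_pow]
    generalize exp ((γ - φ s / γ) ^ 2) = E
    ring
  rw [e, abs_mul, abs_neg, abs_of_pos (by positivity)]
  refine (mul_le_mul_of_nonneg_left key (by positivity)).trans_eq ?_
  rw [hw]
  generalize exp ((γ - φ s / γ) ^ 2) = E
  ring

/-- If the mean of the difference is bounded, then so is the difference. -/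
lemma abs_le_of_mean (h : IsBubblePair δ L C₂ γ σ S P P1 P2 Pθ Pθθ F φ φ1) (hγ : 1 ≤ γ) {κ s : ℝ}
    (hκ : 0 < κ) (hγκ : 4 * (1 + 4 * π * C₂) ≤ κ ^ 2 * γ ^ 2) (hC₂ : 0 ≤ C₂) (hs : s ≤ σ)
    (hφ : φ s ≤ (1 - κ) * γ ^ 2) (hm : |∫ θ in 0..2 * π, (γ * (P s θ - γ) + φ s)| ≤ 1) (θ : ℝ) :
    |γ * (P s θ - γ) + φ s| ≤ 1 + 4 * π * C₂ / κ := by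
  have hγ0 : 0 < γ := by linarith
  have hpi := pi_pos
  have hS := hs.trans_lt h.lt
  have hcP : Continuous (P s) := continuous_slice hS h.polar.c0
  obtain ⟨θ₁, hθ₁, hav⟩ := exists_eq_interval_average (a := 0) (b := 2 * π)
    (f := fun θ => γ * (P s θ - γ) + φ s) two_pi_pos.ne (by fun_prop)
  rw [uIoo_of_lt two_pi_pos] at hθ₁
  have hv1 : |γ * (P s θ₁ - γ) + φ s| ≤ 1 := by
    rw [hav, interval_average_eq, smul_eq_mul, abs_mul, sub_zero, abs_inv, abs_of_pos two_pi_pos]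
    have : (2 * π)⁻¹ ≤ 1 := inv_le_one_of_one_le₀ (by linarith [pi_gt_three])
    calc _ ≤ 1 * (1 : ℝ) := by gcongr
      _ = 1 := by ring
  have hP1 : κ * γ - 1 ≤ P s θ₁ := by
    have h1 := (abs_le.1 hv1).1
    have h2 : (κ * γ - 1) * γ ≤ P s θ₁ * γ := by nlinarith
    exact le_of_mul_le_mul_right h2 hγ0
  have hκγ : 2 ≤ κ * γ := by
    have : (2 : ℝ) ^ 2 ≤ (κ * γ) ^ 2 := by
      rw [mul_pow]; nlinarith [mul_nonneg hpi.le hC₂]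
    exact le_of_sq_le_sq this (by positivity)
  obtain ⟨θ₂, hθ₂, hper⟩ := (h.periodic s hs).exists_mem_Ico₀ two_pi_pos θ
  rw [hper]
  have hlip : ∀ θ ∈ Icc 0 (2 * π), |P s θ ^ 2 - P s θ₁ ^ 2| ≤ 4 * π * C₂ := by
    intro θ hθ
    have := Convex.norm_image_sub_le_of_norm_hasDerivWithin_le (C := 2 * C₂)
      (f := fun θ => P s θ ^ 2) (f' := fun θ => 2 * P s θ * Pθ s θ) (s := Icc 0 (2 * π))
      (fun θ _ => (((h.polar.dt s hS θ).pow 2).congr_deriv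
        (by simp)).hasDerivWithinAt)
      (fun θ _ => by
        rw [Real.norm_eq_abs, abs_mul, abs_mul, abs_of_pos (h.pos s hs θ), abs_two, mul_assoc]
        linarith [h.osc s hs θ])
      (convex_Icc _ _) ⟨hθ₁.1.le, hθ₁.2.le⟩ hθ
    rw [Real.norm_eq_abs, Real.norm_eq_abs] at this
    refine this.trans ?_
    have h2 : |θ - θ₁| ≤ 2 * π := abs_le.2 ⟨by linarith [hθ.1, hθ₁.2], by linarith [hθ.2, hθ₁.1]⟩
    calc 2 * C₂ * |θ - θ₁| ≤ 2 * C₂ * (2 * π) := by gcongr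
      _ = _ := by ring
  have hlow : ∀ θ ∈ Icc 0 (2 * π), κ * γ / 2 ≤ P s θ := by
    intro θ hθ
    have h1 := (abs_le.1 (hlip θ hθ)).1
    have h2 : (κ * γ - 1) ^ 2 ≤ P s θ₁ ^ 2 := pow_le_pow_left₀ (by linarith) hP1 2
    have h3 : (κ * γ / 2) ^ 2 ≤ P s θ ^ 2 := by nlinarith [sq_nonneg (κ * γ - 2)]
    exact le_of_sq_le_sq h3 (h.pos s hs θ).le
  have hlip2 : |P s θ₂ - P s θ₁| ≤ 4 * π * C₂ / (κ * γ) := by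
    have := Convex.norm_image_sub_le_of_norm_hasDerivWithin_le (C := 2 * C₂ / (κ * γ))
      (f := P s) (f' := Pθ s) (s := Icc 0 (2 * π))
      (fun θ _ => (h.polar.dt s hS θ).hasDerivWithinAt)
      (fun θ hθ => by
        rw [Real.norm_eq_abs, le_div_iff₀ (by positivity)]
        have h1 := hlow θ hθ
        have h2 := h.osc s hs θ
        nlinarith [abs_nonneg (Pθ s θ)])
      (convex_Icc _ _) ⟨hθ₁.1.le, hθ₁.2.le⟩ ⟨hθ₂.1, hθ₂.2.le⟩
    rw [Real.norm_eq_abs, Real.norm_eq_abs] at this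
    refine this.trans ?_
    have h2 : |θ₂ - θ₁| ≤ 2 * π := abs_le.2 ⟨by linarith [hθ₂.1, hθ₁.2], by linarith [hθ₂.2, hθ₁.1]⟩
    calc 2 * C₂ / (κ * γ) * |θ₂ - θ₁| ≤ 2 * C₂ / (κ * γ) * (2 * π) := by gcongr
      _ = _ := by ring
  have e : γ * (P s θ₂ - γ) + φ s = (γ * (P s θ₁ - γ) + φ s) + γ * (P s θ₂ - P s θ₁) := by ring
  rw [e]
  refine (abs_add_le _ _).trans (add_le_add hv1 ?_)
  rw [abs_mul, abs_of_pos hγ0]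
  calc _ ≤ γ * (4 * π * C₂ / (κ * γ)) := by gcongr
    _ = _ := by field_simp

end IsBubblePair

lemma abs_integral_le_of_abs_le {g : ℝ → ℝ} {c : ℝ} (hg : ∀ θ, |g θ| ≤ c) :
    |∫ θ in 0..2 * π, g θ| ≤ c * (2 * π) := by
  have := intervalIntegral.norm_integral_le_of_norm_le_const (a := 0) (b := 2 * π) (f := g) (C := c)
    (fun θ _ => hg θ)
  rwa [sub_zero, abs_of_pos two_pi_pos] at this

/-- Uniform comparison with the bubble, and smallness of the mean of the difference. -/
theorem bubble_comparison {δ L C₂ : ℝ} (hδ : 0 < δ) (hδ2 : δ ≤ 1 / 2) (hL : 0 ≤ L) (hC₂ : 0 ≤ C₂) :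
    ∃ C₄ > 0, ∀ δ' > 0, δ' ≤ 1 / 2 → ∃ Γ ≥ 1, ∃ ρ : ℝ, ∃ η > 0, ∀ γ ≥ Γ,
      ∀ (σ S : ℝ) (P P1 P2 Pθ Pθθ F : ℝ → ℝ → ℝ) (φ φ1 : ℝ → ℝ),
      IsBubblePair δ L C₂ γ σ S P P1 P2 Pθ Pθθ F φ φ1 →
      (∀ s ≤ ρ, ∀ θ, |γ * (P s θ - γ) + limProfile s| ≤ η) →
      (∀ s ≤ σ, ∀ θ, |γ * (P s θ - γ) + φ s| ≤ C₄) ∧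
      |∫ θ in 0..2 * π, (γ * (P σ θ - γ) + φ σ)| ≤ δ' := by
  obtain ⟨κ, hκ⟩ : ∃ κ, κ = δ ^ 2 / 2 := ⟨_, rfl⟩
  have hκ0 : 0 < κ := by rw [hκ]; positivity
  have hκ1 : κ ≤ 1 / 8 := by rw [hκ]; nlinarith
  obtain ⟨C₄, hC₄⟩ : ∃ C₄, C₄ = 1 + 4 * π * C₂ / κ := ⟨_, rfl⟩
  have hC₄1 : 1 ≤ C₄ := by
    rw [hC₄]
    have : 0 ≤ 4 * π * C₂ / κ := by positivity
    linarith
  obtain ⟨Y, hY⟩ : ∃ Y, Y = 3 * exp (12 * 96 / (κ / 2)) := ⟨_, rfl⟩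
  have hY0 : 0 < Y := by rw [hY]; positivity
  obtain ⟨ε, hε⟩ : ∃ ε, ε = 1 / (8 * Y) := ⟨_, rfl⟩
  have hε0 : 0 < ε := by rw [hε]; positivity
  obtain ⟨C₅, hC₅⟩ : ∃ C₅, C₅ = 4 * (2 + C₄) ^ 2 * exp (C₄ * (2 + C₄)) := ⟨_, rfl⟩
  have hC₅0 : 0 < C₅ := by rw [hC₅]; positivity
  obtain ⟨D₀, hD₀⟩ : ∃ D₀, D₀ = 32 * C₅ * L + 1 := ⟨_, rfl⟩
  have hD₀0 : 0 < D₀ := by rw [hD₀]; positivity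
  obtain ⟨K, hK⟩ : ∃ K, K = Y * (6 * D₀ + 3 * C₄) := ⟨_, rfl⟩
  refine ⟨C₄, by linarith, fun δ' hδ' hδ'2 => ?_⟩
  obtain ⟨ρ₀, -, Γ₀, hΓ₀, hprof⟩ := bubble_profile hδ hδ2 hκ
    (show 0 < ε / (C₅ * C₄) by positivity)
  obtain ⟨ρ, hρ0, hρK⟩ : ∃ ρ, ρ₀ ≤ ρ ∧ ∀ s ≥ ρ, K * exp (-(κ / 2) * s) ≤ δ' := by
    have t : Tendsto (fun s : ℝ => K * exp (-(κ / 2 * s))) atTop (𝓝 (K * 0)) :=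
      (tendsto_exp_neg_atTop_nhds_zero.comp
        (tendsto_id.const_mul_atTop (half_pos hκ0))).const_mul _
    rw [mul_zero] at t
    obtain ⟨ρ, h1⟩ := eventually_atTop.1 (t.eventually (gt_mem_nhds hδ'))
    exact ⟨max ρ₀ ρ, le_max_left _ _, fun s hs => by
      rw [neg_mul]; exact (h1 s ((le_max_right _ _).trans hs)).le⟩
  obtain ⟨η, hη0, hη1, hη2⟩ : ∃ η > 0, 32 * C₅ * (2 * η) ≤ ε ∧ 2 * η * (2 * π) ≤ δ' := by
    refine ⟨min (ε / (64 * C₅)) (δ' / (4 * π)), by positivity, ?_, ?_⟩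
    · calc _ ≤ 32 * C₅ * (2 * (ε / (64 * C₅))) := by gcongr; exact min_le_left _ _
        _ = ε := by field_simp; norm_num
    · calc _ ≤ 2 * (δ' / (4 * π)) * (2 * π) := by gcongr; exact min_le_right _ _
        _ = δ' := by field_simp; norm_num
  obtain ⟨Γ₁, hΓ₁, hclose⟩ := exists_limProfile_close hη0 ρ
  refine ⟨max Γ₀ (max Γ₁ (4 * (1 + 4 * π * C₂) / κ ^ 2)), le_max_of_le_left hΓ₀, ρ, η, hη0, ?_⟩
  intro γ hγ σ S P P1 P2 Pθ Pθθ F φ φ1 h hlim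
  obtain ⟨hγ0, hγ'⟩ := max_le_iff.1 hγ
  obtain ⟨hγ1, hγ2⟩ := max_le_iff.1 hγ'
  have hγone : 1 ≤ γ := hΓ₀.trans hγ0
  have hγpos : 0 < γ := by linarith
  have hγκ : 4 * (1 + 4 * π * C₂) ≤ κ ^ 2 * γ ^ 2 := by
    rw [div_le_iff₀ (by positivity)] at hγ2
    calc _ ≤ γ * κ ^ 2 := hγ2
      _ ≤ γ ^ 2 * κ ^ 2 := by gcongr; exact le_self_pow₀ hγone two_ne_zero
      _ = _ := by ring
  have hp := hprof γ hγ0 φ φ1 h.bubble σ h.lower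
  have hφle : ∀ s ≤ σ, φ s ≤ γ ^ 2 := fun s hs => (hp s hs).2.1.trans (by
    nlinarith [mul_nonneg hκ0.le (sq_nonneg γ)])
  have hpol := h.diff_polar
  set v : ℝ → ℝ → ℝ := fun s θ => γ * (P s θ - γ) + φ s with hv
  have hnear : ∀ s ≤ σ, s ≤ ρ → ∀ θ, |v s θ| ≤ 2 * η := fun s hs hsρ θ => by
    have h1 := hlim s hsρ θ
    have h2 := (hclose γ hγ1 φ φ1 h.bubble σ hφle s hs hsρ).1
    have e : v s θ = (γ * (P s θ - γ) + limProfile s) + (φ s - limProfile s) := by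
      simp only [hv]; ring
    rw [e]
    exact (abs_add_le _ _).trans (by linarith)
  have hbd : ∀ s ≤ σ, |∫ θ in 0..2 * π, v s θ| ≤ 1 → ∀ θ, |v s θ| ≤ C₄ := fun s hs hm θ => by
    rw [hC₄]
    exact h.abs_le_of_mean hγone hκ0 hγκ hC₂ hs (hp s hs).2.1 hm θ
  have hstep : ∀ s₀ ≤ σ, (∀ s ≤ s₀, |∫ θ in 0..2 * π, v s θ| ≤ 1) →
      |∫ θ in 0..2 * π, v s₀ θ| ≤ δ' := by
    intro s₀ hs₀ hm
    rcases le_total s₀ ρ with hsρ | hsρ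
    · exact (abs_integral_le_of_abs_le (hnear s₀ hs₀ hsρ)).trans hη2
    have hvb : ∀ s ≤ s₀, ∀ θ, |v s θ| ≤ C₄ := fun s hs => hbd s (hs.trans hs₀) (hm s hs)
    have hw0 : ∀ s, 0 ≤ bubWeight γ φ s := fun s => by unfold bubWeight; positivity
    have hcoef : ∀ s ≤ s₀, 1 / γ ^ 2 + 2 * (1 - φ s / γ ^ 2) ^ 2 ≤ 1 / γ ^ 2 + 2 := by
      intro s hs
      have h1 : 0 ≤ φ s / γ ^ 2 := div_nonneg (hp s (hs.trans hs₀)).1 (sq_nonneg γ)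
      have h2 : φ s / γ ^ 2 ≤ 1 := div_le_one_of_le₀ (hφle s (hs.trans hs₀)) (sq_nonneg γ)
      have h3 : (1 - φ s / γ ^ 2) ^ 2 ≤ 1 := pow_le_one₀ (by linarith) (by linarith)
      linarith
    have key := hpol.bound (k := fun s => (1 / γ ^ 2 + 2 * (1 - φ s / γ ^ 2) ^ 2) * bubWeight γ φ s)
      (s₀ := s₀) (α := κ / 2) (Ck := 96) (D₀ := D₀) (C₄ := C₄) (ε := ε) (hs₀.trans_lt h.lt)
      (half_pos hκ0) (by linarith) (by norm_num) hD₀0 (by linarith) hε0.le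
      (by rw [← hY, hε]; field_simp; norm_num)
      (fun s hs => mul_nonneg (by positivity) (hw0 s))
      (fun s hs => (mul_le_mul_of_nonneg_right (hcoef s hs) (hw0 s)).trans
        (hp s (hs.trans hs₀)).2.2.2.1)
      (fun s hs => by
        have h1 := mul_le_mul_of_nonneg_right (hcoef s hs) (hw0 s)
        have h2 : 1 / γ ^ 2 ≤ 1 := div_le_one_of_le₀ (one_le_pow₀ hγone) (sq_nonneg γ)
        have h3 := (hp s (hs.trans hs₀)).2.2.1
        have h4 : (1 / γ ^ 2 + 2) * bubWeight γ φ s ≤ 3 * bubWeight γ φ s :=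
          mul_le_mul_of_nonneg_right (by linarith) (hw0 s)
        linarith)
      (by
        have e : v = fun s θ => γ * (P s θ - γ) + φ s := hv
        exact IsBubblePair.smallAtBot_add hγpos h.small h.bubble.l0)
      (IsBubblePair.smallAtBot_add hγpos h.small1 h.bubble.l1)
      (fun s hs θ => by
        have hsσ := hs.trans hs₀
        have hs1 := hvb s hs θ
        have h1 := h.source hγone hsσ (hp s hsσ).1 (hφle s hsσ) hs1
        rw [← hC₅] at h1
        refine h1.trans ?_
        have hF : |F s θ - 1| ≤ L * exp (s - s₀) := (h.coeff s hsσ θ).trans (by gcongr)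
        have hkp := kap_pos (κ / 2) s
        have a1 : C₅ * bubWeight γ φ s * |F s θ - 1| ≤
            kap (κ / 2) s * (D₀ * exp (s - s₀)) := by
          calc _ ≤ C₅ * (32 * kap (κ / 2) s) * (L * exp (s - s₀)) := by
                gcongr; exact (hp s hsσ).2.2.1
            _ = kap (κ / 2) s * ((32 * C₅ * L) * exp (s - s₀)) := by ring
            _ ≤ _ := by gcongr; linarith
        have a2 : C₅ * bubWeight γ φ s * v s θ ^ 2 ≤ kap (κ / 2) s * (ε * |v s θ|) := by
          rw [← sq_abs, sq]
          rcases le_total s ρ with hsρ | hsρ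
          · calc _ ≤ C₅ * (32 * kap (κ / 2) s) * (2 * η * |v s θ|) := by
                  gcongr
                  · exact (hp s hsσ).2.2.1
                  · exact hnear s hsσ hsρ θ
              _ = kap (κ / 2) s * (32 * C₅ * (2 * η) * |v s θ|) := by ring
              _ ≤ _ := by gcongr
          · calc _ ≤ C₅ * (ε / (C₅ * C₄) * kap (κ / 2) s) * (C₄ * |v s θ|) := by
                  gcongr
                  exact (hp s hsσ).2.2.2.2 (hρ0.trans hsρ)
              _ = _ := by field_simp
        have e : v s θ = γ * (P s θ - γ) + φ s := rfl
        rw [← e]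
        linarith)
      (hvb s₀ le_rfl)
    rw [← hY, ← hK] at key
    exact key.trans (hρK s₀ hsρ)
  have hall : ∀ s ≤ σ, |∫ θ in 0..2 * π, v s θ| ≤ 1 := by
    intro s hs
    by_contra! hlt
    have hcont : ContinuousOn (fun s => |∫ θ in 0..2 * π, v s θ|) (Iic s) := fun t ht =>
      ((hasDerivAt_integral_param (ht.trans_lt (hs.trans_lt h.lt)) hpol.d1 hpol.c0
        hpol.c1).continuousAt.abs).continuousWithinAt
    have hbot : ∀ᶠ t in atBot, |∫ θ in 0..2 * π, v t θ| < 1 := by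
      filter_upwards [eventually_le_atBot σ, eventually_le_atBot ρ] with t h1 h2
      have := (abs_integral_le_of_abs_le (hnear t h1 h2)).trans hη2
      linarith
    obtain ⟨t, hts, ht1, hle⟩ := exists_first_hit hcont hbot hlt.le
    have := hstep t (hts.trans hs) hle
    linarith
  exact ⟨fun s hs => hbd s hs (hall s hs), hstep σ le_rfl hall⟩

lemma mkPt_eq (a b : ℝ) :
    mkPt a b = a • EuclideanSpace.single (0 : Fin 2) (1 : ℝ) + b • EuclideanSpace.single 1 1 := by
  ext i
  fin_cases i <;> simp [mkPt]

lemma norm_mkPt (a b : ℝ) : ‖mkPt a b‖ = √(a ^ 2 + b ^ 2) := by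
  rw [EuclideanSpace.norm_eq]
  simp [mkPt]

lemma exists_polar (x : Pt) : ∃ θ, x = ‖x‖ • mkPt (cos θ) (sin θ) := by
  refine ⟨Complex.arg ⟨x 0, x 1⟩, ?_⟩
  set z : ℂ := ⟨x 0, x 1⟩ with hz
  have h1 : ‖x‖ = ‖z‖ := by
    rw [EuclideanSpace.norm_eq, Complex.norm_def, Complex.normSq_apply]
    simp [hz, sq]
  rw [h1]
  ext i
  fin_cases i
  · simp [mkPt, Complex.norm_mul_cos_arg, hz]
  · simp [mkPt, Complex.norm_mul_sin_arg, hz]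

/-- The point at logarithmic radius `s` and angle `θ`, relative to the centre. -/
def polarVec (μ s θ : ℝ) : Pt := (μ * exp s) • mkPt (cos θ) (sin θ)

/-- The angular derivative of `polarVec`. -/
def polarNormal (μ s θ : ℝ) : Pt := (μ * exp s) • mkPt (-sin θ) (cos θ)

lemma norm_polarVec {μ : ℝ} (hμ : 0 < μ) (s θ : ℝ) : ‖polarVec μ s θ‖ = μ * exp s := by
  rw [polarVec, norm_smul, norm_mkPt, cos_sq_add_sin_sq, sqrt_one, mul_one, Real.norm_eq_abs,
    abs_of_pos (by positivity)]

lemma norm_polarNormal {μ : ℝ} (hμ : 0 < μ) (s θ : ℝ) : ‖polarNormal μ s θ‖ = μ * exp s := by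
  rw [polarNormal, norm_smul, norm_mkPt, neg_sq, sin_sq_add_cos_sq, sqrt_one, mul_one,
    Real.norm_eq_abs, abs_of_pos (by positivity)]

lemma hasDerivAt_polarVec_fst (μ s θ : ℝ) :
    HasDerivAt (fun s => polarVec μ s θ) (polarVec μ s θ) s :=
  ((Real.hasDerivAt_exp s).const_mul μ).smul_const _

lemma hasDerivAt_mkPt {a b : ℝ → ℝ} {a' b' θ : ℝ} (ha : HasDerivAt a a' θ)
    (hb : HasDerivAt b b' θ) : HasDerivAt (fun θ => mkPt (a θ) (b θ)) (mkPt a' b') θ := by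
  simp only [mkPt_eq]
  exact (ha.smul_const _).add (hb.smul_const _)

lemma hasDerivAt_polarVec_snd (μ s θ : ℝ) :
    HasDerivAt (fun θ => polarVec μ s θ) (polarNormal μ s θ) θ :=
  (hasDerivAt_mkPt (hasDerivAt_cos θ) (hasDerivAt_sin θ)).fun_const_smul _

lemma hasDerivAt_polarNormal (μ s θ : ℝ) :
    HasDerivAt (fun θ => polarNormal μ s θ) (-polarVec μ s θ) θ := by
  have h := (hasDerivAt_mkPt (hasDerivAt_sin θ).neg (hasDerivAt_cos θ)).const_smul (μ * exp s)
  refine h.congr_deriv ?_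
  rw [polarVec, ← smul_neg, mkPt_eq, mkPt_eq]
  simp only [neg_smul, neg_add]

lemma continuous_polarVec (μ : ℝ) : Continuous fun p : ℝ × ℝ => polarVec μ p.1 p.2 := by
  simp only [polarVec, mkPt_eq]
  fun_prop

lemma continuous_polarNormal (μ : ℝ) : Continuous fun p : ℝ × ℝ => polarNormal μ p.1 p.2 := by
  simp only [polarNormal, mkPt_eq]
  fun_prop

lemma polarVec_add_two_pi (μ s θ : ℝ) : polarVec μ s (θ + 2 * π) = polarVec μ s θ := by
  simp [polarVec]

lemma polarNormal_add_two_pi (μ s θ : ℝ) : polarNormal μ s (θ + 2 * π) = polarNormal μ s θ := by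
  simp [polarNormal]

lemma lap_mul_sq {u : Pt → ℝ} {x : Pt} (hu : DifferentiableAt ℝ (fderiv ℝ u) x) (μ s θ : ℝ) :
    fderiv ℝ (fderiv ℝ u) x (polarVec μ s θ) (polarVec μ s θ) +
      fderiv ℝ (fderiv ℝ u) x (polarNormal μ s θ) (polarNormal μ s θ) =
      -((μ * exp s) ^ 2 * lap u x) := by
  have e : ∀ w : Pt, fderiv ℝ (fun y => fderiv ℝ u y w) x w = fderiv ℝ (fderiv ℝ u) x w w := by
    intro w
    rw [fderiv_clm_apply hu (differentiableAt_const w)]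
    simp
  simp only [lap, Fin.sum_univ_two, e, polarVec, polarNormal, mkPt_eq, map_add, map_smul,
    smul_add, smul_smul, add_apply, smul_apply, smul_eq_mul]
  have := sin_sq_add_cos_sq θ
  set A := fderiv ℝ (fderiv ℝ u) x (EuclideanSpace.single 0 1) (EuclideanSpace.single 0 1)
  set B := fderiv ℝ (fderiv ℝ u) x (EuclideanSpace.single 1 1) (EuclideanSpace.single 1 1)
  linear_combination (μ * exp s) ^ 2 * (A + B) * this

section

variable {u : Pt → ℝ} {c : Pt} {μ R : ℝ}

lemma add_polarVec_mem (hμ : 0 < μ) (hR : 0 < R) {s : ℝ} (hs : s < log (R / μ)) (θ : ℝ) :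
    c + polarVec μ s θ ∈ ball c R := by
  rw [mem_ball, dist_eq_norm, add_sub_cancel_left, norm_polarVec hμ, mul_comm,
    ← lt_div_iff₀ hμ]
  exact (lt_log_iff_exp_lt (by positivity)).1 hs

/-- A smooth function on a disk, in logarithmic polar coordinates. -/
lemma isPolar_of_contDiffOn (hμ : 0 < μ) (hR : 0 < R) (hu : ContDiffOn ℝ (⊤ : ℕ∞) u (ball c R)) :
    IsPolar (log (R / μ)) (fun s θ => u (c + polarVec μ s θ))
      (fun s θ => fderiv ℝ u (c + polarVec μ s θ) (polarVec μ s θ))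
      (fun s θ => fderiv ℝ (fderiv ℝ u) (c + polarVec μ s θ) (polarVec μ s θ) (polarVec μ s θ) +
        fderiv ℝ u (c + polarVec μ s θ) (polarVec μ s θ))
      (fun s θ => fderiv ℝ u (c + polarVec μ s θ) (polarNormal μ s θ))
      (fun s θ => fderiv ℝ (fderiv ℝ u) (c + polarVec μ s θ) (polarNormal μ s θ)
        (polarNormal μ s θ) - fderiv ℝ u (c + polarVec μ s θ) (polarVec μ s θ)) := by
  have hu1 : ContDiffOn ℝ (⊤ : ℕ∞) (fderiv ℝ u) (ball c R) :=
    hu.fderiv_of_isOpen isOpen_ball (by simp)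
  have hu2 : ContDiffOn ℝ (⊤ : ℕ∞) (fderiv ℝ (fderiv ℝ u)) (ball c R) :=
    hu1.fderiv_of_isOpen isOpen_ball (by simp)
  have hmem : ∀ s < log (R / μ), ∀ θ, c + polarVec μ s θ ∈ ball c R := fun s hs θ =>
    add_polarVec_mem hμ hR hs θ
  have hd : ∀ s < log (R / μ), ∀ θ, HasFDerivAt u (fderiv ℝ u (c + polarVec μ s θ))
      (c + polarVec μ s θ) := fun s hs θ =>
    ((hu.differentiableOn (by simp)).differentiableAt
      (isOpen_ball.mem_nhds (hmem s hs θ))).hasFDerivAt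
  have hd1 : ∀ s < log (R / μ), ∀ θ, HasFDerivAt (fderiv ℝ u)
      (fderiv ℝ (fderiv ℝ u) (c + polarVec μ s θ)) (c + polarVec μ s θ) := fun s hs θ =>
    ((hu1.differentiableOn (by simp)).differentiableAt
      (isOpen_ball.mem_nhds (hmem s hs θ))).hasFDerivAt
  have hpc : ContinuousOn (fun p : ℝ × ℝ => c + polarVec μ p.1 p.2) (Iio (log (R / μ)) ×ˢ univ) :=
    ((continuous_polarVec μ).const_add c).continuousOn
  have hpm : MapsTo (fun p : ℝ × ℝ => c + polarVec μ p.1 p.2) (Iio (log (R / μ)) ×ˢ univ)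
      (ball c R) := fun p hp => hmem p.1 hp.1 p.2
  have k0 := hu.continuousOn.comp hpc hpm
  have k1 := hu1.continuousOn.comp hpc hpm
  have k2 := hu2.continuousOn.comp hpc hpm
  have kv : ContinuousOn (fun p : ℝ × ℝ => polarVec μ p.1 p.2) (Iio (log (R / μ)) ×ˢ univ) :=
    (continuous_polarVec μ).continuousOn
  have kn : ContinuousOn (fun p : ℝ × ℝ => polarNormal μ p.1 p.2) (Iio (log (R / μ)) ×ˢ univ) :=
    (continuous_polarNormal μ).continuousOn
  have per := fun s => polarVec_add_two_pi μ s 0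
  have pern := fun s => polarNormal_add_two_pi μ s 0
  simp only [zero_add] at per pern
  refine ⟨?_, ?_, ?_, ?_, k0, k1.clm_apply kv, ((k2.clm_apply kv).clm_apply kv).add
    (k1.clm_apply kv), k1.clm_apply kn, ((k2.clm_apply kn).clm_apply kn).sub (k1.clm_apply kv),
    ?_, ?_⟩
  · intro s hs θ
    exact (hd s hs θ).comp_hasDerivAt s ((hasDerivAt_polarVec_fst μ s θ).const_add c)
  · intro s hs θ
    have h1 : HasDerivAt (fun s => fderiv ℝ u (c + polarVec μ s θ))
        (fderiv ℝ (fderiv ℝ u) (c + polarVec μ s θ) (polarVec μ s θ)) s :=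
      (hd1 s hs θ).comp_hasDerivAt s ((hasDerivAt_polarVec_fst μ s θ).const_add c)
    exact h1.clm_apply (hasDerivAt_polarVec_fst μ s θ)
  · intro s hs θ
    exact (hd s hs θ).comp_hasDerivAt θ ((hasDerivAt_polarVec_snd μ s θ).const_add c)
  · intro s hs θ
    have h1 : HasDerivAt (fun θ => fderiv ℝ u (c + polarVec μ s θ))
        (fderiv ℝ (fderiv ℝ u) (c + polarVec μ s θ) (polarNormal μ s θ)) θ :=
      (hd1 s hs θ).comp_hasDerivAt θ ((hasDerivAt_polarVec_snd μ s θ).const_add c)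
    refine (h1.clm_apply (hasDerivAt_polarNormal μ s θ)).congr_deriv ?_
    rw [map_neg, ← sub_eq_add_neg]
  · intro s _
    simp only [per]
  · intro s _
    simp only [per, pern]

lemma eventually_polarVec {p : Pt → Prop} (hμ : 0 < μ) (hp : ∀ᶠ x in 𝓝 c, p x) :
    ∀ᶠ s in atBot, ∀ θ, p (c + polarVec μ s θ) := by
  obtain ⟨r, hr, h⟩ := Metric.eventually_nhds_iff_ball.1 hp
  filter_upwards [eventually_lt_atBot (log (r / μ))] with s hs θ
  exact h _ (add_polarVec_mem hμ hr hs θ)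

lemma smallAtBot_sub (hμ : 0 < μ) (hu : DifferentiableAt ℝ u c) (h0 : fderiv ℝ u c = 0) :
    SmallAtBot fun s θ => u (c + polarVec μ s θ) - u c := by
  intro η hη
  have h := hu.hasFDerivAt
  rw [h0, hasFDerivAt_iff_isLittleO] at h
  filter_upwards [eventually_polarVec hμ (h.bound (show 0 < η / μ by positivity))] with s hs θ
  have := hs θ
  simp only [zero_apply, sub_zero, add_sub_cancel_left, norm_polarVec hμ,
    Real.norm_eq_abs] at this
  refine this.trans_eq ?_
  field_simp

lemma smallAtBot_fderiv (hμ : 0 < μ) (hu : ContinuousAt (fderiv ℝ u) c) (h0 : fderiv ℝ u c = 0) :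
    SmallAtBot fun s θ => fderiv ℝ u (c + polarVec μ s θ) (polarVec μ s θ) := by
  intro η hη
  rw [ContinuousAt, h0] at hu
  filter_upwards [eventually_polarVec hμ (hu (Metric.ball_mem_nhds 0
    (show 0 < η / μ by positivity)))] with s hs θ
  have := hs θ
  rw [mem_ball_zero_iff] at this
  have h2 := (fderiv ℝ u (c + polarVec μ s θ)).le_opNorm (polarVec μ s θ)
  rw [norm_polarVec hμ, Real.norm_eq_abs] at h2
  refine h2.trans ?_
  calc _ ≤ η / μ * (μ * exp s) := by gcongr
    _ = _ := by field_simp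

end

lemma tendsto_mul_exp_atBot (μ : ℝ) : Tendsto (fun s => μ * exp s) atBot (𝓝 0) := by
  simpa using tendsto_exp_atBot.const_mul μ

/-- A radial solution in the logarithmic variable. -/
lemma isBubble_of_ode {B : ℝ → ℝ} {γ μ g : ℝ} (hγ : 0 < γ) (hμ : 0 < μ)
    (hB : ContDiff ℝ (⊤ : ℕ∞) B) (hB0 : B 0 = γ) (hB0' : deriv B 0 = 0)
    (hode : ∀ r > (0 : ℝ), deriv (deriv B) r + deriv B r / r = -(g * B r * exp (B r ^ 2)))
    (hμdef : μ ^ 2 * (g * γ ^ 2 * exp (γ ^ 2)) = 1) :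
    IsBubble γ (fun s => γ * (γ - B (μ * exp s)))
      (fun s => -(γ * (μ * exp s) * deriv B (μ * exp s))) := by
  have hd : ∀ r, HasDerivAt B (deriv B r) r := fun r =>
    (hB.differentiable (by simp) r).hasDerivAt
  have hB1 : ContDiff ℝ (⊤ : ℕ∞) (deriv B) := by
    have : ContDiff ℝ ((⊤ : ℕ∞) + 1) B := hB
    exact (contDiff_succ_iff_deriv.1 this).2.2
  have hd1 : ∀ r, HasDerivAt (deriv B) (deriv (deriv B) r) r := fun r =>
    (hB1.differentiable (by simp) r).hasDerivAt
  have he : ∀ s, HasDerivAt (fun s => μ * exp s) (μ * exp s) s := fun s =>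
    (Real.hasDerivAt_exp s).const_mul μ
  refine ⟨fun s => ?_, fun s => ?_, ?_, ?_⟩
  · have h1 : HasDerivAt (fun s => B (μ * exp s)) (deriv B (μ * exp s) * (μ * exp s)) s :=
      (hd _).comp s (he s)
    exact ((h1.const_sub γ).const_mul γ).congr_deriv (by ring)
  · have h1 : HasDerivAt (fun s => deriv B (μ * exp s))
        (deriv (deriv B) (μ * exp s) * (μ * exp s)) s := (hd1 _).comp s (he s)
    refine ((((he s).const_mul γ).mul h1).neg).congr_deriv ?_
    have hρ : 0 < μ * exp s := by positivity
    have h2 := hode _ hρ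
    unfold bubWeight
    set ρ := μ * exp s with hρdef
    set b := B ρ with hb
    have e1 : -2 * (γ * (γ - b)) + (γ * (γ - b)) ^ 2 / γ ^ 2 = b ^ 2 - γ ^ 2 := by
      field_simp; ring
    have e2 : 1 - γ * (γ - b) / γ ^ 2 = b / γ := by field_simp; ring
    have e3 : exp (2 * s) = exp s ^ 2 := by rw [← exp_nat_mul]; norm_num
    have e4 : deriv B ρ * 1 + deriv (deriv B) ρ * ρ = -(g * b * exp (b ^ 2) * ρ) := by
      rw [← neg_mul, ← h2]; field_simp; ring
    rw [e1, e2, e3, exp_sub]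
    have e5 : -(γ * ρ * deriv B ρ + γ * ρ * (deriv (deriv B) ρ * ρ)) =
        γ * g * b * exp (b ^ 2) * ρ ^ 2 := by
      linear_combination (-γ * ρ) * e4
    rw [e5, hρdef]
    field_simp
    linear_combination b * hμdef
  · have h := hd 0
    rw [hB0', hasDerivAt_iff_isLittleO, hB0] at h
    have h2 := (h.comp_tendsto (tendsto_mul_exp_atBot μ)).tendsto_div_nhds_zero
    have h3 := h2.const_mul (-(γ * μ))
    rw [mul_zero] at h3
    refine h3.congr fun s => ?_
    simp only [Function.comp_apply, smul_zero, sub_zero]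
    rw [exp_neg]
    field_simp
    ring
  · have h1 : Tendsto (fun s => deriv B (μ * exp s)) atBot (𝓝 0) := by
      rw [← hB0']
      exact (hd1 0).continuousAt.tendsto.comp (tendsto_mul_exp_atBot μ)
    have h3 := h1.const_mul (-(γ * μ))
    rw [mul_zero] at h3
    refine h3.congr fun s => ?_
    rw [exp_neg]
    field_simp

lemma ball_infDist_frontier_subset {Ω : Set Pt} (hΩo : IsOpen Ω) {c : Pt} (hc : c ∈ Ω) :
    ball c (infDist c (frontier Ω)) ⊆ Ω := by
  rcases le_or_gt (infDist c (frontier Ω)) 0 with h | h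
  · simp [ball_eq_empty.2 h]
  refine (convex_ball c _).isPreconnected.subset_left_of_subset_union hΩo
    isClosed_closure.isOpen_compl (disjoint_compl_right.mono_left subset_closure) (fun x hx => ?_)
    ⟨c, mem_ball_self h, hc⟩
  by_contra hn
  have hxf : x ∈ frontier Ω := by
    rw [hΩo.frontier_eq]
    exact ⟨not_not.1 fun h' => hn (Or.inr h'), fun h' => hn (Or.inl h')⟩
  rw [mem_ball, dist_comm] at hx
  exact absurd (infDist_le_dist_of_mem hxf) (not_le.2 hx)

/-- A function which is smooth up to the boundary has bounded derivative. -/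
lemma exists_fderiv_bound {Ω : Set Pt} (hΩo : IsOpen Ω) (hΩb : Bornology.IsBounded Ω) {f : Pt → ℝ}
    (hf : ContDiffOn ℝ (⊤ : ℕ∞) f (closure Ω)) : ∃ K, ∀ x ∈ Ω, ‖fderiv ℝ f x‖ ≤ K := by
  have hK : IsCompact (closure Ω) := hΩb.isCompact_closure
  obtain ⟨K, h⟩ := hK.induction_on (p := fun s => ∃ K, ∀ x ∈ s ∩ Ω, ‖fderiv ℝ f x‖ ≤ K)
    ⟨0, by simp⟩ (fun s t hst ⟨K, h⟩ => ⟨K, fun x hx => h x ⟨hst hx.1, hx.2⟩⟩)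
    (fun s t ⟨K, h⟩ ⟨K', h'⟩ => ⟨max K K', fun x hx => hx.1.elim
      (fun hs => (h x ⟨hs, hx.2⟩).trans (le_max_left _ _))
      (fun ht => (h' x ⟨ht, hx.2⟩).trans (le_max_right _ _))⟩)
    (fun x hx => by
      have h1 : ContDiffWithinAt ℝ (0 + 1) f (closure Ω) x := (hf x hx).of_le (by simp)
      obtain ⟨w, hw, -, f', hf', hc⟩ := (contDiffWithinAt_succ_iff_hasFDerivWithinAt (by simp)).1 h1
      rw [insert_eq_of_mem hx] at hw
      have h2 := hc.continuousWithinAt.norm.eventually (gt_mem_nhds (lt_add_one ‖f' x‖))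
      obtain ⟨V, hV, hxV, hVw⟩ := mem_nhdsWithin.1 hw
      refine ⟨{y | y ∈ w → ‖f' y‖ < ‖f' x‖ + 1} ∩ (V ∩ closure Ω), ?_, ‖f' x‖ + 1, ?_⟩
      · refine inter_mem ?_ (inter_mem (mem_nhdsWithin_of_mem_nhds (hV.mem_nhds hxV))
          self_mem_nhdsWithin)
        exact mem_nhdsWithin_of_mem_nhds (mem_nhdsWithin_iff_eventually.1 h2)
      · rintro y ⟨⟨hy1, hyV, hyc⟩, hyΩ⟩
        have hyw : y ∈ w := hVw ⟨hyV, hyc⟩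
        have hwn : w ∈ 𝓝 y := mem_of_superset ((hV.inter hΩo).mem_nhds ⟨hyV, hyΩ⟩)
          fun z hz => hVw ⟨hz.1, subset_closure hz.2⟩
        rw [((hf' y hyw).hasFDerivAt hwn).fderiv]
        exact (hy1 hyw).le)
  exact ⟨K, fun x hx => h x ⟨subset_closure hx, hx⟩⟩

lemma dist_iteratedFDeriv_zero (f g : Pt → ℝ) (x : Pt) :
    dist (iteratedFDeriv ℝ 0 f x) (iteratedFDeriv ℝ 0 g x) = |f x - g x| := by
  rw [iteratedFDeriv_zero_eq_comp, iteratedFDeriv_zero_eq_comp, Function.comp_apply,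
    Function.comp_apply, LinearIsometryEquiv.dist_map, Real.dist_eq]

/-- Uniform positivity and Lipschitz bounds for the coefficients. -/
lemma exists_coeff_bound {Ω : Set Pt} (hΩo : IsOpen Ω) (hΩb : Bornology.IsBounded Ω)
    (hΩne : Ω.Nonempty) {f : ℕ → Pt → ℝ} {f₀ : Pt → ℝ}
    (hfs : ∀ n, ContDiffOn ℝ (⊤ : ℕ∞) (f n) (closure Ω))
    (hf₀s : ContDiffOn ℝ (⊤ : ℕ∞) f₀ (closure Ω)) (hf₀pos : ∀ x ∈ closure Ω, 0 < f₀ x)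
    (hfc : TendstoCkOn f f₀ (closure Ω) 1) :
    ∃ a > 0, ∃ K ≥ 0, ∀ᶠ n in atTop, ∀ (c : Pt) (R : ℝ), ball c R ⊆ Ω →
      ∀ x ∈ ball c R, a ≤ f n c ∧ |f n x - f n c| ≤ K * ‖x - c‖ := by
  obtain ⟨x₀, hx₀, hmin⟩ := hΩb.isCompact_closure.exists_isMinOn hΩne.closure hf₀s.continuousOn
  have ha := hf₀pos x₀ hx₀
  obtain ⟨K, hK⟩ := exists_fderiv_bound hΩo hΩb hf₀s
  obtain ⟨y, hy⟩ := hΩne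
  have hK0 : 0 ≤ K := (norm_nonneg _).trans (hK y hy)
  refine ⟨f₀ x₀ / 2, half_pos ha, K + 1, by linarith, ?_⟩
  filter_upwards [Metric.tendstoUniformlyOn_iff.1 (hfc 0 (by norm_num)) _ (half_pos ha),
    Metric.tendstoUniformlyOn_iff.1 (hfc 1 le_rfl) 1 one_pos] with n h0 h1 c R hball x hx
  have hcR : c ∈ ball c R := mem_ball_self (dist_nonneg.trans_lt hx)
  constructor
  · have hc := subset_closure (hball hcR)
    have h2 := h0 c hc
    rw [dist_iteratedFDeriv_zero] at h2
    have h3 : f₀ x₀ ≤ f₀ c := hmin hc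
    linarith [(abs_lt.1 h2).2]
  · have hb : ∀ z ∈ ball c R, ‖fderiv ℝ (f n) z‖ ≤ K + 1 := fun z hz => by
      have h2 := h1 z (subset_closure (hball hz))
      rw [← norm_iteratedFDeriv_one]
      have h3 := hK z (hball hz)
      rw [← norm_iteratedFDeriv_one] at h3
      rw [dist_eq_norm] at h2
      have := norm_sub_norm_le (iteratedFDeriv ℝ 1 (f n) z) (iteratedFDeriv ℝ 1 f₀ z)
      rw [norm_sub_rev] at this
      linarith
    exact Convex.norm_image_sub_le_of_norm_fderiv_le (𝕜 := ℝ)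
      (fun z hz => (((hfs n).mono subset_closure).differentiableOn (by simp)).differentiableAt
        (hΩo.mem_nhds (hball hz))) hb (convex_ball c R) hcR hx

lemma mul_exp_log_div {μ r : ℝ} (hμ : 0 < μ) (hr : 0 < r) : μ * exp (log (r / μ)) = r := by
  rw [exp_log (by positivity)]
  field_simp

lemma mul_exp_eq_mul_exp_sub {μ r : ℝ} (hμ : 0 < μ) (hr : 0 < r) (s : ℝ) :
    μ * exp s = r * exp (s - log (r / μ)) := by
  rw [exp_sub, exp_log (by positivity)]
  field_simp

/-- A solution on a disk around a critical point, and the radial solution with the same value at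
the centre, form a `IsBubblePair` in logarithmic polar coordinates. -/
lemma isBubblePair_of_solution {u f : Pt → ℝ} {B : ℝ → ℝ} {c : Pt} {γ μ g r δ K L C₂ : ℝ}
    (hγ : 0 < γ) (hμ : 0 < μ) (hr : 0 < r) (hu : ContDiffOn ℝ (⊤ : ℕ∞) u (ball c (2 * r)))
    (hpos : ∀ x ∈ ball c (2 * r), 0 < u x)
    (heq : ∀ x ∈ ball c (2 * r), lap u x = g * f x * u x * exp (u x ^ 2))
    (huc : u c = γ) (hcrit : fderiv ℝ u c = 0) (hfc : 0 < f c)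
    (hosc : ∀ x ∈ closedBall c r, ‖x - c‖ * u x * ‖fderiv ℝ u x‖ ≤ C₂)
    (hcoeff : ∀ x ∈ ball c (2 * r), |f x - f c| ≤ K * ‖x - c‖) (hL : K * r ≤ L * f c)
    (hB : ContDiff ℝ (⊤ : ℕ∞) B) (hB0 : B 0 = γ) (hB0' : deriv B 0 = 0)
    (hode : ∀ t > (0 : ℝ), deriv (deriv B) t + deriv B t / t = -(g * f c * B t * exp (B t ^ 2)))
    (hμdef : μ ^ 2 * (g * f c * γ ^ 2 * exp (γ ^ 2)) = 1) (hlow : δ * γ ≤ B r) :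
    IsBubblePair δ L C₂ γ (log (r / μ)) (log (2 * r / μ)) (fun s θ => u (c + polarVec μ s θ))
      (fun s θ => fderiv ℝ u (c + polarVec μ s θ) (polarVec μ s θ))
      (fun s θ => fderiv ℝ (fderiv ℝ u) (c + polarVec μ s θ) (polarVec μ s θ) (polarVec μ s θ) +
        fderiv ℝ u (c + polarVec μ s θ) (polarVec μ s θ))
      (fun s θ => fderiv ℝ u (c + polarVec μ s θ) (polarNormal μ s θ))
      (fun s θ => fderiv ℝ (fderiv ℝ u) (c + polarVec μ s θ) (polarNormal μ s θ)
        (polarNormal μ s θ) - fderiv ℝ u (c + polarVec μ s θ) (polarVec μ s θ))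
      (fun s θ => f (c + polarVec μ s θ) / f c)
      (fun s => γ * (γ - B (μ * exp s))) (fun s => -(γ * (μ * exp s) * deriv B (μ * exp s))) := by
  have h2r : 0 < 2 * r := by positivity
  have hlt : log (r / μ) < log (2 * r / μ) :=
    log_lt_log (by positivity) (div_lt_div_of_pos_right (by linarith) hμ)
  have hmem : ∀ s ≤ log (r / μ), ∀ θ, c + polarVec μ s θ ∈ ball c (2 * r) := fun s hs θ =>
    add_polarVec_mem hμ h2r (hs.trans_lt hlt) θ
  have hc : c ∈ ball c (2 * r) := mem_ball_self h2r
  have hu1 : ContDiffOn ℝ (⊤ : ℕ∞) (fderiv ℝ u) (ball c (2 * r)) :=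
    hu.fderiv_of_isOpen isOpen_ball (by simp)
  refine ⟨isPolar_of_contDiffOn hμ h2r hu, ?_, hlt, fun s hs θ => ?_, ?_, ?_,
    fun s hs θ => hpos _ (hmem s hs θ), fun s hs θ => ?_, fun s hs θ => ?_, fun s hs θ => ?_, ?_⟩
  · exact isBubble_of_ode hγ hμ hB hB0 hB0' hode hμdef
  · have hx := hmem s hs θ
    have h1 := lap_mul_sq ((hu1.differentiableOn (by simp)).differentiableAt
      (isOpen_ball.mem_nhds hx)) μ s θ
    rw [heq _ hx] at h1
    have e3 : exp (2 * s) = exp s ^ 2 := by rw [← exp_nat_mul]; norm_num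
    have e4 : exp (-γ ^ 2) = g * f c * γ ^ 2 * μ ^ 2 := by
      rw [exp_neg]
      exact (eq_inv_of_mul_eq_one_left (by linear_combination hμdef)).symm
    rw [e3, e4]
    have e5 : exp s ^ 2 * (f (c + polarVec μ s θ) / f c) * γ⁻¹ ^ 2 * (g * f c * γ ^ 2 * μ ^ 2) =
        (μ * exp s) ^ 2 * (g * f (c + polarVec μ s θ)) := by field_simp
    rw [e5]
    linear_combination h1
  · simpa only [huc] using smallAtBot_sub hμ ((hu.differentiableOn (by simp)).differentiableAt
      (isOpen_ball.mem_nhds hc)) hcrit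
  · exact smallAtBot_fderiv hμ (hu1.continuousOn.continuousAt (isOpen_ball.mem_nhds hc)) hcrit
  · have hle : μ * exp s ≤ r := by
      rw [mul_exp_eq_mul_exp_sub hμ hr s]
      exact mul_le_of_le_one_right hr.le (exp_le_one_iff.2 (by linarith))
    have h1 := hosc (c + polarVec μ s θ) (by
      rwa [mem_closedBall, dist_eq_norm, add_sub_cancel_left, norm_polarVec hμ])
    rw [add_sub_cancel_left, norm_polarVec hμ] at h1
    have h2 := (fderiv ℝ u (c + polarVec μ s θ)).le_opNorm (polarNormal μ s θ)
    rw [norm_polarNormal hμ, Real.norm_eq_abs] at h2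
    calc _ ≤ u (c + polarVec μ s θ) * (‖fderiv ℝ u (c + polarVec μ s θ)‖ * (μ * exp s)) :=
        mul_le_mul_of_nonneg_left h2 (hpos _ (hmem s hs θ)).le
      _ ≤ C₂ := by linarith
  · simp only [polarVec_add_two_pi]
  · have h1 := hcoeff _ (hmem s hs θ)
    rw [add_sub_cancel_left, norm_polarVec hμ, mul_exp_eq_mul_exp_sub hμ hr s] at h1
    rw [div_sub_one hfc.ne', abs_div, abs_of_pos hfc, div_le_iff₀ hfc]
    nlinarith [mul_le_mul_of_nonneg_right hL (exp_pos (s - log (r / μ))).le]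
  · rw [mul_exp_log_div hμ hr]
    nlinarith

lemma two_mul_le_of_le_half_sInf {N : ℕ} {xc : Fin N → Pt} {i : Fin N} {t d : ℝ}
    (hd : 0 ≤ d) (ht : t ≤ (1 / 2) * sInf (insert d {d : ℝ | ∃ j, j ≠ i ∧ d = ‖xc i - xc j‖})) :
    2 * t ≤ d ∧ ∀ j, j ≠ i → 2 * t ≤ ‖xc i - xc j‖ := by
  have hbdd : BddBelow (insert d {d : ℝ | ∃ j, j ≠ i ∧ d = ‖xc i - xc j‖}) := by
    refine ⟨0, ?_⟩
    rintro x (rfl | ⟨j, -, rfl⟩)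
    exacts [hd, norm_nonneg _]
  have h1 := csInf_le hbdd (mem_insert _ _)
  exact ⟨by linarith, fun j hj => by linarith [csInf_le hbdd (mem_insert_of_mem _ ⟨j, hj, rfl⟩)]⟩

lemma norm_sub_le_iInf {N : ℕ} {xc : Fin N → Pt} {i : Fin N} {t : ℝ} {x : Pt}
    (h : ∀ j, j ≠ i → 2 * t ≤ ‖xc i - xc j‖) (hx : ‖x - xc i‖ ≤ t) :
    ‖x - xc i‖ ≤ ⨅ j, ‖xc j - x‖ := by
  have : Nonempty (Fin N) := ⟨i⟩
  refine le_ciInf fun j => ?_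
  by_cases hj : j = i
  · rw [hj, norm_sub_rev]
  · have h1 := h j hj
    have h2 : ‖xc i - xc j‖ ≤ ‖xc j - x‖ + ‖x - xc i‖ := by
      rw [norm_sub_rev (xc i)]
      exact norm_sub_le_norm_sub_add_norm_sub _ _ _
    linarith

lemma norm_gradient (u : Pt → ℝ) (x : Pt) : ‖gradient u x‖ = ‖fderiv ℝ u x‖ := by
  rw [gradient, LinearIsometryEquiv.norm_map]

lemma Ustd_exp_smul_mkPt (s θ : ℝ) :
    Ustd (exp s • mkPt (cos θ) (sin θ)) = -limProfile s := by
  rw [Ustd, limProfile, norm_smul, norm_mkPt, cos_sq_add_sin_sq, sqrt_one, mul_one,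
    Real.norm_eq_abs, abs_of_pos (exp_pos s), ← exp_nat_mul]
  norm_num

/-- Local convergence to the standard profile, in logarithmic polar coordinates. -/
lemma eventually_close_limProfile {u : ℕ → Pt → ℝ} {c : ℕ → Pt} {γ μ : ℕ → ℝ}
    (h : TendstoCkLocOn (fun n x => γ n * (u n (c n + μ n • x) - γ n)) Ustd univ 2)
    (ρ : ℝ) {η : ℝ} (hη : 0 < η) :
    ∀ᶠ n in atTop, ∀ s ≤ ρ, ∀ θ,
      |γ n * (u n (c n + polarVec (μ n) s θ) - γ n) + limProfile s| ≤ η := by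
  have h0 := (tendstoLocallyUniformlyOn_iff_forall_isCompact isOpen_univ).1 (h 0 (by norm_num))
    (closedBall 0 (exp ρ)) (subset_univ _) (isCompact_closedBall _ _)
  filter_upwards [Metric.tendstoUniformlyOn_iff.1 h0 η hη] with n hn s hs θ
  have h1 := hn (exp s • mkPt (cos θ) (sin θ)) (by
    rw [mem_closedBall_zero_iff, norm_smul, norm_mkPt, cos_sq_add_sin_sq, sqrt_one, mul_one,
      Real.norm_eq_abs, abs_of_pos (exp_pos s)]
    exact exp_le_exp.2 hs)
  rw [dist_comm, dist_iteratedFDeriv_zero, Ustd_exp_smul_mkPt, smul_smul, sub_neg_eq_add] at h1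
  exact h1.le

lemma abs_sub_le_div_of_polar {u : Pt → ℝ} {B : ℝ → ℝ} {c : Pt} {γ μ r A : ℝ} (hγ : 0 < γ)
    (hμ : 0 < μ) (hA : 0 ≤ A) (huc : u c = γ) (hB0 : B 0 = γ)
    (h : ∀ s ≤ log (r / μ), ∀ θ,
      |γ * (u (c + polarVec μ s θ) - γ) + γ * (γ - B (μ * exp s))| ≤ A) :
    ∀ x ∈ ball c r, |u x - B ‖x - c‖| ≤ A / γ := by
  intro x hx
  rw [mem_ball, dist_eq_norm] at hx
  rcases (norm_nonneg (x - c)).eq_or_lt with h0 | h0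
  · rw [← h0, hB0, sub_eq_zero.1 (norm_eq_zero.1 h0.symm), huc, sub_self, abs_zero]
    positivity
  · obtain ⟨θ, hθ⟩ := exists_polar (x - c)
    have h1 := h (log (‖x - c‖ / μ)) (log_le_log (by positivity)
      (div_le_div_of_nonneg_right hx.le hμ.le)) θ
    rw [polarVec, mul_exp_log_div hμ h0, ← hθ, add_sub_cancel] at h1
    rw [le_div_iff₀ hγ]
    calc _ = |γ * (u x - γ) + γ * (γ - B ‖x - c‖)| := by
          rw [← abs_of_pos hγ, ← abs_mul, abs_of_pos hγ]; congr 1; ring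
      _ ≤ A := h1

lemma abs_sphAvg_sub_le {u : Pt → ℝ} {c : Pt} {γ μ r b A : ℝ} (hγ : 0 < γ) (hμ : 0 < μ)
    (hr : 0 < r)
    (hcont : Continuous fun θ => u (c + polarVec μ (log (r / μ)) θ))
    (h : |∫ θ in 0..2 * π, (γ * (u (c + polarVec μ (log (r / μ)) θ) - γ) + γ * (γ - b))| ≤ A) :
    |sphAvg u c r - b| ≤ A / γ := by
  have e : (∫ θ in 0..2 * π, (γ * (u (c + polarVec μ (log (r / μ)) θ) - γ) + γ * (γ - b))) =
      γ * (2 * π) * (sphAvg u c r - b) := by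
    have e1 : ∀ θ, γ * (u (c + polarVec μ (log (r / μ)) θ) - γ) + γ * (γ - b) =
        γ * u (c + polarVec μ (log (r / μ)) θ) - γ * b := fun θ => by ring
    simp only [e1]
    rw [intervalIntegral.integral_sub ((hcont.const_mul γ).intervalIntegrable _ _)
      intervalIntegrable_const, intervalIntegral.integral_const_mul,
      intervalIntegral.integral_const, sphAvg]
    simp only [polarVec, mul_exp_log_div hμ hr, smul_eq_mul]
    field_simp
    ring
  rw [e, abs_mul, abs_of_pos (by positivity)] at h
  rw [le_div_iff₀ hγ]
  nlinarith [abs_nonneg (sphAvg u c r - b), pi_gt_three,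
    mul_nonneg (mul_nonneg hγ.le (abs_nonneg (sphAvg u c r - b)))
      (by linarith [pi_gt_three] : 0 ≤ 2 * π - 1)]

theorem stmt8
    (Ω : Set Pt) (hΩo : IsOpen Ω) (hΩb : Bornology.IsBounded Ω) (hΩne : Ω.Nonempty)
    (lam : ℕ → ℝ) (hlam : ∀ n, 0 < lam n)
    (f : ℕ → Pt → ℝ) (f₀ : Pt → ℝ)
    (hfs : ∀ n, ContDiffOn ℝ (⊤ : ℕ∞) (f n) (closure Ω))
    (hf₀s : ContDiffOn ℝ (⊤ : ℕ∞) f₀ (closure Ω))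
    (hf₀pos : ∀ x ∈ closure Ω, 0 < f₀ x)
    (hfc : TendstoCkOn f f₀ (closure Ω) 1)
    (hf2 : ∃ K : ℝ, ∀ n, ∀ x ∈ Ω, ‖iteratedFDeriv ℝ 2 (f n) x‖ ≤ K)
    (u : ℕ → Pt → ℝ)
    (hus : ∀ n, ContDiffOn ℝ (⊤ : ℕ∞) (u n) (closure Ω))
    (hup : ∀ n, ∀ x ∈ Ω, 0 < u n x)
    (hueq : ∀ n, ∀ x ∈ Ω, lap (u n) x = lam n * f n x * u n x * Real.exp ((u n x) ^ 2))
    (hubd : ∀ n, ∀ x ∈ frontier Ω, u n x = 0)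
    (C : ℝ) (hC : ∀ n, (∫ x in Ω, ‖gradient (u n) x‖ ^ 2) ≤ C)
    (N : ℕ) (hN : 1 ≤ N)
    (xc : Fin N → ℕ → Pt) (hxc : ∀ i n, xc i n ∈ Ω)
    (γ : Fin N → ℕ → ℝ) (hγdef : ∀ i n, γ i n = u n (xc i n))
    (hγ : ∀ i, Tendsto (γ i) atTop atTop)
    (hcrit : ∀ i n, gradient (u n) (xc i n) = 0)
    (μ : Fin N → ℕ → ℝ) (hμpos : ∀ i n, 0 < μ i n)
    (hμdef : ∀ i n,
      (μ i n) ^ 2 * (lam n * f n (xc i n) * (γ i n) ^ 2 * Real.exp ((γ i n) ^ 2)) = 1)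
    (hμinf : ∀ i, Tendsto (fun n => ((μ i n) ^ 2)⁻¹) atTop atTop)
    (hsep : ∀ i j, i ≠ j → Tendsto (fun n => ‖xc i n - xc j n‖ / μ i n) atTop atTop)
    (hconv : ∀ i, TendstoCkLocOn
      (fun n x => γ i n * (u n (xc i n + μ i n • x) - γ i n)) Ustd Set.univ 2)
    (C₁ : ℝ) (hC₁ : ∀ n, ∀ x ∈ Ω,
      lam n * (⨅ i, ‖xc i n - x‖) ^ 2 * (u n x) ^ 2 * Real.exp ((u n x) ^ 2) ≤ C₁)
    (C₂ : ℝ) (hC₂ : ∀ n, ∀ x ∈ Ω,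
      (⨅ i, ‖xc i n - x‖) * u n x * ‖gradient (u n) x‖ ≤ C₂)
    (rad : Fin N → ℕ → ℝ)
    (hrad : ∀ i n, rad i n = (1 / 2) * sInf (insert (Metric.infDist (xc i n) (frontier Ω))
      {d : ℝ | ∃ j, j ≠ i ∧ d = ‖xc i n - xc j n‖}))
    (Bub : Fin N → ℕ → ℝ → ℝ)
    (hBs : ∀ i n, ContDiff ℝ (⊤ : ℕ∞) (Bub i n))
    (hB0 : ∀ i n, Bub i n 0 = γ i n) (hB0' : ∀ i n, deriv (Bub i n) 0 = 0)
    (hBode : ∀ i n, ∀ r > (0 : ℝ), deriv (deriv (Bub i n)) r + deriv (Bub i n) r / r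
      = -(lam n * f n (xc i n) * Bub i n r * Real.exp ((Bub i n r) ^ 2)))
    (i : Fin N) (r : ℕ → ℝ)
    (hrpos : ∀ n, 0 < r n) (hrle : ∀ n, r n ≤ rad i n)
    (hrball : ∀ n, ball (xc i n) (r n) ⊆ Ω)
    (δ : ℝ) (hδ : 0 < δ) (hBlower : ∀ n, δ * γ i n ≤ Bub i n (r n)) :
    (∃ Cc : ℝ, 0 < Cc ∧ ∀ᶠ n in atTop, ∀ x ∈ ball (xc i n) (r n),
      |u n x - Bub i n ‖x - xc i n‖| ≤ Cc / γ i n) ∧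
    (∀ δ' > (0 : ℝ), ∀ᶠ n in atTop,
      |sphAvg (u n) (xc i n) (r n) - Bub i n (r n)| ≤ δ' / γ i n) := by
  obtain ⟨a, ha, K, hK, hcoeff⟩ := exists_coeff_bound hΩo hΩb hΩne hfs hf₀s hf₀pos hfc
  have hgeom : ∀ n, 2 * r n ≤ infDist (xc i n) (frontier Ω) ∧
      ∀ j, j ≠ i → 2 * r n ≤ ‖xc i n - xc j n‖ := fun n =>
    two_mul_le_of_le_half_sInf (xc := fun j => xc j n) infDist_nonneg
      ((hrle n).trans_eq (hrad i n))
  have hball : ∀ n, ball (xc i n) (2 * r n) ⊆ Ω := fun n =>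
    (ball_subset_ball (hgeom n).1).trans (ball_infDist_frontier_subset hΩo (hxc i n))
  obtain ⟨R₀, hR₀⟩ : ∃ R₀, ∀ n, r n ≤ R₀ := by
    obtain ⟨M, hM⟩ := isBounded_iff.1 hΩb
    refine ⟨M, fun n => ?_⟩
    have h1 : xc i n + r n • mkPt 1 0 ∈ ball (xc i n) (2 * r n) := by
      rw [mem_ball, dist_eq_norm, add_sub_cancel_left, norm_smul, norm_mkPt, Real.norm_eq_abs,
        abs_of_pos (hrpos n)]
      norm_num
      linarith [hrpos n]
    have h2 := hM (hball n h1) (hxc i n)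
    rw [dist_eq_norm, add_sub_cancel_left, norm_smul, norm_mkPt, Real.norm_eq_abs,
      abs_of_pos (hrpos n)] at h2
    norm_num at h2
    exact h2
  have hR₀0 : 0 ≤ R₀ := (hrpos 0).le.trans (hR₀ 0)
  obtain ⟨C₄, hC₄, H⟩ := bubble_comparison (δ := min δ (1 / 2)) (L := K * R₀ / a)
    (C₂ := max C₂ 0) (by positivity) (min_le_right _ _) (by positivity) (le_max_right _ _)
  have key : ∀ δ' > 0, δ' ≤ 1 / 2 → ∀ᶠ n in atTop, 0 < γ i n ∧
      (∀ s ≤ log (r n / μ i n), ∀ θ, |γ i n * (u n (xc i n + polarVec (μ i n) s θ) - γ i n) +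
        γ i n * (γ i n - Bub i n (μ i n * exp s))| ≤ C₄) ∧
      |∫ θ in 0..2 * π, (γ i n * (u n (xc i n + polarVec (μ i n) (log (r n / μ i n)) θ) - γ i n) +
        γ i n * (γ i n - Bub i n (r n)))| ≤ δ' := by
    intro δ' hδ' hδ'2
    obtain ⟨Γ, hΓ, ρ, η, hη, H1⟩ := H δ' hδ' hδ'2
    filter_upwards [(hγ i).eventually_ge_atTop Γ, eventually_close_limProfile (hconv i) ρ hη,
      hcoeff] with n hγn hcl hco
    have hγ0 : 0 < γ i n := by linarith
    have hfa := (hco _ _ (hball n) _ (mem_ball_self (by linarith [hrpos n]))).1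
    have hpair := isBubblePair_of_solution (δ := min δ (1 / 2)) (L := K * R₀ / a)
      (C₂ := max C₂ 0) (K := K) (g := lam n) hγ0 (hμpos i n) (hrpos n)
      ((hus n).mono ((hball n).trans subset_closure)) (fun x hx => hup n x (hball n hx))
      (fun x hx => hueq n x (hball n hx)) (hγdef i n).symm
      (norm_eq_zero.1 (by rw [← norm_gradient, hcrit i n, norm_zero])) (ha.trans_le hfa)
      (fun x hx => by
        have hxr : ‖x - xc i n‖ ≤ r n := by rwa [mem_closedBall, dist_eq_norm] at hx
        have hxΩ : x ∈ Ω := hball n (closedBall_subset_ball (by linarith [hrpos n]) hx)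
        rw [← norm_gradient]
        refine le_trans ?_ ((hC₂ n x hxΩ).trans (le_max_left _ _))
        have := norm_sub_le_iInf (xc := fun j => xc j n) (hgeom n).2 hxr
        have := (hup n x hxΩ).le
        gcongr)
      (fun x hx => (hco _ _ (hball n) _ hx).2)
      (by
        calc K * r n ≤ K * R₀ := mul_le_mul_of_nonneg_left (hR₀ n) hK
          _ = K * R₀ / a * a := by field_simp
          _ ≤ K * R₀ / a * f n (xc i n) := mul_le_mul_of_nonneg_left hfa (by positivity))
      (hBs i n) (hB0 i n) (hB0' i n) (hBode i n) (hμdef i n)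
      ((mul_le_mul_of_nonneg_right (min_le_left _ _) hγ0.le).trans (hBlower n))
    have h2 := H1 _ hγn _ _ _ _ _ _ _ _ _ _ hpair hcl
    simp only [mul_exp_log_div (hμpos i n) (hrpos n)] at h2
    exact ⟨hγ0, h2⟩
  refine ⟨⟨C₄, hC₄, ?_⟩, fun δ' hδ' => ?_⟩
  · filter_upwards [key (1 / 2) (by norm_num) le_rfl] with n hn
    exact abs_sub_le_div_of_polar hn.1 (hμpos i n) hC₄.le (hγdef i n).symm (hB0 i n) hn.2.1
  · filter_upwards [key (min δ' (1 / 2)) (by positivity) (min_le_right _ _)] with n hn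
    have h2r : 0 < 2 * r n := by linarith [hrpos n]
    have hpol := isPolar_of_contDiffOn (hμpos i n) h2r
      ((hus n).mono ((hball n).trans subset_closure))
    refine (abs_sphAvg_sub_le hn.1 (hμpos i n) (hrpos n) (continuous_slice
      (log_lt_log (div_pos (hrpos n) (hμpos i n))
        (div_lt_div_of_pos_right (by linarith [hrpos n]) (hμpos i n))) hpol.c0) hn.2.2).trans ?_
    exact div_le_div_of_nonneg_right (min_le_left _ _) hn.1.le

end
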